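/- Let $\alpha_1,\dots,\alpha_d$ be real algebraic numbers such that $1,\alpha_1,\dots,\alpha_d$ are linearly independent over $\mathbb{Q}$. Then for every $\varepsilon>0$ there is a constant $K$ (depending on the $\alpha_i$ and $\varepsilon$) such that $\sum_{m=1}^{M}\frac{1}{\|m\alpha_1\|\cdots\|m\alpha_d\|}\le K\, M^{2-\frac{1}{d}+\varepsilon}$ for all $M\ge 1$. -/

import Mathlib

namespace SchmidtPf
open MvPolynomial Finset

noncomputable section

/-! ### l1 norm of polynomials -/
section l1
variable {σ τ A B : Type*} [SeminormedCommRing A]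

/-- sum of the norms of the coefficients -/
def l1 (f : MvPolynomial σ A) : ℝ := ∑ e ∈ f.support, ‖f.coeff e‖

lemma l1_nonneg (f : MvPolynomial σ A) : 0 ≤ l1 f := sum_nonneg fun _ _ => norm_nonneg _

lemma l1_eq_of_subset (f : MvPolynomial σ A) {s : Finset (σ →₀ ℕ)} (h : f.support ⊆ s) :
    l1 f = ∑ e ∈ s, ‖f.coeff e‖ := by
  refine sum_subset h fun e _ he => ?_
  rw [notMem_support_iff.1 he, norm_zero]

lemma coeff_le_l1 (f : MvPolynomial σ A) (e : σ →₀ ℕ) : ‖f.coeff e‖ ≤ l1 f := by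
  classical
  by_cases h : e ∈ f.support
  · exact single_le_sum (f := fun e => ‖f.coeff e‖) (fun _ _ => norm_nonneg _) h
  · rw [notMem_support_iff.1 h, norm_zero]; exact l1_nonneg f

@[simp] lemma l1_zero : l1 (0 : MvPolynomial σ A) = 0 := by simp [l1]

lemma l1_add_le (f g : MvPolynomial σ A) : l1 (f + g) ≤ l1 f + l1 g := by
  classical
  rw [l1_eq_of_subset (f + g) (support_add), l1_eq_of_subset f (s := f.support ∪ g.support)
    subset_union_left, l1_eq_of_subset g (s := f.support ∪ g.support) subset_union_right,
    ← sum_add_distrib]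
  exact sum_le_sum fun e _ => by rw [coeff_add]; exact norm_add_le _ _

lemma l1_sum_le {ι : Type*} (s : Finset ι) (f : ι → MvPolynomial σ A) :
    l1 (∑ i ∈ s, f i) ≤ ∑ i ∈ s, l1 (f i) := by
  classical
  induction s using Finset.induction_on with
  | empty => simp
  | insert a s ha ih => rw [sum_insert ha, sum_insert ha]; exact (l1_add_le _ _).trans (by gcongr)

lemma l1_monomial (e : σ →₀ ℕ) (a : A) : l1 (monomial e a) = ‖a‖ := by
  classical
  rw [l1_eq_of_subset _ (s := {e}) (support_monomial_subset)]; simp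

lemma l1_C (a : A) : l1 (C a : MvPolynomial σ A) = ‖a‖ := l1_monomial _ _

lemma l1_X [NormOneClass A] (i : σ) : l1 (X i : MvPolynomial σ A) = 1 := by
  rw [X, l1_monomial, norm_one]

lemma l1_mul_le (f g : MvPolynomial σ A) : l1 (f * g) ≤ l1 f * l1 g := by
  classical
  have : f * g = ∑ p ∈ f.support ×ˢ g.support, monomial (p.1 + p.2) (f.coeff p.1 * g.coeff p.2) := by
    conv_lhs => rw [f.as_sum, g.as_sum]
    rw [sum_mul_sum, sum_product]
    simp [monomial_mul]
  rw [this]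
  refine (l1_sum_le _ _).trans ?_
  rw [l1, l1, sum_mul_sum, ← sum_product']
  exact sum_le_sum fun p _ => by rw [l1_monomial]; exact norm_mul_le _ _

variable [NormOneClass A]

lemma l1_one : l1 (1 : MvPolynomial σ A) = 1 := by
  rw [← C_1, l1_C, norm_one]

lemma l1_pow_le (f : MvPolynomial σ A) (n : ℕ) : l1 (f ^ n) ≤ l1 f ^ n := by
  induction n with
  | zero => simp [l1_one]
  | succ n ih =>
    rw [pow_succ, pow_succ]
    exact (l1_mul_le _ _).trans (mul_le_mul_of_nonneg_right ih (l1_nonneg _))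

lemma l1_prod_le {ι : Type*} (s : Finset ι) (f : ι → MvPolynomial σ A) :
    l1 (∏ i ∈ s, f i) ≤ ∏ i ∈ s, l1 (f i) := by
  classical
  induction s using Finset.induction_on with
  | empty => simp [l1_one]
  | insert a s ha ih =>
    rw [prod_insert ha, prod_insert ha]
    exact (l1_mul_le _ _).trans (mul_le_mul_of_nonneg_left ih (l1_nonneg _))

lemma l1_eval₂_le [CommSemiring B] [Fintype τ] (φ : B →+* A) (g : τ → MvPolynomial σ A)
    (P : MvPolynomial τ B) :
    l1 (eval₂Hom (C.comp φ) g P) ≤ ∑ I ∈ P.support, ‖φ (P.coeff I)‖ * ∏ i, l1 (g i) ^ I i := by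
  rw [coe_eval₂Hom, eval₂_eq']
  refine (l1_sum_le _ _).trans (sum_le_sum fun I _ => ?_)
  refine (l1_mul_le _ _).trans ?_
  rw [RingHom.comp_apply, l1_C]
  gcongr
  refine (l1_prod_le _ _).trans (prod_le_prod (fun _ _ => l1_nonneg _) fun i _ => l1_pow_le _ _)

lemma l1_det_le {n : ℕ} (M : Matrix (Fin n) (Fin n) (MvPolynomial σ A)) (b : ℝ)
    (hM : ∀ i j, l1 (M i j) ≤ b) : l1 M.det ≤ n.factorial * b ^ n := by
  rw [Matrix.det_apply']
  refine (l1_sum_le _ _).trans ?_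
  calc _ ≤ ∑ _π : Equiv.Perm (Fin n), b ^ n := by
        refine sum_le_sum fun π _ => ?_
        have h1 : l1 (∏ i, M (π i) i) ≤ b ^ n := by
          refine (l1_prod_le _ _).trans ?_
          calc _ ≤ ∏ _i : Fin n, b := prod_le_prod (fun _ _ => l1_nonneg _) fun i _ => hM _ _
            _ = _ := by simp
        rcases Int.units_eq_one_or (Equiv.Perm.sign π) with h | h
        · simpa [h] using h1
        · simpa [h, l1] using h1
    _ = _ := by simp [Fintype.card_perm]

end l1

lemma one_le_l1_int {σ : Type*} {P : MvPolynomial σ ℤ} (hP : P ≠ 0) : 1 ≤ l1 P := by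
  obtain ⟨e, he⟩ := MvPolynomial.ne_zero_iff.1 hP
  refine le_trans ?_ (coeff_le_l1 P e)
  rw [Int.norm_eq_abs]
  exact_mod_cast Int.one_le_abs he

/-! ### Hasse derivatives and index -/
section hasse
variable {σ : Type*} {R S : Type*} [CommRing R] [CommRing S]

/-- Taylor map `P(x) ↦ P(x+y)` -/
def tay : MvPolynomial σ R →+* MvPolynomial σ (MvPolynomial σ R) :=
  eval₂Hom (C.comp C) (fun i => X i + C (X i))

/-- Hasse derivative -/
def hasse (Δ : σ →₀ ℕ) (f : MvPolynomial σ R) : MvPolynomial σ R := (tay f).coeff Δ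

/-- shift by ξ -/
def shift (ξ : σ → R) : MvPolynomial σ R →+* MvPolynomial σ R :=
  eval₂Hom C (fun i => X i + C (ξ i))

lemma hasse_add (Δ : σ →₀ ℕ) (f g : MvPolynomial σ R) : hasse Δ (f + g) = hasse Δ f + hasse Δ g := by
  simp [hasse]

lemma hasse_sum {ι : Type*} (Δ : σ →₀ ℕ) (s : Finset ι) (f : ι → MvPolynomial σ R) :
    hasse Δ (∑ i ∈ s, f i) = ∑ i ∈ s, hasse Δ (f i) := by
  simp [hasse, coeff_sum]

lemma hasse_C_mul (Δ : σ →₀ ℕ) (a : R) (f : MvPolynomial σ R) :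
    hasse Δ (C a * f) = C a * hasse Δ f := by
  have : tay (C a : MvPolynomial σ R) = C (C a) := by simp [tay]
  simp [hasse, this, coeff_C_mul]

lemma hasse_shift (ξ : σ → R) (Δ : σ →₀ ℕ) (f : MvPolynomial σ R) :
    hasse Δ (shift ξ f) = shift ξ (hasse Δ f) := by
  have : (tay (σ := σ)).comp (shift ξ) = (MvPolynomial.map (shift ξ)).comp tay := by
    apply MvPolynomial.ringHom_ext
    · intro r; simp [tay, shift]
    · intro i; simp [tay, shift]; ring
  have h2 := congrArg (coeff Δ) (congrArg (fun φ => φ f) this)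
  simpa [hasse, coeff_map] using h2

lemma hasse_map (φ : R →+* S) (Δ : σ →₀ ℕ) (f : MvPolynomial σ R) :
    hasse Δ (MvPolynomial.map φ f) = MvPolynomial.map φ (hasse Δ f) := by
  have : (tay (σ := σ)).comp (MvPolynomial.map φ) =
      (MvPolynomial.map (MvPolynomial.map φ)).comp tay := by
    apply MvPolynomial.ringHom_ext
    · intro r; simp [tay]
    · intro i; simp [tay]
  have h2 := congrArg (coeff Δ) (congrArg (fun φ => φ f) this)
  simpa [hasse, coeff_map] using h2

/-- multi-binomial -/
def mbin [Fintype σ] (e Δ : σ →₀ ℕ) : ℕ := ∏ i, (e i).choose (Δ i)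

lemma hasse_monomial [Fintype σ] (Δ e : σ →₀ ℕ) (a : R) :
    hasse Δ (monomial e a) = monomial (e - Δ) (mbin e Δ * a) := by
  classical
  have h1 : tay (monomial e a : MvPolynomial σ R) =
      C (C a) * ∏ i, (X i + C (X i)) ^ e i := by
    rw [tay, coe_eval₂Hom, eval₂_monomial, Finsupp.prod_fintype _ _ (by simp)]; rfl
  have h2 : ∏ i, ((X i : MvPolynomial σ (MvPolynomial σ R)) + C (X i)) ^ e i =
      ∑ k ∈ Fintype.piFinset (fun i => range (e i + 1)),
        monomial (Finsupp.equivFunOnFinite.symm k)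
          (∏ i, (X i ^ (e i - k i) * ((e i).choose (k i) : MvPolynomial σ R))) := by
    simp_rw [add_pow]
    rw [prod_univ_sum]
    refine sum_congr rfl fun k _ => ?_
    have : ∀ i, (X i : MvPolynomial σ (MvPolynomial σ R)) ^ k i * C (X i) ^ (e i - k i) *
        ((e i).choose (k i) : MvPolynomial σ (MvPolynomial σ R)) =
        X i ^ k i * C (X i ^ (e i - k i) * ((e i).choose (k i) : MvPolynomial σ R)) := by
      intro i; simp [mul_assoc]
    rw [prod_congr rfl fun i _ => this i, prod_mul_distrib, ← map_prod, monomial_eq, mul_comm]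
    congr 1
    rw [Finsupp.prod_fintype _ _ (by simp)]; simp
  rw [hasse, h1, coeff_C_mul, h2, coeff_sum]
  simp_rw [coeff_monomial]
  have hmono : ∀ x : σ → ℕ, (∏ i, (X i : MvPolynomial σ R) ^ x i) =
      monomial (Finsupp.equivFunOnFinite.symm x) 1 := by
    intro x
    rw [monomial_eq, Finsupp.prod_fintype _ _ (by simp)]; simp
  by_cases hle : ∀ i, Δ i ≤ e i
  · rw [sum_eq_single (Δ : σ → ℕ)]
    · rw [if_pos (by ext; simp), prod_mul_distrib, hmono, ← Nat.cast_prod]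
      have : (Finsupp.equivFunOnFinite.symm fun i => e i - Δ i) = e - Δ := by ext; simp
      rw [this, mbin, ← map_natCast (C (σ := σ) (R := R)), mul_comm (monomial _ _), C_mul_monomial,
        C_mul_monomial]
      congr 1; ring
    · intro k _ hk
      rw [if_neg]; rintro rfl; exact hk (by ext; simp)
    · intro h; exfalso; apply h; simp [Nat.lt_succ_iff, hle]
  · push Not at hle
    obtain ⟨i, hi⟩ := hle
    have : mbin e Δ = 0 := prod_eq_zero (mem_univ i) (Nat.choose_eq_zero_of_lt hi)
    rw [this]
    rw [sum_eq_zero, mul_zero]; · simp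
    intro k hk
    rw [if_neg]
    rintro rfl
    simp only [Fintype.mem_piFinset, mem_range] at hk
    have := hk i
    simp at hi
    omega

lemma hasse_eq [Fintype σ] (Δ : σ →₀ ℕ) (f : MvPolynomial σ R) :
    hasse Δ f = ∑ e ∈ f.support, monomial (e - Δ) (mbin e Δ * f.coeff e) := by
  conv_lhs => rw [f.as_sum]
  rw [hasse_sum]
  exact sum_congr rfl fun e _ => hasse_monomial _ _ _

lemma hasse_coeff_ne [Fintype σ] {Δ e : σ →₀ ℕ} {f : MvPolynomial σ R}
    (h : (hasse Δ f).coeff e ≠ 0) : f.coeff (e + Δ) ≠ 0 := by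
  classical
  rw [hasse_eq, coeff_sum] at h
  obtain ⟨e', he', h'⟩ := exists_ne_zero_of_sum_ne_zero h
  rw [coeff_monomial] at h'
  split_ifs at h' with h''
  · have hle : Δ ≤ e' := by
      by_contra hc
      obtain ⟨i, hi⟩ := not_forall.1 (fun hh => hc (Finsupp.le_def.2 hh))
      apply h'
      rw [mbin, prod_eq_zero (mem_univ i) (Nat.choose_eq_zero_of_lt (not_le.1 hi))]; simp
    rw [← h'', tsub_add_cancel_of_le hle]
    exact mem_support_iff.1 he'
  · exact absurd rfl h'

lemma hasse_degreeOf_le [Fintype σ] (Δ : σ →₀ ℕ) (f : MvPolynomial σ R) (i : σ) :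
    (hasse Δ f).degreeOf i ≤ f.degreeOf i := by
  rw [degreeOf_le_iff]
  intro e he
  have := hasse_coeff_ne (mem_support_iff.1 he)
  have := (degreeOf_le_iff.1 (le_refl (f.degreeOf i))) _ (mem_support_iff.2 this)
  simp at this; omega

lemma l1_hasse_le [Fintype σ] (Δ : σ →₀ ℕ) (f : MvPolynomial σ ℤ) (D : ℕ)
    (hD : ∀ e ∈ f.support, ∑ i, e i ≤ D) : l1 (hasse Δ f) ≤ 2 ^ D * l1 f := by
  rw [hasse_eq]
  refine (l1_sum_le _ _).trans ?_
  rw [l1, mul_sum]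
  refine sum_le_sum fun e he => ?_
  rw [l1_monomial, norm_mul]
  gcongr
  have : mbin e Δ ≤ 2 ^ D := by
    calc mbin e Δ ≤ ∏ i, 2 ^ (e i) := prod_le_prod' fun i _ => Nat.choose_le_two_pow _ _
      _ = 2 ^ ∑ i, e i := by rw [prod_pow_eq_pow_sum]
      _ ≤ _ := Nat.pow_le_pow_right (by norm_num) (hD e he)
  simp only [Int.norm_eq_abs, Int.cast_natCast, Nat.abs_cast]
  exact_mod_cast this

/-- weighted index at ξ -/
def IdxGE [Fintype σ] (ξ : σ → R) (w : σ → ℝ) (θ : ℝ) (f : MvPolynomial σ R) : Prop :=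
  ∀ e, (shift ξ f).coeff e ≠ 0 → θ ≤ ∑ i, e i * w i

variable [Fintype σ] {ξ : σ → R} {w : σ → ℝ}

lemma IdxGE.hasse {θ : ℝ} {f : MvPolynomial σ R} (h : IdxGE ξ w θ f) (Δ : σ →₀ ℕ) :
    IdxGE ξ w (θ - ∑ i, Δ i * w i) (hasse Δ f) := by
  intro e he
  rw [← hasse_shift] at he
  have := h _ (hasse_coeff_ne he)
  simp only [Finsupp.add_apply, Nat.cast_add, add_mul, sum_add_distrib] at this
  linarith

lemma idxGE_zero (hw : ∀ i, 0 ≤ w i) (f : MvPolynomial σ R) : IdxGE ξ w 0 f := fun e _ =>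
  sum_nonneg fun i _ => mul_nonneg (Nat.cast_nonneg _) (hw i)

lemma IdxGE.mono {θ θ' : ℝ} {f : MvPolynomial σ R} (h : IdxGE ξ w θ f) (hh : θ' ≤ θ) :
    IdxGE ξ w θ' f := fun e he => hh.trans (h e he)

lemma IdxGE.mul {a b : ℝ} {f g : MvPolynomial σ R} (hf : IdxGE ξ w a f) (hg : IdxGE ξ w b g) :
    IdxGE ξ w (a + b) (f * g) := by
  classical
  intro e he
  rw [map_mul, coeff_mul] at he
  obtain ⟨p, hp, h⟩ := exists_ne_zero_of_sum_ne_zero he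
  have h1 := hf _ (left_ne_zero_of_mul h)
  have h2 := hg _ (right_ne_zero_of_mul h)
  rw [← mem_antidiagonal.1 hp]
  simp only [Finsupp.add_apply, Nat.cast_add, add_mul, sum_add_distrib]
  linarith

lemma IdxGE.sum {ι : Type*} {a : ℝ} {s : Finset ι} {f : ι → MvPolynomial σ R}
    (hf : ∀ i ∈ s, IdxGE ξ w a (f i)) : IdxGE ξ w a (∑ i ∈ s, f i) := by
  intro e he
  rw [map_sum, coeff_sum] at he
  obtain ⟨i, hi, h⟩ := exists_ne_zero_of_sum_ne_zero he
  exact hf i hi _ h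

lemma IdxGE.prod {ι : Type*} {a : ι → ℝ} {s : Finset ι} {f : ι → MvPolynomial σ R}
    (hw : ∀ i, 0 ≤ w i)
    (hf : ∀ i ∈ s, IdxGE ξ w (a i) (f i)) : IdxGE ξ w (∑ i ∈ s, a i) (∏ i ∈ s, f i) := by
  classical
  induction s using Finset.induction_on with
  | empty => simpa using idxGE_zero hw 1
  | insert i s hi ih =>
    rw [sum_insert hi, prod_insert hi]
    exact (hf i (by simp)).mul (ih fun j hj => hf j (by simp [hj]))

lemma IdxGE.det {n : ℕ} {M : Matrix (Fin n) (Fin n) (MvPolynomial σ R)} {a : Fin n → ℝ}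
    (hw : ∀ i, 0 ≤ w i) (h : ∀ i j, IdxGE ξ w (a j) (M i j)) :
    IdxGE ξ w (∑ j, a j) M.det := by
  rw [Matrix.det_apply]
  refine IdxGE.sum fun π _ => ?_
  have h1 : IdxGE ξ w (∑ j, a j) (∏ i, M (π i) i) := IdxGE.prod hw fun i _ => h _ _
  rcases Int.units_eq_one_or (Equiv.Perm.sign π) with h | h
  · simpa [h] using h1
  · intro e he; apply h1 e; simpa [h] using he

end hasse

end

end SchmidtPf


namespace SchmidtPf
open MvPolynomial Finset

noncomputable section

/-! ### Wronskians -/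

/-- Euler operator -/
def eul : Polynomial ℚ →ₗ[ℚ] Polynomial ℚ :=
  (LinearMap.mulLeft ℚ (Polynomial.X : Polynomial ℚ)).comp Polynomial.derivative

lemma eul_coeff (f : Polynomial ℚ) (n : ℕ) : (eul f).coeff n = n * f.coeff n := by
  cases n with
  | zero => simp [eul]
  | succ n =>
    simp [eul, Polynomial.coeff_X_mul, Polynomial.coeff_derivative]; ring

lemma eul_pow_coeff (μ : ℕ) (f : Polynomial ℚ) (n : ℕ) :
    ((eul ^ μ) f).coeff n = (n : ℚ) ^ μ * f.coeff n := by
  induction μ with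
  | zero => simp
  | succ μ ih => rw [pow_succ', Module.End.mul_apply, eul_coeff, ih]; ring

lemma wronsk_uni {n : ℕ} (f : Fin n → Polynomial ℚ) (hf : LinearIndependent ℚ f) :
    (Matrix.of fun (μ ν : Fin n) => (eul ^ (μ : ℕ)) (f ν)).det ≠ 0 := by
  intro hdet
  obtain ⟨c, hc0, hc⟩ := Matrix.exists_vecMul_eq_zero_iff.2 hdet
  have hc' : ∀ ν, ∑ μ, c μ * (eul ^ (μ : ℕ)) (f ν) = 0 := by
    intro ν
    have := congrFun hc ν
    simpa [Matrix.vecMul, dotProduct] using this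
  have hn : (univ : Finset (Fin n)).Nonempty := by
    by_contra h
    rw [not_nonempty_iff_eq_empty] at h
    apply hc0; ext1 i; exact absurd (mem_univ i) (by simp [h])
  set d := univ.sup fun μ => (c μ).natDegree with hd
  have hdle : ∀ μ, (c μ).natDegree ≤ d := fun μ => le_sup (f := fun μ => (c μ).natDegree) (mem_univ μ)
  set χ : Polynomial ℚ := ∑ μ : Fin n, Polynomial.C ((c μ).coeff d) * Polynomial.X ^ (μ : ℕ) with hχ
  have hχc : ∀ μ : Fin n, χ.coeff μ = (c μ).coeff d := by
    intro μ
    simp only [hχ, Polynomial.finsetSum_coeff, Polynomial.coeff_C_mul_X_pow]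
    rw [sum_eq_single μ]
    · simp
    · intro b _ hb; rw [if_neg]; intro h; exact hb (Fin.ext h.symm)
    · simp
  have hχ0 : χ ≠ 0 := by
    intro h0
    obtain ⟨μ, hμ0⟩ := Function.ne_iff.1 hc0
    have hall : ∀ μ, (c μ).coeff d = 0 := fun μ => by rw [← hχc, h0]; simp
    obtain ⟨μ1, -, h1⟩ := exists_mem_eq_sup univ hn fun μ => (c μ).natDegree
    have h2 := hall μ1
    rw [hd, h1] at h2
    have h3 : c μ1 = 0 := Polynomial.leadingCoeff_eq_zero.1 h2
    have hd0 : d = 0 := by rw [hd, h1, h3]; simp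
    have h4 := hall μ
    have h5 := hdle μ
    rw [hd0] at h4 h5
    apply hμ0
    rw [Polynomial.eq_C_of_natDegree_le_zero h5, h4]; simp
  have hχd : χ.natDegree < n := by
    have hn' : 0 < n := by obtain ⟨i, _⟩ := hn; exact i.pos
    have : χ.natDegree ≤ n - 1 := by
      apply Polynomial.natDegree_sum_le_of_forall_le
      intro i _
      refine (Polynomial.natDegree_C_mul_X_pow_le _ _).trans ?_
      have := i.2; omega
    omega
  set S := χ.roots.toFinset
  have hS : S.card < n := lt_of_le_of_lt ((Multiset.toFinset_card_le _).trans
    (Polynomial.card_roots' χ)) hχd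
  let T : (Fin n → ℚ) →ₗ[ℚ] (S → ℚ) := LinearMap.pi fun r =>
    (Polynomial.lcoeff ℚ ⌊(r : ℚ)⌋₊).comp (Fintype.linearCombination ℚ f)
  have hT : LinearMap.ker T ≠ ⊥ := LinearMap.ker_ne_bot_of_finrank_lt (by simpa using hS)
  obtain ⟨a, haT, ha0⟩ := Submodule.exists_mem_ne_zero_of_ne_bot hT
  set g := ∑ ν, a ν • f ν with hg
  have hg0 : g ≠ 0 := by
    intro h
    apply ha0
    ext i
    exact Fintype.linearIndependent_iff.1 hf a h i
  have hgs : ∑ μ, c μ * (eul ^ (μ : ℕ)) g = 0 := by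
    have : ∀ μ : Fin n, c μ * (eul ^ (μ : ℕ)) g = ∑ ν, a ν • (c μ * (eul ^ (μ : ℕ)) (f ν)) := by
      intro μ; rw [hg, map_sum, mul_sum]; simp
    rw [sum_congr rfl fun μ _ => this μ, sum_comm]
    refine sum_eq_zero fun ν _ => ?_
    rw [← smul_sum, hc' ν, smul_zero]
  have hroot : χ.eval (g.natDegree : ℚ) = 0 := by
    have h1 := congrArg (fun p => Polynomial.coeff p (d + g.natDegree)) hgs
    simp only [Polynomial.finsetSum_coeff, Polynomial.coeff_zero] at h1
    have h2 : ∀ μ : Fin n, (c μ * (eul ^ (μ : ℕ)) g).coeff (d + g.natDegree) =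
        (c μ).coeff d * ((g.natDegree : ℚ) ^ (μ : ℕ) * g.leadingCoeff) := by
      intro μ
      rw [Polynomial.coeff_mul_add_eq_of_natDegree_le (hdle μ), eul_pow_coeff]; · rfl
      rw [Polynomial.natDegree_le_iff_coeff_eq_zero]
      intro N hN
      rw [eul_pow_coeff, Polynomial.coeff_eq_zero_of_natDegree_lt hN, mul_zero]
    rw [sum_congr rfl fun μ _ => h2 μ] at h1
    simp_rw [← mul_assoc] at h1
    rw [← sum_mul] at h1
    have := (mul_eq_zero.1 h1).resolve_right (Polynomial.leadingCoeff_ne_zero.2 hg0)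
    simpa [hχ, Polynomial.eval_finsetSum] using this
  have hmem : (g.natDegree : ℚ) ∈ S := by
    simp [S, hχ0, hroot]
  have h3 := congrFun (LinearMap.mem_ker.1 haT) ⟨_, hmem⟩
  simp [T, Fintype.linearCombination_apply] at h3
  have h4 : g.coeff g.natDegree = 0 := by
    have hk : ∀ k, g.coeff k = ∑ x, a x * (f x).coeff k := by
      intro k; simp [hg, Polynomial.finsetSum_coeff]
    rw [hk]; exact h3
  exact hg0 (Polynomial.leadingCoeff_eq_zero.1 h4)

lemma multilin_span {n : ℕ} {V W : Type*} [AddCommGroup V] [Module ℚ V] [AddCommGroup W] [Module ℚ W]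
    (D : MultilinearMap ℚ (fun _ : Fin n => V) W) (T : Fin n → Set V) (v : Fin n → V)
    (hv : ∀ i, v i ∈ Submodule.span ℚ (T i)) (h : D v ≠ 0) :
    ∃ t : Fin n → V, (∀ i, t i ∈ T i) ∧ D t ≠ 0 := by
  classical
  have key : ∀ s : Finset (Fin n), ∃ t : Fin n → V, (∀ i ∈ s, t i ∈ T i) ∧
      (∀ i ∉ s, t i = v i) ∧ D t ≠ 0 := by
    intro s
    induction s using Finset.induction_on with
    | empty => exact ⟨v, by simp, by simp, h⟩
    | insert a s ha ih =>
      obtain ⟨t, h1, h2, h3⟩ := ih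
      have : ∃ x ∈ T a, D (Function.update t a x) ≠ 0 := by
        by_contra hcon
        push Not at hcon
        have hle : Submodule.span ℚ (T a) ≤ LinearMap.ker (D.toLinearMap t a) :=
          Submodule.span_le.2 fun x hx => by simpa using hcon x hx
        have := hle (hv a)
        rw [LinearMap.mem_ker, MultilinearMap.toLinearMap_apply, ← h2 a ha,
          Function.update_eq_self] at this
        exact h3 this
      obtain ⟨x, hx, hD⟩ := this
      refine ⟨Function.update t a x, ?_, ?_, hD⟩
      · intro i hi
        by_cases hia : i = a
        · subst hia; simpa using hx
        · rw [Function.update_of_ne hia]; exact h1 i ((mem_insert.1 hi).resolve_left hia)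
      · intro i hi
        have hia : i ≠ a := fun hh => hi (by simp [hh])
        rw [Function.update_of_ne hia]; exact h2 i fun hh => hi (by simp [hh])
  obtain ⟨t, h1, _, h3⟩ := key univ
  exact ⟨t, fun i => h1 i (mem_univ i), h3⟩

lemma exists_kron {σ : Type*} [Fintype σ] (U : Finset (σ →₀ ℕ)) :
    ∃ w : σ → ℕ, ∀ e ∈ U, ∀ e' ∈ U, ∑ i, w i * e i = ∑ i, w i * e' i → e = e' := by
  classical
  obtain ⟨b, hb⟩ : ∃ b : ℕ, ∀ e ∈ U, ∀ i, e i < b := by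
    refine ⟨(∑ e ∈ U, ∑ i, e i) + 1, fun e he i => Nat.lt_succ_of_le ?_⟩
    exact (single_le_sum (f := fun i => e i) (fun _ _ => Nat.zero_le _) (mem_univ i)).trans
      (single_le_sum (f := fun e : σ →₀ ℕ => ∑ i, e i) (fun _ _ => Nat.zero_le _) he)
  have key : ∀ s : Finset σ, ∃ w : σ → ℕ, ∀ e ∈ U, ∀ e' ∈ U,
      ∑ i ∈ s, w i * e i = ∑ i ∈ s, w i * e' i → ∀ i ∈ s, e i = e' i := by
    intro s
    induction s using Finset.induction_on with
    | empty => exact ⟨0, by simp⟩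
    | insert a s ha ih =>
      obtain ⟨w, hw⟩ := ih
      refine ⟨fun i => if i = a then 1 else b * w i, fun e he e' he' h => ?_⟩
      rw [sum_insert ha, sum_insert ha] at h
      have h1 : ∀ e : σ →₀ ℕ, ∑ i ∈ s, (if i = a then 1 else b * w i) * e i =
          b * ∑ i ∈ s, w i * e i := by
        intro e
        rw [mul_sum]
        refine sum_congr rfl fun i hi => ?_
        rw [if_neg (by rintro rfl; exact ha hi), mul_assoc]
      rw [h1, h1] at h
      simp only [if_true, one_mul] at h
      have hm : e a = e' a := by
        have := congrArg (· % b) h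
        simpa [Nat.add_mul_mod_self_left, Nat.mod_eq_of_lt (hb e he a),
          Nat.mod_eq_of_lt (hb e' he' a)] using this
      have hb0 : 0 < b := (Nat.zero_le _).trans_lt (hb e he a)
      have h2 : ∑ i ∈ s, w i * e i = ∑ i ∈ s, w i * e' i := by
        rw [hm] at h
        exact Nat.eq_of_mul_eq_mul_left hb0 (Nat.add_left_cancel h)
      intro i hi
      rcases mem_insert.1 hi with rfl | hi
      · exact hm
      · exact hw e he e' he' h2 i hi
  obtain ⟨w, hw⟩ := key univ
  exact ⟨w, fun e he e' he' h => Finsupp.ext fun i => hw e he e' he' h i (mem_univ i)⟩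

section wr
variable {σ : Type*} [Fintype σ]

/-- span of binomial functions of order ≤ μ -/
def binSpan (σ : Type*) [Fintype σ] (μ : ℕ) : Submodule ℚ ((σ →₀ ℕ) → ℚ) :=
  Submodule.span ℚ ((fun Δ e => (mbin e Δ : ℚ)) '' {Δ : σ →₀ ℕ | ∑ i, Δ i ≤ μ})

lemma mbin_mul (e Δ : σ →₀ ℕ) (i : σ) :
    (e i : ℚ) * mbin e Δ = (Δ i + 1) * mbin e (Δ + Finsupp.single i 1) + Δ i * mbin e Δ := by
  classical
  have h1 : mbin e (Δ + Finsupp.single i 1) = (e i).choose (Δ i + 1) *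
      ∏ j ∈ univ.erase i, (e j).choose (Δ j) := by
    rw [mbin, ← mul_prod_erase univ _ (mem_univ i)]
    congr 1
    · simp
    · refine prod_congr rfl fun j hj => ?_
      simp [Finsupp.single_apply, (ne_of_mem_erase hj).symm]
  have h2 : mbin e Δ = (e i).choose (Δ i) * ∏ j ∈ univ.erase i, (e j).choose (Δ j) := by
    rw [mbin, ← mul_prod_erase univ _ (mem_univ i)]
  rw [h1, h2]
  have h3 : (e i : ℚ) * (e i).choose (Δ i) = (Δ i + 1) * (e i).choose (Δ i + 1) +
      Δ i * (e i).choose (Δ i) := by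
    by_cases hle : Δ i ≤ e i
    · have := Nat.choose_succ_right_eq (e i) (Δ i)
      have h : ((e i).choose (Δ i + 1) : ℚ) * (Δ i + 1) = (e i).choose (Δ i) * (e i - Δ i) := by
        rw [← Nat.cast_sub hle]; exact_mod_cast this
      linear_combination -h
    · rw [Nat.choose_eq_zero_of_lt (not_le.1 hle), Nat.choose_eq_zero_of_lt (by omega)]; simp
  push_cast
  linear_combination (∏ j ∈ univ.erase i, ((e j).choose (Δ j) : ℚ)) * h3

lemma binSpan_mul {μ : ℕ} {g : (σ →₀ ℕ) → ℚ} (hg : g ∈ binSpan σ μ) (i : σ) :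
    (fun e : σ →₀ ℕ => (e i : ℚ) * g e) ∈ binSpan σ (μ + 1) := by
  classical
  unfold binSpan at hg
  induction hg using Submodule.span_induction with
  | mem x hx =>
    obtain ⟨Δ, hΔ, rfl⟩ := hx
    have : (fun e : σ →₀ ℕ => (e i : ℚ) * mbin e Δ) =
        ((Δ i : ℚ) + 1) • (fun e => (mbin e (Δ + Finsupp.single i 1) : ℚ)) +
        (Δ i : ℚ) • (fun e => (mbin e Δ : ℚ)) := by
      ext e; simp [mbin_mul]
    rw [this]
    refine Submodule.add_mem _ (Submodule.smul_mem _ _ (Submodule.subset_span ⟨_, ?_, rfl⟩))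
      (Submodule.smul_mem _ _ (Submodule.subset_span ⟨_, ?_, rfl⟩))
    · simp only [Set.mem_ofPred_eq, Finsupp.add_apply, sum_add_distrib] at hΔ ⊢
      simp [Finsupp.single_apply]; omega
    · simp only [Set.mem_ofPred_eq] at hΔ ⊢; omega
  | zero =>
    convert Submodule.zero_mem (binSpan σ (μ+1)) using 1
    ext e; simp
  | add x y _ _ hx hy =>
    convert Submodule.add_mem _ hx hy using 1
    ext e; simp [mul_add]
  | smul a x _ hx =>
    convert Submodule.smul_mem _ a hx using 1
    ext e; simp; ring

lemma pow_mem_binSpan (w : σ → ℕ) (μ : ℕ) :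
    (fun e : σ →₀ ℕ => ((∑ i, w i * e i : ℕ) : ℚ) ^ μ) ∈ binSpan σ μ := by
  induction μ with
  | zero =>
    refine Submodule.subset_span ⟨0, by simp, ?_⟩
    ext e; simp [mbin]
  | succ μ ih =>
    have : (fun e : σ →₀ ℕ => ((∑ i, w i * e i : ℕ) : ℚ) ^ (μ + 1)) =
        ∑ i, (w i : ℚ) • (fun e : σ →₀ ℕ => (e i : ℚ) * ((∑ i, w i * e i : ℕ) : ℚ) ^ μ) := by
      ext e
      simp only [Finset.sum_apply, Pi.smul_apply, smul_eq_mul]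
      rw [pow_succ', Nat.cast_sum, sum_mul]
      refine sum_congr rfl fun i _ => ?_
      push_cast; ring
    rw [this]
    exact Submodule.sum_mem _ fun i _ => Submodule.smul_mem _ _ (binSpan_mul ih i)

/-- diagonal operator -/
def diagOp (f : MvPolynomial σ ℚ) : ((σ →₀ ℕ) → ℚ) →ₗ[ℚ] MvPolynomial σ ℚ where
  toFun g := ∑ e ∈ f.support, monomial e (g e * f.coeff e)
  map_add' g h := by simp [add_mul, sum_add_distrib]
  map_smul' a g := by simp [mul_assoc, smul_sum, smul_monomial]

lemma diagOp_mbin (f : MvPolynomial σ ℚ) (Δ : σ →₀ ℕ) :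
    diagOp f (fun e => (mbin e Δ : ℚ)) = monomial Δ 1 * hasse Δ f := by
  rw [hasse_eq, mul_sum]
  refine sum_congr rfl fun e _ => ?_
  rw [monomial_mul, one_mul]
  by_cases h : Δ ≤ e
  · rw [add_tsub_cancel_of_le h]
  · obtain ⟨i, hi⟩ := not_forall.1 (fun hh => h (Finsupp.le_def.2 hh))
    have : mbin e Δ = 0 := prod_eq_zero (mem_univ i) (Nat.choose_eq_zero_of_lt (not_le.1 hi))
    simp [this]

theorem wronsk {n : ℕ} (f : Fin n → MvPolynomial σ ℚ) (hf : LinearIndependent ℚ f) :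
    ∃ Δ : Fin n → σ →₀ ℕ, (∀ μ, ∑ i, Δ μ i ≤ μ) ∧
      (Matrix.of fun (μ ν : Fin n) => hasse (Δ μ) (f ν)).det ≠ 0 := by
  classical
  obtain ⟨w, hw⟩ := exists_kron (univ.biUnion fun ν => (f ν).support)
  let φ : MvPolynomial σ ℚ →ₐ[ℚ] Polynomial ℚ := aeval fun i => Polynomial.X ^ w i
  have hφm : ∀ e a, φ (monomial e a) = Polynomial.monomial (∑ i, w i * e i) a := by
    intro e a
    simp only [φ, aeval_monomial]
    rw [Finsupp.prod_fintype _ _ (by simp)]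
    simp_rw [← pow_mul]
    rw [prod_pow_eq_pow_sum, ← Polynomial.C_mul_X_pow_eq_monomial]; rfl
  have hind : LinearIndependent ℚ fun ν => φ (f ν) := by
    rw [Fintype.linearIndependent_iff]
    intro a ha
    have hz : φ (∑ ν, a ν • f ν) = 0 := by simpa using ha
    have h0 : ∑ ν, a ν • f ν = 0 := by
      set g := ∑ ν, a ν • f ν with hg
      have hsup : g.support ⊆ univ.biUnion fun ν => (f ν).support := by
        intro e he
        rw [mem_support_iff, hg, coeff_sum] at he
        obtain ⟨ν, _, hν⟩ := exists_ne_zero_of_sum_ne_zero he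
        rw [coeff_smul, smul_eq_mul] at hν
        exact mem_biUnion.2 ⟨ν, mem_univ _, mem_support_iff.2 (right_ne_zero_of_mul hν)⟩
      by_contra hne
      obtain ⟨e0, he0⟩ := MvPolynomial.ne_zero_iff.1 hne
      apply he0
      have h1 := congrArg (fun p => Polynomial.coeff p (∑ i, w i * e0 i)) hz
      simp only [Polynomial.coeff_zero] at h1
      rw [g.as_sum, map_sum, Polynomial.finsetSum_coeff, sum_eq_single e0] at h1
      · simpa [hφm] using h1
      · intro e he hne'
        rw [hφm, Polynomial.coeff_monomial, if_neg]
        intro hh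
        exact hne' (hw e (hsup he) e0 (hsup (mem_support_iff.2 he0)) hh)
      · intro h; exact absurd (mem_support_iff.2 he0) h
    exact Fintype.linearIndependent_iff.1 hf a h0
  have hW := wronsk_uni _ hind
  let row : ((σ →₀ ℕ) → ℚ) →ₗ[ℚ] (Fin n → MvPolynomial σ ℚ) := LinearMap.pi fun ν => diagOp (f ν)
  let D : MultilinearMap ℚ (fun _ : Fin n => (σ →₀ ℕ) → ℚ) (MvPolynomial σ ℚ) :=
    ((Matrix.detRowAlternating (n := Fin n) (R := MvPolynomial σ ℚ)).toMultilinearMap.restrictScalars ℚ).compLinearMap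
      fun _ => row
  have hD : ∀ v, D v = (Matrix.of fun (μ ν : Fin n) => diagOp (f ν) (v μ)).det := fun v => rfl
  have hne : D (fun μ e => ((∑ i, w i * e i : ℕ) : ℚ) ^ (μ : ℕ)) ≠ 0 := by
    intro h0
    rw [hD] at h0
    apply hW
    have := congrArg φ h0
    rw [map_zero, AlgHom.map_det] at this
    rw [← this]
    congr 1
    ext1 μ ν
    simp only [Matrix.of_apply, AlgHom.mapMatrix_apply, Matrix.map_apply]
    ext k
    rw [eul_pow_coeff]
    conv_lhs => rw [(f ν).as_sum]
    simp only [diagOp, LinearMap.coe_mk, AddHom.coe_mk, map_sum, Polynomial.finsetSum_coeff, hφm,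
      Polynomial.coeff_monomial, mul_sum]
    refine sum_congr rfl fun e _ => ?_
    split_ifs with h
    · rw [h]
    · simp
  obtain ⟨t, ht, hDt⟩ := multilin_span D _ _ (fun μ => pow_mem_binSpan w μ) hne
  choose Δ hΔ hΔt using ht
  refine ⟨Δ, hΔ, fun h0 => hDt ?_⟩
  rw [hD]
  have : (Matrix.of fun (μ ν : Fin n) => diagOp (f ν) (t μ)) =
      Matrix.of fun (μ ν : Fin n) => (monomial (Δ μ) (1 : ℚ)) *
        (Matrix.of fun (μ ν : Fin n) => hasse (Δ μ) (f ν)) μ ν := by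
    ext1 μ ν
    simp only [Matrix.of_apply]
    rw [← hΔt μ, diagOp_mbin]
  rw [this, Matrix.det_mul_column, h0, mul_zero]

end wr

end

end SchmidtPf

open MvPolynomial Finset
namespace SchmidtPf
noncomputable section

section split
variable {σ τ : Type*} {R : Type*} [CommRing R]

/-- index of product -/
abbrev se (e : σ →₀ ℕ) (e' : τ →₀ ℕ) : σ ⊕ τ →₀ ℕ := Finsupp.sumElim e e'

lemma se_surj (d : σ ⊕ τ →₀ ℕ) : ∃ e e', d = se e e' :=
  ⟨d.comapDomain Sum.inl Sum.inl_injective.injOn, d.comapDomain Sum.inr Sum.inr_injective.injOn, by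
    ext (x | x) <;> simp [se]⟩

lemma se_inj {e f : σ →₀ ℕ} {e' f' : τ →₀ ℕ} : se e e' = se f f' ↔ e = f ∧ e' = f' := by
  constructor
  · intro h
    refine ⟨?_, ?_⟩ <;> ext x
    · simpa using DFunLike.congr_fun h (Sum.inl x)
    · simpa using DFunLike.congr_fun h (Sum.inr x)
  · rintro ⟨rfl, rfl⟩; rfl

/-- external product -/
def xp (f : MvPolynomial σ R) (g : MvPolynomial τ R) : MvPolynomial (σ ⊕ τ) R :=
  rename Sum.inl f * rename Sum.inr g

lemma xp_monomial (e : σ →₀ ℕ) (e' : τ →₀ ℕ) (a b : R) :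
    xp (monomial e a) (monomial e' b) = monomial (se e e') (a * b) := by
  classical
  rw [xp, rename_monomial, rename_monomial, monomial_mul]
  have : Finsupp.mapDomain Sum.inl e + Finsupp.mapDomain Sum.inr e' = se e e' := ?_
  · rw [this]
  ext (x | x)
  · rw [Finsupp.add_apply, Finsupp.mapDomain_apply Sum.inl_injective, Finsupp.mapDomain_of_notMem_range] <;> simp
  · rw [Finsupp.add_apply, Finsupp.mapDomain_apply Sum.inr_injective, Finsupp.mapDomain_of_notMem_range] <;> simp

lemma xp_eq (f : MvPolynomial σ R) (g : MvPolynomial τ R) :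
    xp f g = ∑ e ∈ f.support, ∑ e' ∈ g.support, monomial (se e e') (f.coeff e * g.coeff e') := by
  simp_rw [← xp_monomial]
  conv_lhs => rw [xp, f.as_sum, g.as_sum, map_sum, map_sum, sum_mul_sum]
  rfl

lemma coeff_xp (f : MvPolynomial σ R) (g : MvPolynomial τ R) (e : σ →₀ ℕ) (e' : τ →₀ ℕ) :
    (xp f g).coeff (se e e') = f.coeff e * g.coeff e' := by
  classical
  rw [xp_eq]
  simp_rw [coeff_sum, coeff_monomial, se_inj]
  by_cases h : f.coeff e = 0
  · rw [h, zero_mul]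
    refine sum_eq_zero fun a ha => sum_eq_zero fun b hb => ?_
    rw [if_neg]; rintro ⟨rfl, rfl⟩; exact mem_support_iff.1 ha h
  by_cases h' : g.coeff e' = 0
  · rw [h', mul_zero]
    refine sum_eq_zero fun a ha => sum_eq_zero fun b hb => ?_
    rw [if_neg]; rintro ⟨rfl, rfl⟩; exact mem_support_iff.1 hb h'
  rw [sum_eq_single e, sum_eq_single e']
  · simp
  · intro b _ hb; simp [hb]
  · intro hh; exact absurd (notMem_support_iff.1 hh) h'
  · intro b _ hb; simp [hb]
  · intro hh; exact absurd (notMem_support_iff.1 hh) h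

lemma hasse_xp [Fintype σ] [Fintype τ] (Δ : σ →₀ ℕ) (Δ' : τ →₀ ℕ) (f : MvPolynomial σ R)
    (g : MvPolynomial τ R) : hasse (se Δ Δ') (xp f g) = xp (hasse Δ f) (hasse Δ' g) := by
  have hm : ∀ (e : σ →₀ ℕ) (e' : τ →₀ ℕ), mbin (se e e') (se Δ Δ') = mbin e Δ * mbin e' Δ' := by
    intro e e'; simp [mbin, Fintype.prod_sum_type]
  have hs : ∀ (e : σ →₀ ℕ) (e' : τ →₀ ℕ), se e e' - se Δ Δ' = se (e - Δ) (e' - Δ') := by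
    intro e e'; ext (x | x) <;> simp
  rw [xp_eq, hasse_sum, hasse_eq Δ f, hasse_eq Δ' g]
  conv_rhs => rw [xp, map_sum, map_sum, sum_mul_sum]
  refine sum_congr rfl fun e _ => ?_
  rw [hasse_sum]
  refine sum_congr rfl fun e' _ => ?_
  rw [hasse_monomial]
  change _ = xp _ _
  rw [xp_monomial, hm, hs]
  congr 1; push_cast; ring

lemma shift_xp (ξ : σ → R) (η : τ → R) (f : MvPolynomial σ R) (g : MvPolynomial τ R) :
    shift (Sum.elim ξ η) (xp f g) = xp (shift ξ f) (shift η g) := by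
  rw [xp, map_mul, xp]
  congr 1
  · change ((shift (Sum.elim ξ η)).comp (rename Sum.inl : _ →ₐ[R] _).toRingHom) f = ((rename Sum.inl : _ →ₐ[R] _).toRingHom.comp (shift ξ)) f
    congr 1
    apply MvPolynomial.ringHom_ext
    · intro r; simp [shift]
    · intro i; simp [shift]
  · change ((shift (Sum.elim ξ η)).comp (rename Sum.inr : _ →ₐ[R] _).toRingHom) g = ((rename Sum.inr : _ →ₐ[R] _).toRingHom.comp (shift η)) g
    congr 1
    apply MvPolynomial.ringHom_ext
    · intro r; simp [shift]
    · intro i; simp [shift]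

/-- index splitting -/
lemma idx_xp [IsDomain R] [Fintype σ] [Fintype τ] {ξ : σ → R} {η : τ → R} {w : σ → ℝ} {w' : τ → ℝ} {a b : ℝ}
    {f : MvPolynomial σ R} {g : MvPolynomial τ R}
    (h : IdxGE (Sum.elim ξ η) (Sum.elim w w') (a + b) (xp f g)) :
    IdxGE ξ w a f ∨ IdxGE η w' b g := by
  by_contra hh
  simp only [IdxGE, not_or, not_forall, not_le] at hh
  obtain ⟨⟨e, he, h1⟩, ⟨e', he', h2⟩⟩ := hh
  have := h (se e e') (by rw [shift_xp, coeff_xp]; exact mul_ne_zero he he')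
  simp [Fintype.sum_sum_type] at this
  linarith

/-- slice: coefficient of X^e in the first set of variables -/
def slice (e : σ →₀ ℕ) (f : MvPolynomial (σ ⊕ τ) R) : MvPolynomial τ R := by
  classical
  exact ∑ d ∈ f.support, if d.comapDomain Sum.inl Sum.inl_injective.injOn = e then
    monomial (d.comapDomain Sum.inr Sum.inr_injective.injOn) (f.coeff d) else 0

lemma coeff_slice (e : σ →₀ ℕ) (e' : τ →₀ ℕ) (f : MvPolynomial (σ ⊕ τ) R) :
    (slice e f).coeff e' = f.coeff (se e e') := by
  classical
  rw [slice, coeff_sum]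
  have hc1 : (se e e').comapDomain Sum.inl Sum.inl_injective.injOn = e := by ext; simp
  have hc2 : (se e e').comapDomain Sum.inr Sum.inr_injective.injOn = e' := by ext; simp
  rw [sum_eq_single (se e e')]
  · rw [if_pos hc1, hc2, coeff_monomial, if_pos rfl]
  · intro d _ hd
    split_ifs with h
    · rw [coeff_monomial, if_neg]
      intro h'; apply hd
      rw [← h, ← h']
      ext (x | x) <;> simp
    · simp
  · intro h; rw [if_pos hc1, hc2, coeff_monomial, if_pos rfl, notMem_support_iff.1 h]

lemma slice_map {S : Type*} [CommRing S] (φ : R →+* S) (e : σ →₀ ℕ) (f : MvPolynomial (σ ⊕ τ) R) :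
    MvPolynomial.map φ (slice e f) = slice e (MvPolynomial.map φ f) := by
  ext e'; simp [coeff_slice, coeff_map]

lemma slice_xp (e : σ →₀ ℕ) (f : MvPolynomial σ R) (g : MvPolynomial τ R) :
    slice e (xp f g) = C (f.coeff e) * g := by
  ext e'; simp [coeff_slice, coeff_xp]

lemma l1_slice_le {A : Type*} [SeminormedCommRing A] (e : σ →₀ ℕ) (f : MvPolynomial (σ ⊕ τ) A) : l1 (slice e f) ≤ l1 f := by
  classical
  rw [slice]
  refine (l1_sum_le _ _).trans ?_
  refine sum_le_sum fun d _ => ?_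
  split_ifs
  · rw [l1_monomial]
  · simp

lemma slice_degreeOf_le (e : σ →₀ ℕ) (f : MvPolynomial (σ ⊕ τ) R) (i : τ) :
    (slice e f).degreeOf i ≤ f.degreeOf (Sum.inr i) := by
  rw [degreeOf_le_iff]
  intro e' he'
  rw [mem_support_iff, coeff_slice] at he'
  have := (degreeOf_le_iff.1 (le_refl (f.degreeOf (Sum.inr i)))) _ (mem_support_iff.2 he')
  simpa using this

end split

section renameE
variable {σ τ : Type*} {R : Type*} [CommRing R]

lemma l1_rename {A : Type*} [SeminormedCommRing A] (ε : σ ≃ τ) (f : MvPolynomial σ A) :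
    l1 (rename ε f) ≤ l1 f := by
  conv_lhs => rw [f.as_sum, map_sum]
  refine (l1_sum_le _ _).trans (sum_le_sum fun e _ => ?_)
  rw [rename_monomial, l1_monomial]

lemma shift_rename (ε : σ ≃ τ) (ξ : τ → R) (f : MvPolynomial σ R) :
    shift ξ (rename ε f) = rename ε (shift (ξ ∘ ε) f) := by
  change ((shift ξ).comp (rename ε : _ →ₐ[R] _).toRingHom) f = ((rename ε : _ →ₐ[R] _).toRingHom.comp (shift (ξ ∘ ε))) f
  congr 1
  apply MvPolynomial.ringHom_ext
  · intro r; simp [shift]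
  · intro i; simp [shift]

lemma idx_rename [Fintype σ] [Fintype τ] (ε : σ ≃ τ) {ξ : τ → R} {w : τ → ℝ} {a : ℝ} {f : MvPolynomial σ R}
    (h : IdxGE (ξ ∘ ε) (w ∘ ε) a f) : IdxGE ξ w a (rename ε f) := by
  intro e he
  rw [shift_rename] at he
  obtain ⟨d, rfl, hd⟩ := coeff_rename_ne_zero _ _ _ he
  refine (h d hd).trans (le_of_eq ?_)
  rw [← Equiv.sum_comp ε]
  simp [Finsupp.mapDomain_apply ε.injective]

lemma degreeOf_rename_equiv (ε : σ ≃ τ) (f : MvPolynomial σ R) (i : τ) :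
    (rename ε f).degreeOf i = f.degreeOf (ε.symm i) := by
  have := degreeOf_rename_of_injective (p := f) ε.injective (ε.symm i)
  simpa using this

end renameE

/-- minimal-rank decomposition -/
lemma exists_decomp {V₁ V₂ S : Type*} [AddCommGroup V₁] [Module ℚ V₁] [AddCommGroup V₂] [Module ℚ V₂]
    [AddCommGroup S] [Module ℚ S] (β : V₁ →ₗ[ℚ] V₂ →ₗ[ℚ] S) (P : S) (N : ℕ)
    (f : Fin N → V₁) (g : Fin N → V₂) (hP : P = ∑ ν, β (f ν) (g ν)) :
    ∃ k ≤ N, ∃ (f : Fin k → V₁) (g : Fin k → V₂), P = ∑ ν, β (f ν) (g ν) ∧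
      LinearIndependent ℚ f ∧ LinearIndependent ℚ g := by
  classical
  have hex : ∃ k, ∃ (f : Fin k → V₁) (g : Fin k → V₂), P = ∑ ν, β (f ν) (g ν) := ⟨N, f, g, hP⟩
  obtain ⟨f', g', h⟩ := Nat.find_spec hex
  have hmin : ∀ m, m < Nat.find hex → ¬ ∃ (f : Fin m → V₁) (g : Fin m → V₂), P = ∑ ν, β (f ν) (g ν) :=
    fun m hm => Nat.find_min hex hm
  have hle : Nat.find hex ≤ N := Nat.find_min' hex ⟨f, g, hP⟩
  revert f' g' h hmin hle
  generalize Nat.find hex = k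
  intro f' g' h hmin hle
  refine ⟨k, hle, f', g', h, ?_, ?_⟩
  · by_contra hd
    rw [Fintype.not_linearIndependent_iff] at hd
    obtain ⟨c, hc, i, hi⟩ := hd
    obtain ⟨k, rfl⟩ : ∃ m, k = m + 1 := ⟨k - 1, by have := i.pos; omega⟩
    apply hmin k (by omega)
    refine ⟨fun ν => f' (i.succAbove ν), fun ν => g' (i.succAbove ν) - (c (i.succAbove ν) / c i) • g' i, ?_⟩
    rw [Fin.sum_univ_succAbove _ i] at h hc
    have : f' i = - ∑ ν, (c (i.succAbove ν) / c i) • f' (i.succAbove ν) := by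
      apply smul_right_injective _ hi
      simp only [smul_neg, smul_sum, smul_smul]
      rw [eq_neg_iff_add_eq_zero, ← hc]
      congr 1
      refine sum_congr rfl fun ν _ => ?_
      congr 1; field_simp
    rw [h, this]
    simp [map_sum, LinearMap.sum_apply, sum_sub_distrib]
    abel
  · by_contra hd
    rw [Fintype.not_linearIndependent_iff] at hd
    obtain ⟨c, hc, i, hi⟩ := hd
    obtain ⟨k, rfl⟩ : ∃ m, k = m + 1 := ⟨k - 1, by have := i.pos; omega⟩
    apply hmin k (by omega)
    refine ⟨fun ν => f' (i.succAbove ν) - (c (i.succAbove ν) / c i) • f' i, fun ν => g' (i.succAbove ν), ?_⟩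
    rw [Fin.sum_univ_succAbove _ i] at h hc
    have : g' i = - ∑ ν, (c (i.succAbove ν) / c i) • g' (i.succAbove ν) := by
      apply smul_right_injective _ hi
      simp only [smul_neg, smul_sum, smul_smul]
      rw [eq_neg_iff_add_eq_zero, ← hc]
      congr 1
      refine sum_congr rfl fun ν _ => ?_
      congr 1; field_simp
    rw [h, this]
    simp [map_sum, LinearMap.sum_apply, sum_sub_distrib]
    abel

/-- one-variable: high vanishing at p/q forces large leading coefficient. -/
lemma one_var (p : ℤ) (q : ℕ) (hq : 1 ≤ q) (hpq : IsCoprime p (q : ℤ)) (g : MvPolynomial Unit ℤ) (hg : g ≠ 0)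
    (s : ℕ) (h : ∀ e, (shift (fun _ => (p : ℚ) / q) (MvPolynomial.map (Int.castRingHom ℚ) g)).coeff e ≠ 0 → s ≤ e ()) :
    (q : ℝ) ^ s ≤ l1 g := by
  set φ : MvPolynomial Unit ℤ →+* Polynomial ℤ := eval₂Hom Polynomial.C (fun _ => Polynomial.X) with hφ
  set ψ : MvPolynomial Unit ℚ →+* Polynomial ℚ := eval₂Hom Polynomial.C (fun _ => Polynomial.X) with hψ
  have hcoef : ∀ (R : Type) [CommRing R] (f : MvPolynomial Unit R) (k : ℕ),
      (eval₂Hom (Polynomial.C : R →+* _) (fun _ : Unit => (Polynomial.X : Polynomial R)) f).coeff k = f.coeff (Finsupp.single () k) := by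
    intro R _ f k
    induction f using MvPolynomial.induction_on' with
    | monomial e a =>
      rw [coe_eval₂Hom, eval₂_monomial, Finsupp.prod_fintype _ _ (by simp)]
      simp only [univ_unique, PUnit.default_eq_unit, prod_singleton, Polynomial.coeff_C_mul_X_pow, coeff_monomial]
      congr 1
      rw [eq_iff_iff]
      constructor
      · rintro rfl; ext; simp
      · rintro rfl; simp
    | add a b ha hb => rw [map_add, Polynomial.coeff_add, ha, hb, coeff_add]
  have hmap : ψ (MvPolynomial.map (Int.castRingHom ℚ) g) = (φ g).map (Int.castRingHom ℚ) := by
    ext k; rw [hψ, hcoef, Polynomial.coeff_map, hφ, hcoef, coeff_map]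
  have hsh : ψ (shift (fun _ => (p : ℚ) / q) (MvPolynomial.map (Int.castRingHom ℚ) g)) =
     ((φ g).map (Int.castRingHom ℚ)).comp (Polynomial.X + Polynomial.C ((p : ℚ) / q)) := by
    rw [← hmap]
    have key : ψ.comp (shift (fun _ => (p : ℚ) / q)) = (Polynomial.compRingHom (Polynomial.X + Polynomial.C ((p : ℚ) / q))).comp ψ := by
      apply MvPolynomial.ringHom_ext
      · intro r; simp [shift, hψ]
      · intro i; simp [shift, hψ]
    have := RingHom.congr_fun key (MvPolynomial.map (Int.castRingHom ℚ) g)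
    rw [RingHom.comp_apply, RingHom.comp_apply, Polynomial.coe_compRingHom_apply] at this
    exact this
  have hdvd : (Polynomial.X - Polynomial.C ((p : ℚ) / q)) ^ s ∣ (φ g).map (Int.castRingHom ℚ) := by
    rw [Polynomial.X_sub_C_pow_dvd_iff, ← hsh, Polynomial.X_pow_dvd_iff]
    intro d hd
    rw [hψ, hcoef]
    by_contra hne
    have := h _ hne
    simp at this
    omega
  have hqQ : (q : ℚ) ≠ 0 := by positivity
  set L : Polynomial ℤ := Polynomial.C (q : ℤ) * Polynomial.X + Polynomial.C (-p) with hL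
  have hLp : L.IsPrimitive := by
    rw [Polynomial.isPrimitive_iff_isUnit_of_C_dvd]
    intro r hr
    rw [Polynomial.C_dvd_iff_dvd_coeff] at hr
    have h1 := hr 1
    have h0 := hr 0
    simp only [hL, Polynomial.coeff_add, Polynomial.coeff_C_mul, Polynomial.coeff_X_one, Polynomial.coeff_X_zero,
      Polynomial.coeff_C_zero, Polynomial.coeff_C_ne_zero one_ne_zero, mul_one, mul_zero, add_zero, zero_add, dvd_neg] at h0 h1
    exact hpq.isUnit_of_dvd' h0 h1
  have hLs : (L ^ s).IsPrimitive := by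
    have : ∀ n, (L ^ n).IsPrimitive := by
      intro n
      induction n with
      | zero => simp
      | succ n ih => rw [pow_succ]; exact ih.mul hLp
    exact this _
  have hLm : L.map (Int.castRingHom ℚ) = Polynomial.C (q : ℚ) * (Polynomial.X - Polynomial.C ((p : ℚ) / q)) := by
    rw [hL, mul_sub, ← Polynomial.C_mul, mul_div_cancel₀ _ hqQ]
    simp [sub_eq_add_neg]
  have hd2 : L ^ s ∣ φ g := by
    rw [Polynomial.IsPrimitive.Int.dvd_iff_map_cast_dvd_map_cast _ _ hLs, Polynomial.map_pow, hLm, mul_pow,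
      ← Polynomial.C_pow]
    rw [IsUnit.mul_left_dvd (Polynomial.isUnit_C.2 (IsUnit.mk0 _ (pow_ne_zero _ hqQ)))]
    exact hdvd
  have hg0 : φ g ≠ 0 := by
    intro h0
    apply hg
    ext e
    have : e = Finsupp.single () (e ()) := by ext; simp
    rw [this, ← hcoef, ← hφ, h0]; simp
  obtain ⟨u, hu⟩ := hd2
  have hlead : (φ g).leadingCoeff = (q : ℤ) ^ s * u.leadingCoeff := by
    rw [hu, Polynomial.leadingCoeff_mul, Polynomial.leadingCoeff_pow, hL, Polynomial.leadingCoeff_linear (by positivity)]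
  have hu0 : u.leadingCoeff ≠ 0 := by
    rw [Polynomial.leadingCoeff_ne_zero]; rintro rfl; exact hg0 (by simpa using hu)
  have h5 : ‖(φ g).leadingCoeff‖ ≤ l1 g := by
    rw [Polynomial.leadingCoeff, hφ, hcoef]; exact coeff_le_l1 _ _
  refine le_trans ?_ h5
  rw [hlead, norm_mul, norm_pow]
  have : (1 : ℝ) ≤ ‖u.leadingCoeff‖ := by
    rw [Int.norm_eq_abs]; exact_mod_cast Int.one_le_abs hu0
  have h6 : ‖(q : ℤ)‖ = (q : ℝ) := by simp
  rw [h6]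
  nlinarith [pow_nonneg (Nat.cast_nonneg (α := ℝ) q) s]

end
end SchmidtPf

open MvPolynomial Finset
namespace SchmidtPf
noncomputable section

section
variable {σ : Type*} [Fintype σ]

lemma rename_swap_xp {σ τ R : Type*} [CommRing R] (f : MvPolynomial σ R) (g : MvPolynomial τ R) :
    rename (Equiv.sumComm σ τ) (xp f g) = xp g f := by
  simp only [xp, map_mul, rename_rename]
  rw [mul_comm]; rfl

lemma coeff_rename_swap {σ τ R : Type*} [CommRing R] (f : MvPolynomial (σ ⊕ τ) R) (e : σ →₀ ℕ) (e' : τ →₀ ℕ) :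
    (rename (Equiv.sumComm σ τ) f).coeff (se e' e) = f.coeff (se e e') := by
  rw [← coeff_rename_mapDomain _ (Equiv.sumComm σ τ).injective f (se e e')]
  congr 1
  ext x
  obtain ⟨y, rfl⟩ := (Equiv.sumComm σ τ).surjective x
  rw [Finsupp.mapDomain_apply (Equiv.sumComm σ τ).injective]
  rcases y with y | y <;> simp

def xpB (σ τ : Type*) : MvPolynomial σ ℚ →ₗ[ℚ] MvPolynomial τ ℚ →ₗ[ℚ] MvPolynomial (σ ⊕ τ) ℚ :=
  LinearMap.mk₂ ℚ xp (by intros; simp [xp, add_mul]) (by intros; simp [xp])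
    (by intros; simp [xp, mul_add]) (by intros; simp [xp])

@[simp] lemma xpB_apply {σ τ : Type*} (f : MvPolynomial σ ℚ) (g : MvPolynomial τ ℚ) : xpB σ τ f g = xp f g := rfl

lemma decompP (P : MvPolynomial (σ ⊕ Unit) ℚ) (r : ℕ) (hr : P.degreeOf (Sum.inr ()) ≤ r) :
    ∃ k ≤ r + 1, ∃ (f : Fin k → MvPolynomial σ ℚ) (g : Fin k → MvPolynomial Unit ℚ),
      P = ∑ ν, xp (f ν) (g ν) ∧ LinearIndependent ℚ f ∧ LinearIndependent ℚ g := by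
  classical
  have := exists_decomp (xpB σ Unit) P (r + 1)
    (fun j => slice (Finsupp.single () (j : ℕ)) (rename (Equiv.sumComm σ Unit) P))
    (fun j => monomial (Finsupp.single () (j : ℕ)) 1) ?_
  · simpa only [xpB_apply] using this
  ext d
  obtain ⟨e, e', rfl⟩ := se_surj d
  simp_rw [xpB_apply, coeff_sum, coeff_xp, coeff_slice, coeff_rename_swap, coeff_monomial]
  have he' : e' = Finsupp.single () (e' ()) := by ext; simp
  by_cases h : e' () < r + 1
  · rw [sum_eq_single ⟨e' (), h⟩]
    · rw [if_pos he'.symm, mul_one]; simp only; rw [← he']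
    · intro b _ hb
      rw [if_neg, mul_zero]
      intro hh; apply hb; ext; have := DFunLike.congr_fun hh (); simpa using this
    · simp
  · rw [sum_eq_zero]
    · by_contra h0
      have := degreeOf_le_iff.1 hr _ (mem_support_iff.2 h0)
      simp at this; omega
    · intro b _
      rw [if_neg, mul_zero]
      intro hh; apply h; rw [← hh]; simp; omega

lemma degreeOf_det_le {k : ℕ} {R : Type*} [CommRing R] (M : Matrix (Fin k) (Fin k) (MvPolynomial σ R)) (i : σ) (b : ℕ)
    (h : ∀ μ ν, (M μ ν).degreeOf i ≤ b) : M.det.degreeOf i ≤ k * b := by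
  rw [Matrix.det_apply']
  refine (degreeOf_sum_le _ _ _).trans ?_
  refine Finset.sup_le fun π _ => ?_
  have : ((Equiv.Perm.sign π : ℤ) : MvPolynomial σ R) = C ((Equiv.Perm.sign π : ℤ) : R) := by simp
  rw [this]
  refine (degreeOf_C_mul_le _ _ _).trans ((degreeOf_prod_le _ _ _).trans ?_)
  refine (sum_le_sum fun j _ => h _ _).trans ?_
  simp

lemma wr_step (P : MvPolynomial (σ ⊕ Unit) ℤ) (hP : P ≠ 0) (r : σ → ℕ) (r0 D : ℕ)
    (hr : ∀ h, P.degreeOf (Sum.inl h) ≤ r h) (hr0 : P.degreeOf (Sum.inr ()) ≤ r0)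
    (hD : ∑ h, r h + r0 ≤ D) :
    ∃ k, 1 ≤ k ∧ k ≤ r0 + 1 ∧ ∃ (F1 : MvPolynomial σ ℤ) (G1 : MvPolynomial Unit ℤ), F1 ≠ 0 ∧ G1 ≠ 0 ∧
      (∀ h, F1.degreeOf h ≤ k * r h) ∧ l1 F1 ≤ k.factorial * (2 ^ D * l1 P) ^ k ∧
      l1 G1 ≤ k.factorial * (2 ^ D * l1 P) ^ k ∧
      ∀ (ξ : σ → ℚ) (η : Unit → ℚ) (w : σ → ℝ) (w0 : Unit → ℝ) (θ ω a b : ℝ), (∀ h, 0 ≤ w h) → 0 ≤ w0 () →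
        (∀ h, w h * r0 ≤ ω) → 0 ≤ ω →
        IdxGE (Sum.elim ξ η) (Sum.elim w w0) θ (MvPolynomial.map (Int.castRingHom ℚ) P) →
        a + b ≤ ∑ ν : Fin k, max 0 (θ - ω - ν * w0 ()) →
        IdxGE ξ w a (MvPolynomial.map (Int.castRingHom ℚ) F1) ∨
        IdxGE η w0 b (MvPolynomial.map (Int.castRingHom ℚ) G1) := by
  classical
  set φ := MvPolynomial.map (σ := σ ⊕ Unit) (Int.castRingHom ℚ) with hφ
  have hφinj : Function.Injective φ := map_injective _ Int.cast_injective
  have hdeg0 : (φ P).degreeOf (Sum.inr ()) ≤ r0 := by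
    rw [degreeOf_le_iff] at hr0 ⊢
    intro e he; exact hr0 e (support_map_subset _ _ he)
  obtain ⟨k, hk, f, g, hPe, hf, hg⟩ := decompP (φ P) r0 hdeg0
  have hk1 : 1 ≤ k := by
    by_contra hk0
    obtain rfl : k = 0 := by omega
    apply hP; apply hφinj; rw [hPe]; simp
  obtain ⟨Δ, hΔ, hFd⟩ := wronsk f hf
  obtain ⟨Δ', hΔ', hGd⟩ := wronsk g hg
  set F := (Matrix.of fun μ ν => hasse (Δ μ) (f ν)).det
  set G := (Matrix.of fun μ ν => hasse (Δ' μ) (g ν)).det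
  set M : Matrix (Fin k) (Fin k) (MvPolynomial (σ ⊕ Unit) ℤ) :=
    Matrix.of fun μ ν => hasse (se (Δ μ) (Δ' ν)) P with hM
  set W := M.det with hW
  have hWFG : φ W = xp F G := by
    rw [hW, RingHom.map_det]
    have : φ.mapMatrix M = ((rename Sum.inl : MvPolynomial σ ℚ →ₐ[ℚ] MvPolynomial (σ ⊕ Unit) ℚ).mapMatrix (Matrix.of fun μ ν => hasse (Δ μ) (f ν))) *
        ((rename Sum.inr : MvPolynomial Unit ℚ →ₐ[ℚ] MvPolynomial (σ ⊕ Unit) ℚ).mapMatrix (Matrix.of fun μ ν => hasse (Δ' μ) (g ν))).transpose := by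
      ext1 μ ν
      simp only [RingHom.mapMatrix_apply, Matrix.map_apply, hM, Matrix.of_apply, Matrix.mul_apply,
        AlgHom.mapMatrix_apply, Matrix.transpose_apply]
      rw [hφ, ← hasse_map, ← hφ, hPe, hasse_sum]
      refine sum_congr rfl fun κ _ => ?_
      rw [hasse_xp]; rfl
    rw [this, Matrix.det_mul, Matrix.det_transpose, ← AlgHom.map_det, ← AlgHom.map_det]
    rfl
  obtain ⟨e, he⟩ := MvPolynomial.ne_zero_iff.1 hFd
  obtain ⟨e', he'⟩ := MvPolynomial.ne_zero_iff.1 hGd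
  set G1 := slice e W with hG1
  set F1 := slice e' (rename (Equiv.sumComm σ Unit) W) with hF1
  have hG1m : MvPolynomial.map (Int.castRingHom ℚ) G1 = C (F.coeff e) * G := by
    rw [hG1, slice_map, ← hφ, hWFG, slice_xp]
  have hF1m : MvPolynomial.map (Int.castRingHom ℚ) F1 = C (G.coeff e') * F := by
    rw [hF1, slice_map, map_rename, ← hφ, hWFG, rename_swap_xp, slice_xp]
  have hl1 : l1 W ≤ k.factorial * (2 ^ D * l1 P) ^ k := by
    refine l1_det_le _ _ fun μ ν => l1_hasse_le _ _ _ ?_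
    intro d hd
    refine le_trans ?_ hD
    rw [Fintype.sum_sum_type]
    simp only [univ_unique, PUnit.default_eq_unit, sum_singleton]
    exact add_le_add (sum_le_sum fun h _ => degreeOf_le_iff.1 (hr h) _ hd) (degreeOf_le_iff.1 hr0 _ hd)
  refine ⟨k, hk1, hk, F1, G1, ?_, ?_, ?_, (l1_slice_le _ _).trans ((l1_rename _ _).trans hl1), (l1_slice_le _ _).trans hl1, ?_⟩
  · intro h0
    rw [h0, map_zero] at hF1m
    rcases mul_eq_zero.1 hF1m.symm with h | h
    · exact he' (C_eq_zero.1 h)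
    · exact hFd h
  · intro h0
    rw [h0, map_zero] at hG1m
    rcases mul_eq_zero.1 hG1m.symm with h | h
    · exact he (C_eq_zero.1 h)
    · exact hGd h
  · intro h
    refine (slice_degreeOf_le _ _ _).trans ?_
    rw [degreeOf_rename_equiv]
    exact degreeOf_det_le _ _ _ fun μ ν => (hasse_degreeOf_le _ _ _).trans (hr h)
  · intro ξ η w w0 θ ω a b hw hw0 hwω hω hidx hab
    have hw' : ∀ i, 0 ≤ Sum.elim w w0 i := by rintro (i | i); exacts [hw i, hw0]
    have hWi : IdxGE (Sum.elim ξ η) (Sum.elim w w0) (a + b) (xp F G) := by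
      rw [← hWFG, hW, RingHom.map_det]
      refine IdxGE.mono (IdxGE.det hw' (a := fun ν : Fin k => max 0 (θ - ω - ν * w0 ())) fun μ ν => ?_) hab
      rcases max_choice 0 (θ - ω - (ν : ℕ) * w0 ()) with h | h
      · rw [h]; exact idxGE_zero hw' _
      rw [h]
      simp only [RingHom.mapMatrix_apply, Matrix.map_apply, hM, Matrix.of_apply]
      rw [hφ, ← hasse_map, ← hφ]
      refine (hidx.hasse (se (Δ μ) (Δ' ν))).mono ?_
      rw [Fintype.sum_sum_type]
      simp only [Finsupp.sumElim_inl, Finsupp.sumElim_inr, Sum.elim_inl, Sum.elim_inr, univ_unique, PUnit.default_eq_unit, sum_singleton]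
      have h1 : ∑ h, (Δ μ h : ℝ) * w h ≤ ω := by
        rcases Nat.eq_zero_or_pos r0 with h0 | h0
        · have hμ : (μ : ℕ) = 0 := by have := μ.2; omega
          have : ∀ h, Δ μ h = 0 := by
            intro h
            have h2 := hΔ μ
            rw [hμ] at h2
            have := single_le_sum (f := fun i => Δ μ i) (fun _ _ => Nat.zero_le _) (mem_univ h)
            omega
          simp [this, hω]
        · have hr0p : (0 : ℝ) < r0 := by exact_mod_cast h0
          calc ∑ h, (Δ μ h : ℝ) * w h ≤ ∑ h, (Δ μ h : ℝ) * (ω / r0) := by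
                refine sum_le_sum fun h _ => mul_le_mul_of_nonneg_left ?_ (Nat.cast_nonneg _)
                rw [le_div_iff₀ hr0p]; exact hwω h
            _ = (∑ h, Δ μ h : ℕ) * (ω / r0) := by rw [← sum_mul]; push_cast; rfl
            _ ≤ r0 * (ω / r0) := by
                refine mul_le_mul_of_nonneg_right ?_ (by positivity)
                have := hΔ μ; have := μ.2
                exact_mod_cast (by omega)
            _ = ω := by field_simp
      have h2 : (Δ' ν () : ℝ) ≤ ν := by
        have := hΔ' ν; simp at this; exact_mod_cast this
      have h3 := mul_le_mul_of_nonneg_right h2 hw0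
      linarith
    rcases idx_xp hWi with h | h
    · left
      rw [hF1m]
      intro d hd
      apply h d
      intro h0; apply hd
      rw [map_mul, show ∀ c, shift ξ (C c) = C c from fun c => by simp [shift], coeff_C_mul, h0, mul_zero]
    · right
      rw [hG1m]
      intro d hd
      apply h d
      intro h0; apply hd
      rw [map_mul, show ∀ c, shift η (C c) = C c from fun c => by simp [shift], coeff_C_mul, h0, mul_zero]

end

lemma sum_max_lower (c : ℝ) (hc0 : 0 < c) (hc1 : c ≤ 1) (r k : ℕ) (hr : 1 ≤ r) (hk : k ≤ r + 1) :
    k * (c ^ 2 / 8) ≤ ∑ ν : Fin k, max 0 (c - (ν : ℕ) * (1 / (r : ℝ))) := by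
  rw [Fin.sum_univ_eq_sum_range (fun ν => max 0 (c - (ν : ℕ) * (1 / (r : ℝ))))]
  have hrp : (0 : ℝ) < r := by exact_mod_cast hr
  set s := min k (⌊c * r / 2⌋₊ + 1) with hs
  have h1 : ∑ ν ∈ range s, (c / 2) ≤ ∑ ν ∈ range k, max 0 (c - (ν : ℕ) * (1 / (r : ℝ))) := by
    refine le_trans (sum_le_sum fun ν hν => ?_) (sum_le_sum_of_subset_of_nonneg
      (range_subset_range.2 (min_le_left _ _)) fun _ _ _ => le_max_left _ _)
    refine le_trans ?_ (le_max_right _ _)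
    have h2 : ν ≤ ⌊c * r / 2⌋₊ := by
      have := mem_range.1 hν; have := min_le_right k (⌊c * r / 2⌋₊ + 1); omega
    have h3 : (ν : ℝ) ≤ c * r / 2 := (Nat.le_floor_iff (by positivity)).1 h2
    have : (ν : ℝ) * (1 / r) ≤ c / 2 := by
      rw [mul_one_div, div_le_iff₀ hrp]; linarith
    linarith
  refine le_trans ?_ h1
  rw [sum_const, card_range, nsmul_eq_mul]
  have hs2 : (k : ℝ) * (c / 4) ≤ s := by
    rw [hs, Nat.cast_min]
    apply le_min
    · nlinarith [Nat.cast_nonneg (α := ℝ) k]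
    · have h4 := Nat.lt_floor_add_one (c * r / 2)
      push_cast
      have : (k : ℝ) ≤ 2 * r := by exact_mod_cast (by omega : k ≤ 2 * r)
      nlinarith
  nlinarith

/-- Roth's lemma -/
theorem rothLemma (n : ℕ) : ∀ θ : ℝ, 0 < θ → θ ≤ 1 → ∃ ω : ℝ, 0 < ω ∧ ω ≤ 1 ∧
    ∀ (r : Fin n → ℕ) (R : ℝ) (p : Fin n → ℤ) (q : Fin n → ℕ) (P : MvPolynomial (Fin n) ℤ),
      (∀ h, 1 ≤ r h) → (∀ h, (r h : ℝ) ≤ R) → (∀ i j, i < j → (r j : ℝ) ≤ ω * r i) →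
      (∀ h, 1 ≤ q h) → (∀ h, IsCoprime (p h) (q h : ℤ)) → P ≠ 0 → (∀ h, P.degreeOf h ≤ r h) →
      (∀ h, Real.log (l1 P) + R ≤ ω * (r h * Real.log (q h))) →
      ¬ IdxGE (fun h => (p h : ℚ) / q h) (fun h => 1 / (r h : ℝ)) θ (MvPolynomial.map (Int.castRingHom ℚ) P) := by
  induction n with
  | zero =>
    intro θ hθ hθ1
    refine ⟨1, one_pos, le_rfl, ?_⟩
    intro r R p q P _ _ _ _ _ hP _ _ hidx
    obtain ⟨a, rfl⟩ := C_surjective (Fin 0) P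
    have ha : a ≠ 0 := by rintro rfl; simp at hP
    have := hidx 0 (by rw [map_C, show ∀ (ξ : Fin 0 → ℚ) c, shift ξ (C c) = C c from fun ξ c => by simp [shift], coeff_zero_C]; simpa using ha)
    simp at this
    linarith
  | succ n ih =>
    intro θ hθ hθ1
    obtain ⟨ω2, hω2, hω21, IH⟩ := ih (θ ^ 2 / 64) (by positivity) (by nlinarith)
    set θ2 := θ ^ 2 / 64 with hθ2
    have hθ2p : 0 < θ2 := by positivity
    set Cn : ℝ := n + 5 with hCn
    have hCn1 : 1 ≤ Cn := by rw [hCn]; linarith [Nat.cast_nonneg (α := ℝ) n]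
    set ω := min (min (θ / 2) (ω2 / Cn)) (θ2 / (2 * Cn)) with hω
    have hωθ : ω ≤ θ / 2 := (min_le_left _ _).trans (min_le_left _ _)
    have hωω2 : ω * Cn ≤ ω2 := by
      rw [← le_div_iff₀ (by positivity)]; exact (min_le_left _ _).trans (min_le_right _ _)
    have hωθ2 : ω * (2 * Cn) ≤ θ2 := by
      rw [← le_div_iff₀ (by positivity)]; exact min_le_right _ _
    have hωp : 0 < ω := by
      rw [hω]; refine lt_min (lt_min ?_ ?_) ?_ <;> positivity
    have hωω2' : ω ≤ ω2 := by nlinarith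
    refine ⟨ω, hωp, by linarith, ?_⟩
    intro r R p q P hr1 hrR hrω hq hpq hP hdeg hlog hidx
    set ε : Fin (n + 1) ≃ Fin n ⊕ Unit := finSuccEquivLast.trans (Equiv.optionEquivSumPUnit (Fin n)) with hε
    have hεl : ∀ h : Fin n, ε.symm (Sum.inl h) = h.castSucc := by
      intro h; rw [Equiv.symm_apply_eq]; simp [hε]
    have hεr : ε.symm (Sum.inr ()) = Fin.last n := by
      rw [Equiv.symm_apply_eq]; simp [hε]
    set P' := rename ε P with hP'
    have hP'0 : P' ≠ 0 := by
      intro h0; apply hP; apply rename_injective ε ε.injective; rw [← hP', h0, map_zero]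
    set r0 := r (Fin.last n) with hr0
    have hR0 : 1 ≤ R := le_trans (by exact_mod_cast hr1 (Fin.last n)) (hrR (Fin.last n))
    set D := ∑ h : Fin n, r h.castSucc + r0 with hD
    have hDR : (D : ℝ) ≤ (n + 1) * R := by
      rw [hD]; push_cast
      have : ∑ h : Fin n, (r h.castSucc : ℝ) ≤ ∑ h : Fin n, R := sum_le_sum fun h _ => hrR _
      simp at this
      have := hrR (Fin.last n)
      rw [hr0]; linarith
    obtain ⟨k, hk1, hkr, F1, G1, hF0, hG0, hFdeg, hFl, hGl, hmain⟩ := wr_step P' hP'0 (fun h => r h.castSucc) r0 D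
      (fun h => by rw [hP', degreeOf_rename_equiv, hεl]; exact hdeg _)
      (by rw [hP', degreeOf_rename_equiv, hεr]; exact hdeg _) le_rfl
    have hP1 : 1 ≤ l1 P := one_le_l1_int hP
    have hlP : 0 ≤ Real.log (l1 P) := Real.log_nonneg hP1
    have hkR : (k : ℝ) ≤ 2 * R := by
      have h1 : (k : ℝ) ≤ r0 + 1 := by exact_mod_cast hkr
      have := hrR (Fin.last n)
      rw [← hr0] at this; linarith
    have hkp : (0 : ℝ) < k := by exact_mod_cast hk1
    have hl1P' : l1 P' ≤ l1 P := l1_rename _ _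
    -- log of the bound
    have hB : ∀ x : ℝ, 1 ≤ x → x ≤ k.factorial * (2 ^ D * l1 P') ^ k →
        Real.log x ≤ k * ((n + 3) * R + Real.log (l1 P)) := by
      intro x hx1 hx
      have h1 : x ≤ (k * (2 ^ D * l1 P)) ^ k := by
        refine hx.trans ?_
        rw [mul_pow (k : ℝ)]
        refine mul_le_mul (by exact_mod_cast Nat.factorial_le_pow k) ?_ (pow_nonneg (mul_nonneg (by positivity) (l1_nonneg _)) _) (by positivity)
        refine pow_le_pow_left₀ (mul_nonneg (by positivity) (l1_nonneg _)) ?_ _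
        exact mul_le_mul_of_nonneg_left hl1P' (by positivity)
      have h2 := Real.log_le_log (by linarith) h1
      refine h2.trans ?_
      rw [Real.log_pow]
      refine mul_le_mul_of_nonneg_left ?_ hkp.le
      rw [Real.log_mul (by positivity) (by positivity), Real.log_mul (by positivity) (by positivity), Real.log_pow]
      have h3 : Real.log k ≤ 2 * R := ((Real.log_le_sub_one_of_pos hkp).trans (by linarith)).trans hkR
      have h4 : (D : ℝ) * Real.log 2 ≤ (n + 1) * R := by
        have : Real.log 2 ≤ 1 := by have := Real.log_two_lt_d9; linarith
        have := Nat.cast_nonneg (α := ℝ) D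
        nlinarith
      linarith
    have hlogC : ∀ h, (n + 4) * R + Real.log (l1 P) ≤ Cn * (ω * (r h * Real.log (q h))) := by
      intro h
      have := hlog h
      have h2 := mul_le_mul_of_nonneg_left this (by linarith : (0:ℝ) ≤ Cn)
      refine le_trans ?_ h2
      rw [hCn]
      nlinarith [Nat.cast_nonneg (α := ℝ) n]
    have hidx' : IdxGE (Sum.elim (fun h : Fin n => (p h.castSucc : ℚ) / q h.castSucc) (fun _ => (p (Fin.last n) : ℚ) / q (Fin.last n)))
        (Sum.elim (fun h : Fin n => 1 / (r h.castSucc : ℝ)) (fun _ => 1 / (r0 : ℝ))) θ (MvPolynomial.map (Int.castRingHom ℚ) P') := by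
      rw [hP', map_rename]
      apply idx_rename
      convert hidx using 1
      · funext x
        obtain ⟨y, rfl⟩ := ε.symm.surjective x
        rw [Function.comp_apply, Equiv.apply_symm_apply]
        rcases y with y | y
        · rw [hεl]; rfl
        · rw [hεr]; rfl
      · funext x
        obtain ⟨y, rfl⟩ := ε.symm.surjective x
        rw [Function.comp_apply, Equiv.apply_symm_apply]
        rcases y with y | y
        · rw [hεl]; rfl
        · rw [hεr]; rfl
    have hr0p : (0 : ℝ) < r0 := by exact_mod_cast hr1 _
    have := hmain (fun h : Fin n => (p h.castSucc : ℚ) / q h.castSucc) (fun _ => (p (Fin.last n) : ℚ) / q (Fin.last n))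
      (fun h : Fin n => 1 / (r h.castSucc : ℝ)) (fun _ => 1 / (r0 : ℝ)) θ ω (k * θ2) (k * θ2) (fun h => by positivity)
      (by positivity) (fun h => by
        have h1 : (0 : ℝ) < r h.castSucc := by exact_mod_cast hr1 _
        rw [one_div, inv_mul_le_iff₀ h1, mul_comm]
        exact hrω _ _ (Fin.castSucc_lt_last h)) hωp.le hidx' (by
        have h1 := sum_max_lower (θ / 2) (by positivity) (by linarith) r0 k (hr1 _) hkr
        have h2 : ∑ ν : Fin k, max 0 (θ / 2 - (ν : ℕ) * (1 / (r0 : ℝ))) ≤ ∑ ν : Fin k, max 0 (θ - ω - (ν : ℕ) * (1 / (r0 : ℝ))) :=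
          sum_le_sum fun ν _ => max_le_max le_rfl (by linarith)
        refine le_trans (le_of_eq ?_) (h1.trans h2)
        rw [hθ2]; ring)
    rcases this with h | h
    · refine IH (fun h => k * r h.castSucc) (k * R) (fun h => p h.castSucc) (fun h => q h.castSucc) F1
        (fun h => Nat.mul_pos hk1 (hr1 _)) (fun h => ?_) (fun i j hij => ?_) (fun h => hq _) (fun h => hpq _) hF0 hFdeg
        (fun h => ?_) ?_
      · push_cast; exact mul_le_mul_of_nonneg_left (hrR _) hkp.le
      · push_cast
        have h1 := hrω _ _ (Fin.castSucc_lt_castSucc_iff.2 hij)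
        have : ω * (r i.castSucc : ℝ) ≤ ω2 * r i.castSucc := mul_le_mul_of_nonneg_right hωω2' (Nat.cast_nonneg _)
        nlinarith
      · have h1 := hB _ (one_le_l1_int hF0) hFl
        have h2 := hlogC h.castSucc
        have h3 : 0 ≤ (r h.castSucc : ℝ) * Real.log (q h.castSucc) :=
          mul_nonneg (Nat.cast_nonneg _) (Real.log_natCast_nonneg _)
        have h4 := mul_le_mul_of_nonneg_right hωω2 h3
        push_cast
        calc Real.log (l1 F1) + k * R ≤ k * ((n + 4) * R + Real.log (l1 P)) := by linarith
          _ ≤ k * (ω2 * (r h.castSucc * Real.log (q h.castSucc))) := by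
            refine mul_le_mul_of_nonneg_left ?_ hkp.le; linarith
          _ = _ := by ring
      · intro e he
        have h1 := h e he
        push_cast
        have : ∑ i, (e i : ℝ) * (1 / (k * r i.castSucc)) = (∑ i, (e i : ℝ) * (1 / r i.castSucc)) / k := by
          rw [sum_div]; refine sum_congr rfl fun i _ => ?_
          rw [one_div, one_div, mul_inv]; ring
        rw [this, le_div_iff₀ hkp]; linarith
    · set s := ⌈(k : ℝ) * θ2 * r0⌉₊ with hs
      have h1 := one_var (p (Fin.last n)) (q (Fin.last n)) (hq _) (hpq _) G1 hG0 s (fun e he => by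
        have h2 := h e he
        simp only [univ_unique, PUnit.default_eq_unit, sum_singleton] at h2
        rw [hs, Nat.ceil_le]
        rw [mul_one_div, le_div_iff₀ hr0p] at h2
        exact h2)
      have hqp : (1 : ℝ) ≤ q (Fin.last n) := by exact_mod_cast hq _
      have h2 := Real.log_le_log (by positivity) h1
      rw [Real.log_pow] at h2
      have h3 := hB _ (one_le_l1_int hG0) hGl
      have h4 := hlogC (Fin.last n)
      have h5 : (k : ℝ) * θ2 * r0 ≤ s := Nat.le_ceil _
      have hlq : 0 ≤ Real.log (q (Fin.last n)) := Real.log_nonneg hqp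
      have h6 := mul_le_mul_of_nonneg_right h5 hlq
      have h7 : 0 ≤ (r0 : ℝ) * Real.log (q (Fin.last n)) := mul_nonneg hr0p.le hlq
      have h8 := mul_le_mul_of_nonneg_right hωθ2 h7
      -- k * ((n+3) R + log) < k * ((n+4)R + log) ≤ k * Cn ω r0 log q ≤ k θ2/2 r0 log q
      have h9 : θ2 * (r0 * Real.log (q (Fin.last n))) ≤ (n + 3) * R + Real.log (l1 P) := by
        have : (k : ℝ) * (θ2 * (r0 * Real.log (q (Fin.last n)))) ≤ k * ((n + 3) * R + Real.log (l1 P)) := by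
          calc _ = (k : ℝ) * θ2 * r0 * Real.log (q (Fin.last n)) := by ring
            _ ≤ _ := h6.trans (h2.trans h3)
        exact le_of_mul_le_mul_left this hkp
      rw [← hr0] at h4
      nlinarith

end
end SchmidtPf

namespace SchmidtPf
open Finset
noncomputable section

section Anorm
variable (A : Type) [CommRing A] [Module.Free ℤ A] [Module.Finite ℤ A]

abbrev bIx := Module.Free.ChooseBasisIndex ℤ A
abbrev bA : Module.Basis (bIx A) ℤ A := Module.Free.chooseBasis ℤ A

attribute [local instance] Matrix.linftyOpNormedRing

open Classical in
/-- the regular representation over ℝ -/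
def regR : A →+* Matrix (bIx A) (bIx A) ℝ :=
  (Int.castRingHom ℝ).mapMatrix.comp (Algebra.leftMulMatrix (bA A)).toRingHom

open Classical in
/-- the norm on A -/
@[reducible] def normA : SeminormedCommRing A := SeminormedCommRing.induced A (Matrix (bIx A) (bIx A) ℝ) (regR A)

def nA (x : A) : ℝ := by classical exact ‖regR A x‖

variable {A}
lemma nA_eq (x : A) : @norm A (normA A).toNorm x = nA A x := rfl

lemma nA_one [Nontrivial A] : nA A (1 : A) = 1 := by
  classical
  unfold nA
  rw [map_one]
  haveI : Nonempty (bIx A) := (bA A).index_nonempty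
  exact norm_one

lemma entry_le (x : A) (i j : bIx A) : |(regR A x i j : ℝ)| ≤ nA A x := by
  classical
  unfold nA
  rw [Matrix.linfty_opNorm_def]
  have h1 : ‖regR A x i j‖₊ ≤ ∑ k, ‖regR A x i k‖₊ :=
    single_le_sum (f := fun k => ‖regR A x i k‖₊) (fun _ _ => by positivity) (mem_univ j)
  have h2 : ∑ k, ‖regR A x i k‖₊ ≤ univ.sup fun i => ∑ k, ‖regR A x i k‖₊ :=
    le_sup (f := fun i => ∑ k, ‖regR A x i k‖₊) (mem_univ i)
  have := h1.trans h2
  rw [← Real.norm_eq_abs]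
  exact_mod_cast this

lemma regR_apply (x : A) (i j : bIx A) : regR A x i j = (((bA A).repr (x * bA A j) i : ℤ) : ℝ) := by
  classical
  simp [regR, Algebra.leftMulMatrix_eq_repr_mul]

lemma nA_nonneg (x : A) : 0 ≤ nA A x := by
  classical
  exact norm_nonneg _

variable (A) in
lemma coord_bound : ∃ C : ℝ, 1 ≤ C ∧ ∀ (x : A) (i : bIx A), |(((bA A).repr x i : ℤ) : ℝ)| ≤ C * nA A x := by
  classical
  refine ⟨1 + ∑ j, |(((bA A).repr 1 j : ℤ) : ℝ)|, by linarith [sum_nonneg (s := univ) fun j (_ : j ∈ univ) => abs_nonneg (((bA A).repr 1 j : ℤ) : ℝ)], ?_⟩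
  intro x i
  have h1 : (bA A).repr x i = ∑ j, (bA A).repr 1 j * (bA A).repr (x * bA A j) i := by
    have : x = ∑ j, (bA A).repr 1 j • (x * bA A j) := by
      conv_lhs => rw [← mul_one x, ← (bA A).sum_repr 1, mul_sum]
      refine sum_congr rfl fun j _ => ?_
      rw [mul_smul_comm]
    conv_lhs => rw [this]
    rw [map_sum, Finsupp.finset_sum_apply]
    refine sum_congr rfl fun j _ => ?_
    rw [map_zsmul, Finsupp.smul_apply, smul_eq_mul]
  rw [h1]
  push_cast
  refine (abs_sum_le_sum_abs _ _).trans ?_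
  rw [add_mul, sum_mul, one_mul]
  have : ∑ j, |(((bA A).repr 1 j : ℤ) : ℝ) * (((bA A).repr (x * bA A j) i : ℤ) : ℝ)| ≤ ∑ j, |(((bA A).repr 1 j : ℤ) : ℝ)| * nA A x := by
    refine sum_le_sum fun j _ => ?_
    rw [abs_mul]
    refine mul_le_mul_of_nonneg_left ?_ (abs_nonneg _)
    rw [← regR_apply]; exact entry_le _ _ _
  linarith [nA_nonneg x]

lemma psi_bound (ψ : A →+* ℝ) : ∃ C : ℝ, 1 ≤ C ∧ ∀ x : A, |ψ x| ≤ C * nA A x := by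
  classical
  obtain ⟨C, hC1, hC⟩ := coord_bound A
  refine ⟨1 + C * ∑ j, |ψ (bA A j)|, by
    have := mul_nonneg (by linarith : 0 ≤ C) (sum_nonneg (s := univ) fun j (_ : j ∈ univ) => abs_nonneg (ψ (bA A j)))
    linarith, ?_⟩
  intro x
  have h1 : ψ x = ∑ j, (((bA A).repr x j : ℤ) : ℝ) * ψ (bA A j) := by
    conv_lhs => rw [← (bA A).sum_repr x, map_sum]
    refine sum_congr rfl fun j _ => ?_
    rw [zsmul_eq_mul, map_mul, map_intCast]
  rw [h1]
  refine (abs_sum_le_sum_abs _ _).trans ?_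
  have : ∑ j, |(((bA A).repr x j : ℤ) : ℝ) * ψ (bA A j)| ≤ ∑ j, C * nA A x * |ψ (bA A j)| := by
    refine sum_le_sum fun j _ => ?_
    rw [abs_mul]
    exact mul_le_mul_of_nonneg_right (hC _ _) (abs_nonneg _)
  rw [← mul_sum] at this
  nlinarith [nA_nonneg x]

lemma liouville [IsDomain A] (ψ : A →+* ℝ) : ∃ c : ℝ, 0 < c ∧ ∃ D : ℕ, ∀ x : A, x ≠ 0 →
    c ≤ |ψ x| * (max 1 (nA A x)) ^ D := by
  classical
  set D := Fintype.card (bIx A) with hD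
  set s := ∑ j, |ψ (bA A j)| with hs
  have hspos : 0 < s := by
    by_contra h
    have h0 : s = 0 := le_antisymm (not_lt.1 h) (sum_nonneg fun _ _ => abs_nonneg _)
    have hz : ∀ j, ψ (bA A j) = 0 := fun j => abs_eq_zero.1 ((sum_eq_zero_iff_of_nonneg fun _ _ => abs_nonneg _).1 h0 j (mem_univ _))
    have : ψ 1 = 0 := by
      rw [← (bA A).sum_repr 1, map_sum]
      refine sum_eq_zero fun j _ => ?_
      rw [zsmul_eq_mul, map_mul, hz, mul_zero]
    simp at this
  have hcard : 0 < D := by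
    haveI : Nonempty (bIx A) := (bA A).index_nonempty
    exact Fintype.card_pos
  refine ⟨1 / (D * D.factorial), by positivity, D, ?_⟩
  intro x hx
  set M := (regR A x).transpose with hM
  set v : bIx A → ℝ := fun j => ψ (bA A j) with hv
  have hMv : M.mulVec v = ψ x • v := by
    funext j
    simp only [Matrix.mulVec, dotProduct, hM, Matrix.transpose_apply, regR_apply, hv, Pi.smul_apply, smul_eq_mul]
    rw [← map_mul]
    conv_rhs => rw [← (bA A).sum_repr (x * bA A j), map_sum]
    refine sum_congr rfl fun i _ => ?_
    rw [map_zsmul ψ, zsmul_eq_mul]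
  have hdet : 1 ≤ |M.det| := by
    have h1 : M.det = ((Algebra.norm ℤ x : ℤ) : ℝ) := by
      rw [hM, Matrix.det_transpose, Algebra.norm_eq_matrix_det (bA A), regR]
      simp only [RingHom.comp_apply]
      rw [← RingHom.map_det]; rfl
    rw [h1]
    have : Algebra.norm ℤ x ≠ 0 := (Algebra.norm_ne_zero_iff_of_basis (bA A)).2 hx
    exact_mod_cast Int.one_le_abs this
  have hadj : M.det • v = ψ x • (M.adjugate.mulVec v) := by
    rw [← Matrix.mulVec_smul, ← hMv, Matrix.mulVec_mulVec, Matrix.adjugate_mul, Matrix.smul_mulVec, Matrix.one_mulVec]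
  set b := max 1 (nA A x) with hb
  have hadje : ∀ i j, |M.adjugate i j| ≤ D.factorial * b ^ D := by
    intro i j
    rw [Matrix.adjugate_apply]
    have := Matrix.det_le (A := M.updateRow j (Pi.single i 1)) (abv := AbsoluteValue.abs) (x := b) ?_
    · simpa [hD, nsmul_eq_mul] using this
    intro i' j'
    rw [Matrix.updateRow_apply]
    split_ifs
    · rw [Pi.single_apply]; split_ifs <;> simp [hb]
    · exact (entry_le x j' i').trans (le_max_right _ _)
  have hsum : |M.det| * s ≤ |ψ x| * (D * (D.factorial * b ^ D * s)) := by
    have h1 : ∀ i, |M.det| * |v i| ≤ |ψ x| * (D.factorial * b ^ D * s) := by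
      intro i
      have h2 := congrFun hadj i
      simp only [Pi.smul_apply, smul_eq_mul] at h2
      rw [← abs_mul, h2, abs_mul]
      refine mul_le_mul_of_nonneg_left ?_ (abs_nonneg _)
      rw [Matrix.mulVec, dotProduct, hs, mul_sum]
      refine (abs_sum_le_sum_abs _ _).trans (sum_le_sum fun j _ => ?_)
      rw [abs_mul]
      exact mul_le_mul_of_nonneg_right (hadje _ _) (abs_nonneg _)
    have h3 := sum_le_sum fun i (_ : i ∈ univ) => h1 i
    rw [← mul_sum, sum_const, card_univ, ← hD, nsmul_eq_mul] at h3
    refine h3.trans (le_of_eq ?_); ring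
  have h4 : s ≤ (|ψ x| * b ^ D * (D * D.factorial)) * s := by
    calc s = 1 * s := (one_mul _).symm
      _ ≤ |M.det| * s := mul_le_mul_of_nonneg_right hdet hspos.le
      _ ≤ _ := hsum
      _ = _ := by ring
  rw [div_le_iff₀ (by positivity)]
  by_contra hlt
  push Not at hlt
  nlinarith

end Anorm
end
end SchmidtPf

namespace SchmidtPf
open Finset
noncomputable section

lemma var_sum {m : ℕ} {β : Type*} (S : Fin m → Finset β) (f : Fin m → β → ℝ)
    (h1 : ∀ h, ∀ x ∈ S h, |f h x| ≤ 1) (h0 : ∀ h, ∑ x ∈ S h, f h x = 0) :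
    ∑ J ∈ Fintype.piFinset S, (∑ h, f h (J h)) ^ 2 ≤ m * (Fintype.piFinset S).card := by
  classical
  have hoff : ∀ h h', h ≠ h' → ∑ J ∈ Fintype.piFinset S, f h (J h) * f h' (J h') = 0 := by
    intro h h' hne
    have e := Finset.prod_univ_sum S (fun k x => (if h = k then f k x else 1) * (if h' = k then f k x else 1))
    have e2 : ∀ J ∈ Fintype.piFinset S, ∏ k, ((if h = k then f k (J k) else 1) * (if h' = k then f k (J k) else 1)) = f h (J h) * f h' (J h') := by
      intro J _
      rw [prod_mul_distrib, prod_ite_eq, prod_ite_eq]; simp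
    rw [sum_congr rfl e2] at e
    rw [← e]
    refine prod_eq_zero (mem_univ h) ?_
    rw [← h0 h]
    refine sum_congr rfl fun x _ => ?_
    simp [hne.symm]
  have e1 : ∀ J : Fin m → β, (∑ h, f h (J h)) ^ 2 = ∑ h, ∑ h', f h (J h) * f h' (J h') := by
    intro J
    rw [sq, sum_mul_sum]
  rw [sum_congr rfl fun J _ => e1 J, sum_comm]
  have e3 : ∀ h, ∑ J ∈ Fintype.piFinset S, ∑ h', f h (J h) * f h' (J h') ≤ (Fintype.piFinset S).card := by
    intro h
    rw [sum_comm, sum_eq_single h]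
    · calc ∑ J ∈ Fintype.piFinset S, f h (J h) * f h (J h) ≤ ∑ J ∈ Fintype.piFinset S, (1:ℝ) := by
            refine sum_le_sum fun J hJ => ?_
            have := h1 h (J h) (Fintype.mem_piFinset.1 hJ h)
            rw [← abs_mul_abs_self]
            nlinarith [abs_nonneg (f h (J h))]
        _ = _ := by simp
    · intro b _ hb; exact hoff h b hb.symm
    · simp
  refine (sum_le_sum fun h _ => e3 h).trans ?_
  simp

variable {ι : Type} [Fintype ι] [DecidableEq ι]

/-- compositions -/
abbrev cmp (ι : Type) [Fintype ι] [DecidableEq ι] (r : ℕ) : Finset (ι → ℕ) := Finset.piAntidiag univ r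

lemma mem_cmp {r : ℕ} {J : ι → ℕ} : J ∈ cmp ι r ↔ ∑ i, J i = r := by
  simp [cmp, mem_piAntidiag]

lemma mean_cmp (r : ℕ) (i j : ι) : ∑ J ∈ cmp ι r, (J i : ℝ) = ∑ J ∈ cmp ι r, (J j : ℝ) := by
  refine sum_nbij' (fun J => J ∘ Equiv.swap i j) (fun J => J ∘ Equiv.swap i j) ?_ ?_ ?_ ?_ ?_
  · intro J hJ
    rw [mem_cmp] at *
    rw [← hJ]
    exact Equiv.sum_comp (Equiv.swap i j) J
  · intro J hJ
    rw [mem_cmp] at *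
    rw [← hJ]
    exact Equiv.sum_comp (Equiv.swap i j) J
  · intro J _; funext k; simp
  · intro J _; funext k; simp
  · intro J _; simp

lemma mean_cmp' (r : ℕ) (i : ι) : (Fintype.card ι : ℝ) * ∑ J ∈ cmp ι r, (J i : ℝ) = (cmp ι r).card * r := by
  have : ∑ j, ∑ J ∈ cmp ι r, (J j : ℝ) = (cmp ι r).card * r := by
    rw [sum_comm, sum_congr rfl (g := fun _ => (r:ℝ))]
    · simp
    · intro J hJ
      rw [mem_cmp] at hJ
      exact_mod_cast hJ
  rw [← this, sum_congr rfl fun j _ => mean_cmp r j i]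
  simp

/-- multi-compositions -/
abbrev mcmp (ι : Type) [Fintype ι] [DecidableEq ι] {m : ℕ} (r : Fin m → ℕ) : Finset (Fin m → ι → ℕ) :=
  Fintype.piFinset fun h => cmp ι (r h)

lemma cheb {m : ℕ} (hm : 1 ≤ m) (r : Fin m → ℕ) (hr : ∀ h, 1 ≤ r h) {ε : ℝ} (hε : 0 < ε) (i : ι) :
    (((mcmp ι r).filter fun J => ε * m < |∑ h, ((J h i : ℝ) / r h) - m / Fintype.card ι|).card : ℝ) * (ε ^ 2 * m)
      ≤ (mcmp ι r).card := by
  have hN : (1:ℝ) ≤ Fintype.card ι := by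
    haveI : Nonempty ι := ⟨i⟩
    exact_mod_cast Fintype.card_pos
  have hm' : (1:ℝ) ≤ m := by exact_mod_cast hm
  have key := var_sum (fun h => cmp ι (r h)) (fun h J => (J i : ℝ) / r h - 1 / Fintype.card ι) ?_ ?_
  · set F := (mcmp ι r).filter fun J => ε * m < |∑ h, ((J h i : ℝ) / r h) - m / Fintype.card ι| with hF
    have h2 : (F.card : ℝ) * (ε * m) ^ 2 ≤ ∑ J ∈ mcmp ι r, (∑ h, ((J h i : ℝ) / r h - 1 / Fintype.card ι)) ^ 2 := by
      rw [← nsmul_eq_mul, ← sum_const]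
      refine (sum_le_sum fun J hJ => ?_).trans (sum_le_sum_of_subset_of_nonneg (filter_subset _ _) fun _ _ _ => sq_nonneg _)
      rw [hF, mem_filter] at hJ
      have e : ∑ h, ((J h i : ℝ) / r h - 1 / Fintype.card ι) = ∑ h, ((J h i : ℝ) / r h) - m / Fintype.card ι := by
        rw [sum_sub_distrib]; simp [div_eq_mul_inv]
      rw [e, ← sq_abs (∑ h, ((J h i : ℝ) / r h) - m / Fintype.card ι)]
      exact pow_le_pow_left₀ (by positivity) hJ.2.le 2
    have h3 := h2.trans key
    have h4 : (m:ℝ) * ((F.card : ℝ) * (ε ^ 2 * m)) ≤ m * (mcmp ι r).card := by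
      refine le_trans (le_of_eq ?_) h3; ring
    exact le_of_mul_le_mul_left h4 (by linarith)
  · intro h J hJ
    rw [mem_cmp] at hJ
    have h1 : (J i : ℝ) ≤ r h := by
      rw [← hJ]; exact_mod_cast single_le_sum (f := J) (fun _ _ => Nat.zero_le _) (mem_univ i)
    have hr1 : (1:ℝ) ≤ r h := by exact_mod_cast hr h
    have h2 : (J i : ℝ) / r h ≤ 1 := by rw [div_le_one (by linarith)]; exact h1
    have h3 : 0 ≤ (J i : ℝ) / r h := by positivity
    have h4 : 1 / (Fintype.card ι : ℝ) ≤ 1 := by rw [div_le_one (by linarith)]; exact hN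
    have h5 : 0 ≤ 1 / (Fintype.card ι : ℝ) := by positivity
    rw [abs_le]; constructor <;> linarith
  · intro h
    have hr1 : (1:ℝ) ≤ r h := by exact_mod_cast hr h
    rw [sum_sub_distrib, ← sum_div, sum_const, nsmul_eq_mul]
    have := mean_cmp' (ι := ι) (r h) i
    field_simp
    linarith

/-- good multi-exponents -/
def Good {m : ℕ} (r : Fin m → ℕ) (ε : ℝ) (J : Fin m → ι → ℕ) : Prop :=
  ∀ i, |∑ h, ((J h i : ℝ) / r h) - m / Fintype.card ι| ≤ ε * m

open Classical in
lemma card_bad {m : ℕ} (hm : 1 ≤ m) (r : Fin m → ℕ) (hr : ∀ h, 1 ≤ r h) {ε : ℝ} (hε : 0 < ε) :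
    (((mcmp ι r).filter fun J => ¬ Good r ε J).card : ℝ) * (ε ^ 2 * m)
      ≤ Fintype.card ι * (mcmp ι r).card := by
  have hsub : ((mcmp ι r).filter fun J => ¬ Good r ε J) ⊆ univ.biUnion fun i : ι =>
      ((mcmp ι r).filter fun J => ε * m < |∑ h, ((J h i : ℝ) / r h) - m / Fintype.card ι|) := by
    intro J hJ
    rw [mem_filter] at hJ
    obtain ⟨hJ1, hJ2⟩ := hJ
    simp only [Good, not_forall, not_le] at hJ2
    obtain ⟨i, hi⟩ := hJ2
    rw [mem_biUnion]
    exact ⟨i, mem_univ _, mem_filter.2 ⟨hJ1, hi⟩⟩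
  have h1 : (((mcmp ι r).filter fun J => ¬ Good r ε J).card : ℝ) ≤ ∑ i : ι,
      (((mcmp ι r).filter fun J => ε * m < |∑ h, ((J h i : ℝ) / r h) - m / Fintype.card ι|).card : ℝ) := by
    exact_mod_cast (card_le_card hsub).trans card_biUnion_le
  refine (mul_le_mul_of_nonneg_right h1 (by positivity)).trans ?_
  rw [sum_mul]
  refine (sum_le_sum fun i _ => cheb hm r hr hε i).trans ?_
  simp

lemma card_mcmp_le {m : ℕ} (r : Fin m → ℕ) : (mcmp ι r).card ≤ (2 ^ Fintype.card ι) ^ (∑ h, r h) := by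
  rw [Fintype.card_piFinset, ← prod_pow_eq_pow_sum]
  refine prod_le_prod' fun h _ => ?_
  have : cmp ι (r h) ⊆ Fintype.piFinset fun _ : ι => range (r h + 1) := by
    intro J hJ
    rw [mem_cmp] at hJ
    rw [Fintype.mem_piFinset]
    intro i
    rw [mem_range, Nat.lt_succ_iff, ← hJ]
    exact single_le_sum (f := J) (fun _ _ => Nat.zero_le _) (mem_univ i)
  refine (card_le_card this).trans ?_
  rw [Fintype.card_piFinset]
  simp only [card_range, prod_const, card_univ]
  rw [← pow_mul, mul_comm, pow_mul]
  exact Nat.pow_le_pow_left (Nat.lt_two_pow_self) _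

end
end SchmidtPf

namespace SchmidtPf
open Finset MvPolynomial
noncomputable section
set_option linter.unusedSectionVars false
set_option linter.style.haveILetI false

section siegel
attribute [local instance] Matrix.seminormedAddCommGroup
lemma siegel {α β : Type*} [Fintype α] [Fintype β] (M : Matrix α β ℤ) (hc : 2 * Fintype.card α ≤ Fintype.card β)
    (hb : 0 < Fintype.card β) (B : ℝ) (hB : 1 ≤ B) (hM : ∀ i j, |(M i j : ℝ)| ≤ B) :
    ∃ t : β → ℤ, t ≠ 0 ∧ M.mulVec t = 0 ∧ ∀ j, |(t j : ℝ)| ≤ Fintype.card β * B := by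
  have hb1 : (1:ℝ) ≤ Fintype.card β := by exact_mod_cast hb
  rcases Nat.eq_zero_or_pos (Fintype.card α) with h0 | h0
  · haveI : IsEmpty α := Fintype.card_eq_zero_iff.1 h0
    refine ⟨fun _ => 1, ?_, ?_, ?_⟩
    · obtain ⟨j⟩ := Fintype.card_pos_iff.1 hb
      intro h; simpa using congrFun h j
    · funext i; exact isEmptyElim i
    · intro j; simp; nlinarith
  · obtain ⟨t, h1, h2, h3⟩ := Int.Matrix.exists_ne_zero_int_vec_norm_le M (by omega) h0
    refine ⟨t, h1, h2, fun j => ?_⟩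
    have e1 : |(t j : ℝ)| ≤ ‖t‖ := by
      rw [← Int.norm_eq_abs]; exact norm_le_pi_norm t j
    have e2 : ‖M‖ ≤ B := by
      rw [Matrix.norm_le_iff (by linarith)]
      intro i j; rw [Int.norm_eq_abs]; exact hM i j
    have e3 : (Fintype.card β * max 1 ‖M‖ : ℝ) ≤ Fintype.card β * B :=
      mul_le_mul_of_nonneg_left (max_le hB e2) (by linarith)
    have e4 : (1:ℝ) ≤ Fintype.card β * max 1 ‖M‖ := by
      nlinarith [le_max_left 1 ‖M‖]
    have hc' : (2 * Fintype.card α : ℝ) ≤ Fintype.card β := by exact_mod_cast hc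
    have h0' : (1 : ℝ) ≤ Fintype.card α := by exact_mod_cast h0
    have e5 : (Fintype.card α : ℝ) / (Fintype.card β - Fintype.card α) ≤ 1 := by
      rw [div_le_one (by linarith)]; linarith
    calc |(t j : ℝ)| ≤ ‖t‖ := e1
      _ ≤ _ := h3
      _ ≤ (Fintype.card β * max 1 ‖M‖ : ℝ) ^ (1:ℝ) := Real.rpow_le_rpow_of_exponent_le e4 e5
      _ ≤ _ := by rw [Real.rpow_one]; exact e3
end siegel

variable {ι : Type} [Fintype ι] [DecidableEq ι] {m : ℕ}

/-- multihomogeneity -/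
def MHom {R : Type*} [CommSemiring R] (r : Fin m → ℕ) (P : MvPolynomial (Fin m × ι) R) : Prop :=
  ∀ J, P.coeff J ≠ 0 → ∀ h, ∑ i, J (h, i) = r h

/-- linear substitution in each block -/
def lsub {R S : Type*} [CommRing R] [CommRing S] (φ : R →+* S) (F : Fin m → Matrix ι ι S) :
    MvPolynomial (Fin m × ι) R →+* MvPolynomial (Fin m × ι) S :=
  eval₂Hom (C.comp φ) (fun p => ∑ i, C (F p.1 p.2 i) * X (p.1, i))

lemma lsub_X {R S : Type*} [CommRing R] [CommRing S] (φ : R →+* S) (F : Fin m → Matrix ι ι S) (p : Fin m × ι) :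
    lsub φ F (X p) = ∑ i, C (F p.1 p.2 i) * X (p.1, i) := by simp [lsub]

lemma lsub_C {R S : Type*} [CommRing R] [CommRing S] (φ : R →+* S) (F : Fin m → Matrix ι ι S) (a : R) :
    lsub φ F (C a) = C (φ a) := by simp [lsub]

lemma lsub_comp {R S T : Type*} [CommRing R] [CommRing S] [CommRing T] (φ : R →+* S) (F : Fin m → Matrix ι ι S)
    (φ' : S →+* T) (G : Fin m → Matrix ι ι T) :
    (lsub φ' G).comp (lsub φ F) = lsub (φ'.comp φ) (fun h => (F h).map φ' * G h) := by
  refine MvPolynomial.ringHom_ext ?_ ?_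
  · intro a; simp [lsub_C]
  · intro p
    rw [RingHom.comp_apply, lsub_X, lsub_X, map_sum]
    simp only [map_mul, lsub_C, lsub_X, Matrix.mul_apply, Matrix.map_apply, map_sum, mul_sum, sum_mul]
    rw [sum_comm]
    refine sum_congr rfl fun i _ => sum_congr rfl fun j _ => ?_
    ring

lemma lsub_one {R : Type*} [CommRing R] : lsub (m := m) (RingHom.id R) (fun _ => (1 : Matrix ι ι R)) = RingHom.id _ := by
  refine MvPolynomial.ringHom_ext ?_ ?_
  · intro a; simp [lsub_C]
  · intro p
    rw [lsub_X]
    simp [Matrix.one_apply, ite_mul, apply_ite C]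

lemma lsub_map {R S T : Type*} [CommRing R] [CommRing S] [CommRing T] (φ : R →+* S) (F : Fin m → Matrix ι ι S)
    (φ' : S →+* T) (P : MvPolynomial (Fin m × ι) R) :
    MvPolynomial.map φ' (lsub φ F P) = lsub (φ'.comp φ) (fun h => (F h).map φ') P := by
  have : (MvPolynomial.map φ').comp (lsub φ F) = lsub (φ'.comp φ) (fun h => (F h).map φ') := by
    refine MvPolynomial.ringHom_ext ?_ ?_
    · intro a; simp [lsub_C]
    · intro p; simp [lsub_X]
  rw [← this]; rfl

lemma lsub_map_left {R S T : Type*} [CommRing R] [CommRing S] [CommRing T] (φ : R →+* S)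
    (φ' : S →+* T) (G : Fin m → Matrix ι ι T) (P : MvPolynomial (Fin m × ι) R) :
    lsub φ' G (MvPolynomial.map φ P) = lsub (φ'.comp φ) G P := by
  have : (lsub φ' G).comp (MvPolynomial.map φ) = lsub (φ'.comp φ) G := by
    refine MvPolynomial.ringHom_ext ?_ ?_
    · intro a; simp [lsub_C]
    · intro p; simp [lsub_X]
  rw [← this]; rfl

lemma lsub_eq {R S : Type*} [CommRing R] [CommRing S] (φ : R →+* S) (F : Fin m → Matrix ι ι S)
    (P : MvPolynomial (Fin m × ι) R) : lsub φ F P = ∑ J ∈ P.support, C (φ (P.coeff J)) *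
      ∏ p, (∑ i, C (F p.1 p.2 i) * X (p.1, i)) ^ J p := by
  rw [lsub, coe_eval₂Hom, eval₂_eq']; rfl

/-- block weight -/
def bw (h : Fin m) : Fin m × ι → ℕ := fun p => if p.1 = h then 1 else 0

lemma weight_bw (h : Fin m) (J : Fin m × ι →₀ ℕ) : Finsupp.weight (bw h) J = ∑ i, J (h, i) := by
  rw [Finsupp.weight_apply, Finsupp.sum_fintype _ _ (by simp), Fintype.sum_prod_type, sum_eq_single h]
  · simp [bw]
  · intro b _ hb; simp [bw, hb]
  · simp

lemma mhom_iff {R : Type*} [CommSemiring R] {r : Fin m → ℕ} {P : MvPolynomial (Fin m × ι) R} :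
    MHom r P ↔ ∀ h, IsWeightedHomogeneous (bw h) P (r h) := by
  constructor
  · intro H h J hJ; rw [weight_bw]; exact H J hJ h
  · intro H J hJ h; rw [← weight_bw]; exact H h hJ

lemma lprod_hom {S : Type*} [CommRing S] (F : Fin m → Matrix ι ι S) (J : Fin m × ι →₀ ℕ) :
    MHom (fun h => ∑ i, J (h, i)) (∏ p, (∑ i, C (F p.1 p.2 i) * X (p.1, i)) ^ J p) := by
  rw [mhom_iff]
  intro h
  have : ∑ i, J (h, i) = ∑ p, J p • bw h p := by
    rw [← weight_bw, Finsupp.weight_apply, Finsupp.sum_fintype _ _ (by simp)]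
  rw [this]
  refine IsWeightedHomogeneous.prod _ _ _ fun p _ => IsWeightedHomogeneous.pow ?_ _
  refine IsWeightedHomogeneous.sum _ _ _ fun i _ => ?_
  exact (isWeightedHomogeneous_X S (bw h) (p.1, i)).C_mul _

lemma MHom.lsub {R S : Type*} [CommRing R] [CommRing S] {φ : R →+* S} {F : Fin m → Matrix ι ι S}
    {r : Fin m → ℕ} {P : MvPolynomial (Fin m × ι) R} (hP : MHom r P) : MHom r (lsub φ F P) := by
  rw [lsub_eq, mhom_iff]
  intro h
  refine IsWeightedHomogeneous.sum _ _ _ fun J hJ => ?_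
  have h1 := mhom_iff.1 (lprod_hom F J) h
  simp only [hP J (mem_support_iff.1 hJ) h] at h1
  exact h1.C_mul _

lemma l1_lin {S : Type*} [SeminormedCommRing S] [NormOneClass S] (F : Matrix ι ι S) (h : Fin m) (k : ι) :
    l1 (∑ i, C (F k i) * X (h, i) : MvPolynomial (Fin m × ι) S) ≤ ∑ i, ‖F k i‖ := by
  refine (l1_sum_le _ _).trans (sum_le_sum fun i _ => ?_)
  refine (l1_mul_le _ _).trans ?_
  rw [l1_C, l1_X, mul_one]

lemma l1_lprod {S : Type*} [SeminormedCommRing S] [NormOneClass S] (F : Fin m → Matrix ι ι S) {c : ℝ}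
    (hc : ∀ h k, ∑ i, ‖F h k i‖ ≤ c) (J : Fin m × ι →₀ ℕ) :
    l1 (∏ p, (∑ i, C (F p.1 p.2 i) * X (p.1, i)) ^ J p : MvPolynomial (Fin m × ι) S) ≤ c ^ (∑ p, J p) := by
  refine (l1_prod_le _ _).trans ?_
  rw [← prod_pow_eq_pow_sum]
  refine prod_le_prod (fun _ _ => l1_nonneg _) fun p _ => ?_
  refine (l1_pow_le _ _).trans (pow_le_pow_left₀ (l1_nonneg _) ((l1_lin _ _ _).trans (hc _ _)) _)

lemma l1_lsub {R S : Type*} [CommRing R] [SeminormedCommRing S] [NormOneClass S] {φ : R →+* S} {F : Fin m → Matrix ι ι S}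
    {r : Fin m → ℕ} {P : MvPolynomial (Fin m × ι) R} (hP : MHom r P) {c : ℝ}
    (hc : ∀ h k, ∑ i, ‖F h k i‖ ≤ c) :
    l1 (SchmidtPf.lsub φ F P) ≤ (∑ J ∈ P.support, ‖φ (P.coeff J)‖) * c ^ (∑ h, r h) := by
  rw [lsub_eq, sum_mul]
  refine (l1_sum_le _ _).trans (sum_le_sum fun J hJ => ?_)
  refine (l1_mul_le _ _).trans ?_
  rw [l1_C]
  refine mul_le_mul_of_nonneg_left ((l1_lprod F hc J).trans (le_of_eq ?_)) (norm_nonneg _)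
  congr 1
  rw [Fintype.sum_prod_type]
  exact sum_congr rfl fun h _ => hP J (mem_support_iff.1 hJ) h

/-- exponent conversion -/
def toF : (Fin m → ι → ℕ) ≃ (Fin m × ι →₀ ℕ) where
  toFun J := Finsupp.equivFunOnFinite.symm fun p => J p.1 p.2
  invFun J := fun h i => J (h, i)
  left_inv _ := rfl
  right_inv J := by ext p; rfl

@[simp] lemma toF_apply (J : Fin m → ι → ℕ) (p) : toF J p = J p.1 p.2 := rfl

lemma lprod_coeff_bound {S : Type} [SeminormedCommRing S] [NormOneClass S] (E : Matrix ι ι S) :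
    ∃ c : ℝ, 1 ≤ c ∧ ∀ (m : ℕ) (J J' : Fin m × ι →₀ ℕ),
      ‖coeff J' (∏ p, (∑ i, C (E p.2 i) * X (p.1, i)) ^ J p : MvPolynomial (Fin m × ι) S)‖ ≤ c ^ (∑ p, J p) := by
  refine ⟨1 + ∑ k, ∑ i, ‖E k i‖, by linarith [sum_nonneg fun k (_ : k ∈ univ) => sum_nonneg fun i (_ : i ∈ univ) => norm_nonneg (E k i)], ?_⟩
  intro m J J'
  refine (coeff_le_l1 _ _).trans (l1_lprod (fun _ => E) (fun _ k => ?_) J)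
  have : ∑ i, ‖E k i‖ ≤ ∑ k, ∑ i, ‖E k i‖ :=
    single_le_sum (f := fun k => ∑ i, ‖E k i‖) (fun k _ => sum_nonneg fun i _ => norm_nonneg (E k i)) (mem_univ k)
  linarith

variable (A : Type) [CommRing A] [Nontrivial A] [Module.Free ℤ A] [Module.Finite ℤ A]

lemma lprod_coord_bound (E : Matrix ι ι A) :
    ∃ c : ℝ, 1 ≤ c ∧ ∃ C0 : ℝ, 1 ≤ C0 ∧ ∀ (m : ℕ) (J J' : Fin m × ι →₀ ℕ) (b : bIx A),
      |(((bA A).repr (coeff J' (∏ p, (∑ i, C (E p.2 i) * X (p.1, i)) ^ J p : MvPolynomial (Fin m × ι) A)) b : ℤ) : ℝ)|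
        ≤ C0 * c ^ (∑ p, J p) := by
  obtain ⟨C0, hC0, h0⟩ := coord_bound A
  obtain ⟨c, hc, h⟩ := @lprod_coeff_bound ι _ _ A (normA A)
    (@NormOneClass.mk A (normA A).toNorm _ (nA_one)) E
  exact ⟨c, hc, C0, hC0, fun m J J' b => (h0 _ b).trans (mul_le_mul_of_nonneg_left (h m J J') (by linarith))⟩

open Classical in
theorem auxPoly [Nonempty ι] (E : Matrix ι ι A) {ε : ℝ} (hε : 0 < ε) : ∃ m : ℕ, 1 ≤ m ∧ ∃ c : ℝ, 1 ≤ c ∧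
    ∀ r : Fin m → ℕ, (∀ h, 1 ≤ r h) → ∃ P : MvPolynomial (Fin m × ι) ℤ, P ≠ 0 ∧ MHom r P ∧
      l1 P ≤ c ^ (∑ h, r h) ∧ ∀ J, (lsub (Int.castRingHom A) (fun _ => E) P).coeff J ≠ 0 →
        Good r ε (fun h i => J (h, i)) := by
  obtain ⟨c, hc, C0, hC0, hb⟩ := lprod_coord_bound A E
  set D := Fintype.card (bIx A) with hD
  set N := Fintype.card ι with hN
  set m : ℕ := ⌈2 * D * N / ε ^ 2⌉₊ + 1 with hm
  refine ⟨m, by omega, (2 ^ N) * (2 ^ N) * C0 * c, ?_, ?_⟩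
  · have : (1:ℝ) ≤ 2 ^ N := one_le_pow₀ (by norm_num)
    exact one_le_mul_of_one_le_of_one_le (one_le_mul_of_one_le_of_one_le (one_le_mul_of_one_le_of_one_le this this) hC0) hc
  intro r hr
  set bad := (mcmp ι r).filter fun J => ¬ Good r ε J with hbad
  set R := ∑ h, r h with hR
  have hR1 : 1 ≤ R := (hr 0).trans (single_le_sum (f := r) (fun _ _ => Nat.zero_le _) (mem_univ 0))
  let Mt : Matrix (bad × bIx A) (mcmp ι r) ℤ := fun x I =>
    (bA A).repr (coeff (toF x.1.1) (∏ p, (∑ i, C (E p.2 i) * X (p.1, i)) ^ toF I.1 p : MvPolynomial (Fin m × ι) A)) x.2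
  have hpos : 0 < (mcmp ι r).card := by
    rw [card_pos, Fintype.piFinset_nonempty]
    intro h
    obtain ⟨i0⟩ := ‹Nonempty ι›
    exact ⟨Pi.single i0 (r h), by rw [mem_cmp]; simp⟩
  have hcard : 2 * (bad.card * D) ≤ (mcmp ι r).card := by
    have h1 := card_bad (ι := ι) (m := m) (by omega) r hr hε
    have h2 : 2 * D * N / ε ^ 2 ≤ (m : ℝ) := by
      rw [hm]; push_cast; linarith [Nat.le_ceil (2 * D * N / ε ^ 2)]
    rw [div_le_iff₀ (by positivity)] at h2
    have h3 : (N : ℝ) * (2 * (bad.card * D)) ≤ N * (mcmp ι r).card := by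
      refine le_trans ?_ h1
      rw [← hbad]
      have : (0:ℝ) ≤ bad.card := by positivity
      nlinarith
    have hN0 : (0:ℝ) < N := by exact_mod_cast Fintype.card_pos
    exact_mod_cast le_of_mul_le_mul_left h3 hN0
  have hsum : ∀ I ∈ mcmp ι r, ∑ p, toF I p = R := by
    intro I hI
    rw [Fintype.sum_prod_type]
    refine sum_congr rfl fun h _ => ?_
    simp only [toF_apply]
    exact mem_cmp.1 (Fintype.mem_piFinset.1 hI h)
  obtain ⟨t, ht0, ht1, ht2⟩ := siegel Mt (by simpa [Fintype.card_prod, ← hD] using hcard) (by simpa using hpos)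
    (C0 * c ^ R) (one_le_mul_of_one_le_of_one_le hC0 (one_le_pow₀ hc)) (by
      intro x I
      have := hb m (toF I.1) (toF x.1.1) x.2
      rwa [hsum I.1 I.2] at this)
  let P : MvPolynomial (Fin m × ι) ℤ := ∑ I : mcmp ι r, monomial (toF I.1) (t I)
  have hcoe : ∀ I : mcmp ι r, P.coeff (toF I.1) = t I := by
    intro I
    simp only [P, coeff_sum, coeff_monomial]
    rw [sum_eq_single I]
    · simp
    · intro b _ hb'
      rw [if_neg]
      intro e; exact hb' (Subtype.ext (toF.injective e))
    · simp
  have hcoe0 : ∀ J, P.coeff J ≠ 0 → ∃ I : mcmp ι r, toF I.1 = J := by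
    intro J hJ
    simp only [P, coeff_sum, coeff_monomial] at hJ
    obtain ⟨I, _, hI⟩ := exists_ne_zero_of_sum_ne_zero hJ
    by_contra hcon
    push Not at hcon
    rw [if_neg (hcon I)] at hI
    exact hI rfl
  have hhom : MHom r P := by
    intro J hJ h
    obtain ⟨I, rfl⟩ := hcoe0 J hJ
    simp only [toF_apply]
    exact mem_cmp.1 (Fintype.mem_piFinset.1 I.2 h)
  refine ⟨P, ?_, hhom, ?_, ?_⟩
  · intro h0
    apply ht0
    funext I
    rw [← hcoe I, h0]; simp
  · have h1 : l1 P ≤ ∑ I : mcmp ι r, ‖t I‖ := by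
      refine (l1_sum_le _ _).trans (le_of_eq ?_)
      simp only [l1_monomial]
    have h2 : ∀ I : mcmp ι r, ‖t I‖ ≤ (mcmp ι r).card * (C0 * c ^ R) := by
      intro I
      rw [Int.norm_eq_abs]
      simpa using ht2 I
    have h3 : ((mcmp ι r).card : ℝ) ≤ (2 ^ N) ^ R := by exact_mod_cast card_mcmp_le (ι := ι) r
    have h4 : C0 ≤ C0 ^ R := le_self_pow₀ hC0 (by omega)
    calc l1 P ≤ ∑ I : mcmp ι r, ‖t I‖ := h1
      _ ≤ ∑ I : mcmp ι r, ((mcmp ι r).card * (C0 * c ^ R) : ℝ) := sum_le_sum fun I _ => h2 I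
      _ = (mcmp ι r).card * ((mcmp ι r).card * (C0 * c ^ R)) := by simp
      _ ≤ (2 ^ N) ^ R * ((2 ^ N) ^ R * (C0 ^ R * c ^ R)) := by gcongr
      _ = _ := by rw [mul_pow, mul_pow, mul_pow]; ring
  · intro J hJ
    by_contra hg
    apply hJ
    have hJh : ∀ h, ∑ i, J (h, i) = r h := (MHom.lsub (φ := Int.castRingHom A) (F := fun _ => E) hhom) J hJ
    have hJb : toF.symm J ∈ bad := by
      rw [hbad, mem_filter]
      refine ⟨Fintype.mem_piFinset.2 fun h => mem_cmp.2 (hJh h), hg⟩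
    have hlin : (lsub (Int.castRingHom A) (fun _ => E) P) = ∑ I : mcmp ι r, C ((t I : ℤ) : A) *
      ∏ p, (∑ i, C (E p.2 i) * X (p.1, i)) ^ toF I.1 p := by
      simp only [P, map_sum]
      refine sum_congr rfl fun I _ => ?_
      rw [lsub, coe_eval₂Hom, eval₂_monomial, Finsupp.prod_fintype _ _ (by simp)]
      simp
    apply (bA A).repr.injective
    ext b
    rw [hlin, coeff_sum, map_sum, Finsupp.finsetSum_apply]
    have := congrFun ht1 (⟨toF.symm J, hJb⟩, b)
    simp only [Matrix.mulVec, dotProduct, Pi.zero_apply, Mt, Equiv.apply_symm_apply] at this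
    rw [map_zero, Finsupp.zero_apply, ← this]
    refine sum_congr rfl fun I _ => ?_
    rw [coeff_C_mul, ← zsmul_eq_mul, map_zsmul, Finsupp.smul_apply, smul_eq_mul, mul_comm]

end
end SchmidtPf

namespace SchmidtPf
open Finset MvPolynomial
noncomputable section
set_option linter.unusedSectionVars false
set_option linter.style.haveILetI false

variable {ι : Type} [Fintype ι] [DecidableEq ι] {m : ℕ}

lemma coeff_lsub_diag {S : Type*} [CommRing S] (D : Fin m → ι → S) (f : MvPolynomial (Fin m × ι) S) (J) :
    (lsub (RingHom.id S) (fun h => Matrix.diagonal (D h)) f).coeff J = f.coeff J * ∏ p, D p.1 p.2 ^ J p := by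
  rw [lsub_eq]
  have h1 : ∀ p : Fin m × ι, (∑ i, C ((Matrix.diagonal (D p.1) : Matrix ι ι S) p.2 i) * X (p.1, i) : MvPolynomial (Fin m × ι) S)
      = C (D p.1 p.2) * X p := by
    intro p
    rw [sum_eq_single p.2]
    · simp
    · intro b _ hb; rw [Matrix.diagonal_apply_ne _ hb.symm]; simp
    · simp
  simp only [h1, mul_pow, prod_mul_distrib, RingHom.id_apply, ← C_pow, ← map_prod, ← mul_assoc, ← C_mul]
  have h2 : ∀ J' : Fin m × ι →₀ ℕ, (∏ p, X p ^ J' p : MvPolynomial (Fin m × ι) S) = monomial J' 1 := by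
    intro J'
    rw [monomial_eq, Finsupp.prod_fintype _ _ (by simp)]; simp
  simp only [h2, C_mul_monomial, mul_one, coeff_sum, coeff_monomial]
  rw [sum_ite_eq' ]
  split_ifs with hJ
  · rfl
  · rw [notMem_support_iff.1 hJ]; simp

lemma expo_bound {r : Fin m → ℕ} (hr : ∀ h, 1 ≤ r h) {ε L τ δ β : ℝ} {b : ι → ℝ} {ℓ : Fin m → ℝ}
    (hL : 0 < L) (hb : ∑ i, b i = 0) (hβ : ∑ i, |b i| ≤ β)
    (hrl : ∀ h, L ≤ r h * ℓ h) (hrl2 : ∀ h, r h * ℓ h ≤ (1 + τ) * L) (hδ : 0 ≤ δ)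
    {J : Fin m → ι → ℕ} (hJ : ∀ h, ∑ i, J h i = r h) (hg : Good r ε J) :
    ∑ h, ∑ i, (ℓ h * (b i - δ)) * J h i ≤ L * m * (β * ε + β * τ - δ) := by
  have hr' : ∀ h, (1:ℝ) ≤ r h := fun h => by exact_mod_cast hr h
  have hx1 : ∀ h, ∑ i, (J h i : ℝ) / r h = 1 := by
    intro h
    rw [← sum_div, div_eq_one_iff_eq (by linarith [hr' h])]
    exact_mod_cast hJ h
  have hx2 : ∀ h i, (J h i : ℝ) / r h ≤ 1 := by
    intro h i
    rw [← hx1 h]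
    exact single_le_sum (f := fun i => (J h i : ℝ) / r h) (fun i _ => by positivity) (mem_univ i)
  have hterm : ∀ h, ∑ i, (ℓ h * (b i - δ)) * J h i ≤ L * (∑ i, b i * ((J h i : ℝ) / r h)) + τ * L * β - δ * L := by
    intro h
    have e1 : ∑ i, (ℓ h * (b i - δ)) * J h i = (r h * ℓ h) * (∑ i, b i * ((J h i : ℝ) / r h)) - δ * (r h * ℓ h) * ∑ i, (J h i : ℝ) / r h := by
      rw [mul_sum, mul_sum, ← sum_sub_distrib]
      refine sum_congr rfl fun i _ => ?_
      have := hr' h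
      field_simp
    rw [e1, hx1]
    have e2 : |∑ i, b i * ((J h i : ℝ) / r h)| ≤ β := by
      refine (abs_sum_le_sum_abs _ _).trans (le_trans (sum_le_sum fun i _ => ?_) hβ)
      rw [abs_mul, abs_of_nonneg (a := (J h i : ℝ) / r h) (by positivity)]
      exact mul_le_of_le_one_right (abs_nonneg _) (hx2 h i)
    have e3 := (abs_le.1 e2).2
    have e4 : (r h * ℓ h - L) * (∑ i, b i * ((J h i : ℝ) / r h)) ≤ τ * L * β := by
      have hb0 : 0 ≤ β := (abs_nonneg _).trans e2
      have a1 : (r h * ℓ h - L) * (∑ i, b i * ((J h i : ℝ) / r h)) ≤ (r h * ℓ h - L) * β :=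
        mul_le_mul_of_nonneg_left e3 (by linarith [hrl h])
      have a2 : (r h * ℓ h - L) * β ≤ τ * L * β := mul_le_mul_of_nonneg_right (by linarith [hrl2 h]) hb0
      linarith
    have e5 : δ * L ≤ δ * (r h * ℓ h) := mul_le_mul_of_nonneg_left (hrl h) hδ
    linarith
  refine (sum_le_sum fun h _ => hterm h).trans ?_
  rw [sum_sub_distrib, sum_add_distrib, ← mul_sum, sum_comm]
  simp only [sum_const, card_univ, Fintype.card_fin, nsmul_eq_mul, ← mul_sum]
  have e6 : ∑ i, b i * ∑ h, (J h i : ℝ) / r h ≤ β * (ε * m) := by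
    have : ∑ i, b i * ∑ h, (J h i : ℝ) / r h = ∑ i, b i * (∑ h, (J h i : ℝ) / r h - m / Fintype.card ι) := by
      simp only [mul_sub, sum_sub_distrib, ← sum_mul, hb]; ring
    rw [this]
    have h0 : ∀ i, b i * (∑ h, (J h i : ℝ) / r h - m / Fintype.card ι) ≤ |b i| * (ε * m) := by
      intro i
      refine (le_abs_self _).trans ?_
      rw [abs_mul]
      exact mul_le_mul_of_nonneg_left (hg i) (abs_nonneg _)
    refine (sum_le_sum fun i _ => h0 i).trans ?_
    rw [← sum_mul]
    rcases isEmpty_or_nonempty ι with hi | ⟨⟨i⟩⟩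
    · simp at hβ ⊢
      rcases Nat.eq_zero_or_pos m with hm | hm
      · subst hm; simp
      · exfalso
        have := hJ ⟨0, hm⟩
        simp at this
        have := hr ⟨0, hm⟩; omega
    · exact mul_le_mul_of_nonneg_right hβ ((abs_nonneg _).trans (hg i))
  nlinarith

set_option maxHeartbeats 1000000 in
theorem idx_hat {A : Type} [CommRing A] (ψ : A →+* ℝ) (E : Matrix ι ι A) (Y : Fin m → Matrix ι ι ℤ)
    (W : Fin m → Matrix ι ι ℝ) (hW : ∀ h, (E.map ψ) * W h = (Y h).map (Int.castRingHom ℝ)) (hm : 1 ≤ m)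
    (j0 : ι) {r : Fin m → ℕ} (hr : ∀ h, 1 ≤ r h) {ε L τ δ β B c0 : ℝ} {b : ι → ℝ} {ℓ : Fin m → ℝ}
    (hL : 0 < L) (hb : ∑ i, b i = 0) (hβ : ∑ i, |b i| ≤ β) (hδ : 0 < δ) (hB : 0 < B)
    (hrl : ∀ h, L ≤ r h * ℓ h) (hrl2 : ∀ h, r h * ℓ h ≤ (1 + τ) * L)
    (hτ : τ ≤ 1) (hβε : β * ε ≤ δ / 16) (hβτ : β * τ ≤ δ / 16)
    (hWb : ∀ h i j, |W h i j| ≤ Real.exp (ℓ h * (b i - δ + if j = j0 then B else 0)))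
    {P : MvPolynomial (Fin m × ι) ℤ} (hP : MHom r P) (hc0 : 0 ≤ c0)
    (hg : ∀ J, (lsub (Int.castRingHom A) (fun _ => E) P).coeff J ≠ 0 → Good r ε (fun h i => J (h, i)))
    (hl1 : l1 (lsub (Int.castRingHom ℝ) (fun _ => E.map ψ) P) ≤ c0 ^ (∑ h, r h))
    (hc : ∀ h, c0 * Fintype.card ι ≤ Real.exp (δ * ℓ h / 16))
    (J) (hJ : (lsub (RingHom.id ℤ) Y P).coeff J ≠ 0) :
    δ / (4 * B) * m ≤ ∑ h, (J (h, j0) : ℝ) / r h := by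
  by_contra hlt
  push Not at hlt
  have hr' : ∀ h, (1:ℝ) ≤ r h := fun h => by exact_mod_cast hr h
  have hm' : (1:ℝ) ≤ m := by exact_mod_cast hm
  set F := lsub (Int.castRingHom ℝ) (fun _ => E.map ψ) P with hF
  have hFm : F = MvPolynomial.map ψ (lsub (Int.castRingHom A) (fun _ => E) P) := by
    rw [lsub_map]
    have : ψ.comp (Int.castRingHom A) = Int.castRingHom ℝ := RingHom.ext_int _ _
    rw [this]
  have hFg : ∀ J', F.coeff J' ≠ 0 → Good r ε (fun h i => J' (h, i)) := by
    intro J' h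
    apply hg
    intro h0
    apply h
    rw [hFm, coeff_map, h0, map_zero]
  have hFh : MHom r F := hP.lsub
  set W' : Fin m → Matrix ι ι ℝ := fun h => Matrix.of fun i j => W h i j * (if j = j0 then Real.exp (-(B * ℓ h)) else 1) with hW'
  set Dg : Fin m → ι → ℝ := fun h j => if j = j0 then Real.exp (B * ℓ h) else 1 with hDg
  have hWW : ∀ h, W' h * Matrix.diagonal (Dg h) = W h := by
    intro h
    ext i j
    rw [Matrix.mul_diagonal]
    simp only [hW', hDg, Matrix.of_apply]
    split_ifs
    · rw [mul_assoc, ← Real.exp_add]; simp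
    · simp
  have hhat : MvPolynomial.map (Int.castRingHom ℝ) (lsub (RingHom.id ℤ) Y P)
      = lsub (RingHom.id ℝ) (fun h => Matrix.diagonal (Dg h)) (lsub (RingHom.id ℝ) W' F) := by
    rw [lsub_map, ← RingHom.comp_apply, lsub_comp, hF, ← RingHom.comp_apply, lsub_comp]
    congr 1
    congr 1
    funext h
    rw [← hW h]
    congr 1
    rw [← hWW h]
    congr 1
  have hcoef : (((lsub (RingHom.id ℤ) Y P).coeff J : ℤ) : ℝ) = (lsub (RingHom.id ℝ) W' F).coeff J * ∏ p : Fin m × ι, Dg p.1 p.2 ^ J p := by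
    rw [← coeff_lsub_diag, ← hhat, coeff_map]; rfl
  have hDprod : ∏ p : Fin m × ι, Dg p.1 p.2 ^ J p = Real.exp (∑ h, B * ℓ h * J (h, j0)) := by
    rw [Real.exp_sum, Fintype.prod_prod_type]
    refine prod_congr rfl fun h _ => ?_
    rw [prod_eq_single j0]
    · simp only [hDg, if_true]; rw [← Real.exp_nat_mul, mul_comm]
    · intro j _ hj; simp [hDg, hj]
    · simp
  have hW'b : ∀ h i, ∑ j, ‖W' h i j‖ ≤ Fintype.card ι * Real.exp (ℓ h * (b i - δ)) := by
    intro h i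
    rw [← nsmul_eq_mul, ← card_univ, ← sum_const]
    refine sum_le_sum fun j _ => ?_
    simp only [hW', Matrix.of_apply, Real.norm_eq_abs, abs_mul]
    have h1 := hWb h i j
    split_ifs at h1 ⊢ with hj
    · rw [Real.abs_exp]
      refine (mul_le_mul_of_nonneg_right h1 (Real.exp_pos _).le).trans (le_of_eq ?_)
      rw [← Real.exp_add]; congr 1; ring
    · rw [abs_one, mul_one]
      refine h1.trans (le_of_eq ?_)
      congr 1; ring
  set X0 := L * m * (β * ε + β * τ - δ) with hX0
  have hterm : l1 (lsub (RingHom.id ℝ) W' F) ≤ c0 ^ (∑ h, r h) * ((Fintype.card ι : ℝ) ^ (∑ h, r h) * Real.exp X0) := by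
    rw [lsub_eq]
    refine (l1_sum_le _ _).trans ?_
    refine le_trans ?_ (mul_le_mul_of_nonneg_right hl1 (by positivity))
    rw [l1, sum_mul]
    refine sum_le_sum fun J' hJ' => ?_
    have hJ'0 := mem_support_iff.1 hJ'
    refine (l1_mul_le _ _).trans ?_
    rw [l1_C, RingHom.id_apply]
    refine mul_le_mul_of_nonneg_left ?_ (norm_nonneg _)
    refine (l1_prod_le _ _).trans ?_
    have s1 : ∏ p : Fin m × ι, l1 ((∑ i, C (W' p.1 p.2 i) * X (p.1, i)) ^ J' p : MvPolynomial (Fin m × ι) ℝ)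
        ≤ ∏ p : Fin m × ι, ((Fintype.card ι : ℝ) ^ J' p * Real.exp ((ℓ p.1 * (b p.2 - δ)) * J' p)) := by
      refine prod_le_prod (fun _ _ => l1_nonneg _) fun p _ => ?_
      refine (l1_pow_le _ _).trans ?_
      refine (pow_le_pow_left₀ (l1_nonneg _) ((l1_lin _ _ _).trans (hW'b _ _)) _).trans (le_of_eq ?_)
      rw [mul_pow, ← Real.exp_nat_mul, mul_comm (J' p : ℝ)]
    refine s1.trans ?_
    rw [prod_mul_distrib, prod_pow_eq_pow_sum, ← Real.exp_sum, Fintype.sum_prod_type, Fintype.sum_prod_type]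
    simp only [hFh J' hJ'0]
    refine mul_le_mul_of_nonneg_left (Real.exp_le_exp.2 ?_) (by positivity)
    exact expo_bound hr hL hb hβ hrl hrl2 hδ.le (J := fun h i => J' (h, i)) (hFh J' hJ'0) (hFg J' hJ'0)
  have hcN : c0 ^ (∑ h, r h) * (Fintype.card ι : ℝ) ^ (∑ h, r h) ≤ Real.exp (L * m * (δ / 8)) := by
    rw [← mul_pow, ← prod_pow_eq_pow_sum]
    have : L * m * (δ / 8) = ∑ _h : Fin m, L * (δ / 8) := by simp; ring
    rw [this, Real.exp_sum]
    refine prod_le_prod (fun _ _ => by positivity) fun h _ => ?_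
    refine (pow_le_pow_left₀ (by positivity) (hc h) _).trans ?_
    rw [← Real.exp_nat_mul]
    refine Real.exp_le_exp.2 ?_
    have a1 : (r h : ℝ) * ℓ h ≤ 2 * L := (hrl2 h).trans (by nlinarith)
    nlinarith
  have hS : ∑ h, B * ℓ h * J (h, j0) ≤ L * m * (δ / 2) := by
    have a0 : ∀ h, B * ℓ h * J (h, j0) ≤ B * (2 * L) * ((J (h, j0) : ℝ) / r h) := by
      intro h
      have a1 : (r h : ℝ) * ℓ h ≤ 2 * L := (hrl2 h).trans (by nlinarith)
      have a2 : B * ℓ h * J (h, j0) = B * (r h * ℓ h) * ((J (h, j0) : ℝ) / r h) := by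
        have := hr' h
        field_simp
      rw [a2]
      gcongr
    refine (sum_le_sum fun h _ => a0 h).trans ?_
    rw [← mul_sum]
    refine (mul_le_mul_of_nonneg_left hlt.le (by positivity)).trans (le_of_eq ?_)
    field_simp; ring
  have hfin : |(((lsub (RingHom.id ℤ) Y P).coeff J : ℤ) : ℝ)| < 1 := by
    rw [hcoef, hDprod, abs_mul, Real.abs_exp]
    calc |(lsub (RingHom.id ℝ) W' F).coeff J| * Real.exp (∑ h, B * ℓ h * J (h, j0))
        ≤ (Real.exp (L * m * (δ / 8)) * Real.exp X0) * Real.exp (L * m * (δ / 2)) := by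
          refine mul_le_mul ?_ (Real.exp_le_exp.2 hS) (Real.exp_pos _).le (by positivity)
          rw [← Real.norm_eq_abs]
          refine (coeff_le_l1 _ _).trans (hterm.trans ?_)
          rw [← mul_assoc]
          exact mul_le_mul_of_nonneg_right hcN (Real.exp_pos _).le
      _ < 1 := by
          rw [← Real.exp_add, ← Real.exp_add, Real.exp_lt_one_iff]
          have : L * m * (δ / 8) + X0 + L * m * (δ / 2) ≤ -(L * m * (δ / 4)) := by
            have h0 : 0 < L * m := by positivity
            rw [hX0]; nlinarith
          have h1 : 0 < L * m * (δ / 4) := by positivity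
          linarith
  have : |(lsub (RingHom.id ℤ) Y P).coeff J| < 1 := by exact_mod_cast hfin
  exact hJ (Int.abs_lt_one_iff.1 this)

end
end SchmidtPf

namespace SchmidtPf
open Finset MvPolynomial
noncomputable section
set_option linter.unusedSectionVars false
set_option linter.style.haveILetI false

variable {ι : Type} [Fintype ι] [DecidableEq ι] {m : ℕ}

section low
variable {σ T : Type*} [CommRing T] (Θ : MvPolynomial σ T →+* MvPolynomial σ T)

lemma theta_sub_mem (hX : ∀ i, Θ (X i) = X i) (hC : ∀ a, Θ (C a) - C a ∈ idealOfVars σ T)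
    (k : ℕ) (f : MvPolynomial σ T) (hf : f ∈ idealOfVars σ T ^ k) : Θ f - f ∈ idealOfVars σ T ^ (k + 1) := by
  rw [mem_pow_idealOfVars_iff] at hf
  rw [f.as_sum, map_sum, ← sum_sub_distrib]
  refine Ideal.sum_mem _ fun e he => ?_
  have h1 : (monomial e (f.coeff e)) = (C (f.coeff e) : MvPolynomial σ T) * monomial e 1 := by
    rw [C_mul_monomial, mul_one]
  have h2 : Θ (monomial e 1) = monomial e 1 := by
    rw [monomial_eq, map_mul, Finsupp.prod, map_prod]
    simp [hX]
  rw [h1, map_mul, h2, ← sub_mul, mul_comm, pow_succ]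
  refine Ideal.mul_mem_mul ?_ (hC _)
  by_cases h0 : (1 : T) = 0
  · rw [h0]; simp
  · rw [monomial_mem_pow_idealOfVars_iff _ _ h0]
    exact hf e he

lemma coeff_theta (hX : ∀ i, Θ (X i) = X i) (hC : ∀ a, Θ (C a) - C a ∈ idealOfVars σ T)
    (f : MvPolynomial σ T) (e : σ →₀ ℕ) (he : ∀ e', f.coeff e' ≠ 0 → e.degree ≤ e'.degree) :
    (Θ f).coeff e = f.coeff e := by
  have h1 : f ∈ idealOfVars σ T ^ e.degree := by
    rw [mem_pow_idealOfVars_iff]; intro x hx; exact he x (mem_support_iff.1 hx)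
  have h2 := theta_sub_mem Θ hX hC _ f h1
  rw [mem_pow_idealOfVars_iff] at h2
  by_contra h3
  have := h2 e (by rw [mem_support_iff, coeff_sub]; exact sub_ne_zero.2 h3)
  omega
end low

/-- dehomogenization -/
def rho (R : Type*) [CommRing R] (i0 i1 : ι) : MvPolynomial (Fin m × ι) R →+* MvPolynomial (Fin m × ι) (MvPolynomial (Fin m) R) :=
  eval₂Hom (C.comp C) (fun p => if p.2 = i1 then 1 else if p.2 = i0 then C (X p.1) else X p)

def oe (i0 i1 : ι) (J : Fin m × ι →₀ ℕ) : Fin m × ι →₀ ℕ :=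
  Finsupp.equivFunOnFinite.symm fun p => if p.2 = i1 then 0 else if p.2 = i0 then 0 else J p

def xe (i0 : ι) (J : Fin m × ι →₀ ℕ) : Fin m →₀ ℕ :=
  Finsupp.equivFunOnFinite.symm fun h => J (h, i0)

lemma mono_eq {σ R : Type*} [Fintype σ] [CommRing R] (J : σ →₀ ℕ) : (∏ p, X p ^ J p : MvPolynomial σ R) = monomial J 1 := by
  rw [monomial_eq, Finsupp.prod_fintype _ _ (by simp)]; simp

lemma rho_monomial {R : Type*} [CommRing R] {i0 i1 : ι} (hne : i0 ≠ i1) (J : Fin m × ι →₀ ℕ) (a : R) :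
    rho R i0 i1 (monomial J a) = monomial (oe i0 i1 J) (monomial (xe i0 J) a) := by
  have h1 : ∀ p : Fin m × ι, ((if p.2 = i1 then 1 else if p.2 = i0 then C (X p.1) else X p : MvPolynomial (Fin m × ι) (MvPolynomial (Fin m) R))) ^ J p
      = (C (if p.2 = i0 then (X p.1) ^ J p else 1)) * X p ^ (oe i0 i1 J p) := by
    intro p
    simp only [oe, Finsupp.coe_equivFunOnFinite_symm]
    split_ifs with h h' h'
    · exact absurd (h'.symm.trans h) hne
    · simp
    · simp
    · simp
  rw [rho, coe_eval₂Hom, eval₂_monomial, Finsupp.prod_fintype _ _ (by simp)]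
  simp only [h1]
  rw [prod_mul_distrib, mono_eq, ← map_prod]
  have h2 : ∏ p : Fin m × ι, (if p.2 = i0 then (X p.1 : MvPolynomial (Fin m) R) ^ J p else 1) = monomial (xe i0 J) 1 := by
    rw [Fintype.prod_prod_type, ← mono_eq]
    refine prod_congr rfl fun h _ => ?_
    rw [prod_eq_single i0]
    · simp [xe]
    · intro b _ hb; simp [hb]
    · simp
  rw [h2, RingHom.comp_apply, ← mul_assoc, ← C_mul, C_mul_monomial, mul_one, C_mul_monomial, mul_one]

lemma rho_eq {R : Type*} [CommRing R] {i0 i1 : ι} (hne : i0 ≠ i1) (P : MvPolynomial (Fin m × ι) R) (e) :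
    (rho R i0 i1 P).coeff e = ∑ J ∈ P.support, if oe i0 i1 J = e then monomial (xe i0 J) (P.coeff J) else 0 := by
  conv_lhs => rw [P.as_sum, map_sum, coeff_sum]
  refine sum_congr rfl fun J _ => ?_
  rw [rho_monomial hne, coeff_monomial]

lemma rho_inj {r : Fin m → ℕ} {i0 i1 : ι} (hne : i0 ≠ i1) {J J' : Fin m × ι →₀ ℕ} (hJ : ∀ h, ∑ i, J (h, i) = r h)
    (hJ' : ∀ h, ∑ i, J' (h, i) = r h) (h1 : oe i0 i1 J = oe i0 i1 J') (h2 : xe i0 J = xe i0 J') : J = J' := by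
  have key : ∀ h i, i ≠ i1 → J (h, i) = J' (h, i) := by
    intro h i hi
    by_cases hi0 : i = i0
    · subst hi0
      simpa [xe] using DFunLike.congr_fun h2 h
    · simpa [oe, hi, hi0] using DFunLike.congr_fun h1 (h, i)
  ext ⟨h, i⟩
  by_cases hi : i = i1
  · subst hi
    have a := hJ h
    rw [← hJ' h, ← add_sum_erase _ _ (mem_univ i), ← add_sum_erase _ _ (mem_univ i)] at a
    have b : ∑ x ∈ univ.erase i, J (h, x) = ∑ x ∈ univ.erase i, J' (h, x) :=
      sum_congr rfl fun x hx => key h x (ne_of_mem_erase hx)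
    omega
  · exact key h i hi

lemma rho_ne_zero {R : Type*} [CommRing R] {r : Fin m → ℕ} {i0 i1 : ι} (hne : i0 ≠ i1) {P : MvPolynomial (Fin m × ι) R}
    (hP : MHom r P) (h0 : P ≠ 0) : rho R i0 i1 P ≠ 0 := by
  obtain ⟨J, hJ⟩ := MvPolynomial.ne_zero_iff.1 h0
  intro hz
  apply hJ
  have h1 : coeff (xe i0 J) ((rho R i0 i1 P).coeff (oe i0 i1 J)) = 0 := by rw [hz]; simp
  rw [rho_eq hne, coeff_sum, sum_eq_single J] at h1
  · simpa using h1
  · intro J' hJ' hJJ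
    split_ifs with h
    · rw [coeff_monomial, if_neg]
      intro h'
      exact hJJ (rho_inj hne (hP J' (mem_support_iff.1 hJ')) (hP J hJ) h h')
    · simp
  · intro h; rw [notMem_support_iff.1 h]; simp

lemma rho_l1 {i0 i1 : ι} (hne : i0 ≠ i1) (P : MvPolynomial (Fin m × ι) ℤ) (e) :
    l1 ((rho ℤ i0 i1 P).coeff e) ≤ l1 P := by
  rw [rho_eq hne]
  refine (l1_sum_le _ _).trans (sum_le_sum fun J _ => ?_)
  split_ifs
  · rw [l1_monomial]
  · simp [l1]

lemma rho_deg {R : Type*} [CommRing R] {r : Fin m → ℕ} {i0 i1 : ι} (hne : i0 ≠ i1) {P : MvPolynomial (Fin m × ι) R}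
    (hP : MHom r P) (e) (h : Fin m) : ((rho R i0 i1 P).coeff e).degreeOf h ≤ r h := by
  rw [degreeOf_le_iff]
  intro x hx
  rw [mem_support_iff, rho_eq hne, coeff_sum] at hx
  obtain ⟨J, hJ, hJ2⟩ := exists_ne_zero_of_sum_ne_zero hx
  split_ifs at hJ2 with he
  · rw [coeff_monomial] at hJ2
    split_ifs at hJ2 with hh
    · rw [← hh, ← hP J (mem_support_iff.1 hJ) h]
      exact single_le_sum (f := fun i => J (h, i)) (fun _ _ => Nat.zero_le _) (mem_univ i0)
    · exact absurd rfl hJ2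
  · simp at hJ2

theorem dehom {i0 i1 : ι} (hne : i0 ≠ i1) (j0 : ι) (u : Fin m → ι → ℤ) (hu : ∀ h, u h i0 ≠ 0)
    (Y : Fin m → Matrix ι ι ℤ) (hdet : ∀ h, (Y h).det ≠ 0)
    (huY : ∀ h j, ∑ k, u h k * Y h k j = if j = j0 then u h i0 else 0)
    {r : Fin m → ℕ} {P : MvPolynomial (Fin m × ι) ℤ} (h0 : P ≠ 0) (hP : MHom r P) (κ : ℝ)
    (hidx : ∀ J, (lsub (RingHom.id ℤ) Y P).coeff J ≠ 0 → κ ≤ ∑ h, (J (h, j0) : ℝ) / r h) :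
    ∃ Q : MvPolynomial (Fin m) ℤ, Q ≠ 0 ∧ (∀ h, Q.degreeOf h ≤ r h) ∧ l1 Q ≤ l1 P ∧
      IdxGE (fun h => -(u h i1 : ℚ) / u h i0) (fun h => 1 / (r h : ℝ)) κ (map (Int.castRingHom ℚ) Q) := by
  have hz := rho_ne_zero hne hP h0
  -- minimal degree
  have hex : ∃ e, (rho ℤ i0 i1 P).coeff e ≠ 0 ∧ ∀ e', (rho ℤ i0 i1 P).coeff e' ≠ 0 → e.degree ≤ e'.degree := by
    have hne' : (rho ℤ i0 i1 P).support.Nonempty := support_nonempty.2 hz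
    obtain ⟨e, he, hmin⟩ := exists_min_image _ (fun e => e.degree) hne'
    exact ⟨e, mem_support_iff.1 he, fun e' he' => hmin e' (mem_support_iff.2 he')⟩
  obtain ⟨e, he, hmin⟩ := hex
  refine ⟨(rho ℤ i0 i1 P).coeff e, he, rho_deg hne hP e, rho_l1 hne P e, ?_⟩
  set ξ : Fin m → ℚ := fun h => -(u h i1 : ℚ) / u h i0 with hξ
  set ic := Int.castRingHom ℚ with hic
  have huQ : ∀ h, (u h i0 : ℚ) ≠ 0 := fun h => by exact_mod_cast hu h
  let ell : Fin m → MvPolynomial (Fin m × ι) (MvPolynomial (Fin m) ℚ) := fun h =>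
    ∑ i, if i = i1 then 0 else if i = i0 then 0 else C (C ((u h i : ℚ) / u h i0)) * X (h, i)
  let Θ : MvPolynomial (Fin m × ι) (MvPolynomial (Fin m) ℚ) →+* MvPolynomial (Fin m × ι) (MvPolynomial (Fin m) ℚ) :=
    eval₂Hom (eval₂Hom (C.comp C) (fun h => C (X h) - ell h)) X
  have hΘX : ∀ p, Θ (X p) = X p := fun p => by simp [Θ]
  have hΘCC : ∀ a, Θ (C (C a)) = C (C a) := fun a => by simp [Θ]
  have hΘCX : ∀ h, Θ (C (X h)) = C (X h) - ell h := fun h => by simp [Θ]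
  have hell : ∀ h, ell h ∈ idealOfVars (Fin m × ι) (MvPolynomial (Fin m) ℚ) := by
    intro h
    refine Ideal.sum_mem _ fun i _ => ?_
    split_ifs
    · exact Ideal.zero_mem _
    · exact Ideal.zero_mem _
    · exact Ideal.mul_mem_left _ _ (Ideal.subset_span ⟨_, rfl⟩)
  have hΘC : ∀ a, Θ (C a) - C a ∈ idealOfVars (Fin m × ι) (MvPolynomial (Fin m) ℚ) := by
    intro a
    have h1 : (Ideal.Quotient.mk (idealOfVars (Fin m × ι) (MvPolynomial (Fin m) ℚ))).comp (Θ.comp C) =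
      (Ideal.Quotient.mk (idealOfVars (Fin m × ι) (MvPolynomial (Fin m) ℚ))).comp C := by
      refine MvPolynomial.ringHom_ext ?_ ?_
      · intro a; simp only [RingHom.comp_apply, hΘCC]
      · intro h
        simp only [RingHom.comp_apply, hΘCX]
        rw [Ideal.Quotient.eq]
        simpa using hell h
    have h2 := RingHom.congr_fun h1 a
    simp only [RingHom.comp_apply] at h2
    exact Ideal.Quotient.eq.1 h2
  set PQ := map ic P with hPQ
  have hρ : ∀ e', (rho ℚ i0 i1 PQ).coeff e' = map ic ((rho ℤ i0 i1 P).coeff e') := by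
    intro e'
    have : (rho ℚ i0 i1).comp (map ic) = (map (map ic)).comp (rho (m := m) ℤ i0 i1) := by
      refine MvPolynomial.ringHom_ext ?_ ?_
      · intro a; simp [rho]
      · intro p; simp only [rho, RingHom.comp_apply, map_X, coe_eval₂Hom, eval₂_X]
        split_ifs <;> simp
    have h2 := RingHom.congr_fun this P
    simp only [RingHom.comp_apply] at h2
    rw [hPQ, h2, coeff_map]
  have hco : map ic ((rho ℤ i0 i1 P).coeff e) = (Θ (rho ℚ i0 i1 PQ)).coeff e := by
    rw [coeff_theta Θ hΘX hΘC, hρ]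
    intro e' he'
    apply hmin
    intro hcon
    apply he'
    rw [hρ, hcon, map_zero]
  rw [hco]
  -- the inverse matrices
  let Z : Fin m → Matrix ι ι ℚ := fun h => ((Y h).map ic)⁻¹
  have hdetQ : ∀ h, IsUnit ((Y h).map ic).det := by
    intro h
    rw [isUnit_iff_ne_zero]
    have : ((Y h).map ic).det = ((Y h).det : ℚ) := by
      rw [show (Y h).map ic = ic.mapMatrix (Y h) from rfl, ← RingHom.map_det]; rfl
    rw [this]; exact_mod_cast hdet h
  have hPZ : PQ = lsub (RingHom.id ℚ) Z (map ic (lsub (RingHom.id ℤ) Y P)) := by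
    rw [lsub_map, ← RingHom.comp_apply, lsub_comp]
    have h1 : (fun h => ((Y h).map ic).map (RingHom.id ℚ) * Z h) = fun _ => (1 : Matrix ι ι ℚ) := by
      funext h
      rw [show ((Y h).map ic).map (RingHom.id ℚ) = (Y h).map ic from rfl]
      exact Matrix.mul_nonsing_inv _ (hdetQ h)
    rw [h1, RingHom.comp_id]
    have h2 := lsub_map_left (m := m) (ι := ι) ic (RingHom.id ℚ) (fun _ => 1) P
    rw [lsub_one] at h2
    rw [hPQ]
    exact h2
  have hZ : ∀ h k, Z h j0 k = (u h k : ℚ) / u h i0 := by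
    intro h k
    have h1 : Matrix.vecMul (fun k => (u h k : ℚ)) ((Y h).map ic) = (u h i0 : ℚ) • (Pi.single j0 1 : ι → ℚ) := by
      funext j
      simp only [Matrix.vecMul, dotProduct, Matrix.map_apply, Pi.smul_apply, Pi.single_apply, smul_eq_mul]
      have := huY h j
      have h2 : ((∑ k, u h k * Y h k j : ℤ) : ℚ) = ((if j = j0 then u h i0 else 0 : ℤ) : ℚ) := by rw [this]
      push_cast at h2
      simpa using h2
    have h3 : (fun k => (u h k : ℚ)) = (u h i0 : ℚ) • Matrix.vecMul (Pi.single j0 1 : ι → ℚ) (Z h) := by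
      rw [← Matrix.smul_vecMul, ← h1, Matrix.vecMul_vecMul, Matrix.mul_nonsing_inv _ (hdetQ h), Matrix.vecMul_one]
    have h4 := congrFun h3 k
    simp only [Pi.smul_apply, Matrix.single_one_vecMul, smul_eq_mul, Matrix.row_apply] at h4
    rw [h4]
    field_simp [huQ h]
  set Ψ := (Θ.comp (rho ℚ i0 i1)).comp (lsub (RingHom.id ℚ) Z) with hΨ
  have hΨ0 : ∀ h, Ψ (X (h, j0)) = C (X h - C (ξ h)) := by
    intro h
    rw [hΨ, RingHom.comp_apply, lsub_X, RingHom.comp_apply, map_sum, map_sum]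
    have h1 : ∀ k, Θ (rho ℚ i0 i1 (C (Z h j0 k) * X (h, k))) =
        (if k = i1 then C (C ((u h k : ℚ) / u h i0)) else 0) + (if k = i0 then (C (X h) - ell h) else 0) +
        (if k = i1 then 0 else if k = i0 then 0 else C (C ((u h k : ℚ) / u h i0)) * X (h, k)) := by
      intro k
      have a1 : rho (m := m) ℚ i0 i1 (C (Z h j0 k)) = C (C ((u h k : ℚ) / u h i0)) := by rw [hZ]; simp [rho]
      have a2 : rho ℚ i0 i1 (X (h, k)) = if k = i1 then 1 else if k = i0 then C (X h) else X (h, k) := by simp [rho]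
      rw [map_mul, a1, a2, map_mul, hΘCC]
      split_ifs with b1 b2 b2
      · exact absurd (b2.symm.trans b1) hne
      · simp
      · rw [hΘCX, b2, div_self (huQ h)]; simp
      · rw [hΘX]; simp
    simp only [h1, sum_add_distrib, sum_ite_eq', mem_univ, if_true]
    have h2 : (∑ k, if k = i1 then 0 else if k = i0 then 0 else C (C ((u h k : ℚ) / u h i0)) * X (h, k)) = ell h := rfl
    rw [h2, hξ]
    simp only [C_sub, neg_div, C_neg]
    ring
  have hΘρ : Θ (rho ℚ i0 i1 PQ) = Ψ (map ic (lsub (RingHom.id ℤ) Y P)) := by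
    conv_lhs => rw [hPZ]
    rfl
  rw [hΘρ]
  set PH := lsub (RingHom.id ℤ) Y P with hPH
  rw [(map ic PH).as_sum, map_sum, coeff_sum]
  refine IdxGE.sum fun J hJ => ?_
  have hJ0 : PH.coeff J ≠ 0 := by
    intro h
    rw [mem_support_iff, coeff_map, h, map_zero] at hJ
    exact hJ rfl
  have hJk := hidx J hJ0
  have hfac : ∃ G, Ψ (monomial J (coeff J (map ic PH))) = C (∏ h, (X h - C (ξ h)) ^ J (h, j0)) * G := by
    refine ⟨Ψ (C (coeff J (map ic PH))) * ∏ h : Fin m, ∏ j ∈ univ.erase j0, Ψ (X (h, j)) ^ J (h, j), ?_⟩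
    have : (monomial J (coeff J (map ic PH))) = C (coeff J (map ic PH)) * ∏ p, X p ^ J p := by
      rw [mono_eq, C_mul_monomial, mul_one]
    rw [this, map_mul, map_prod, Fintype.prod_prod_type]
    have h3 : ∀ h : Fin m, ∏ j, Ψ (X (h, j) ^ J (h, j)) = C ((X h - C (ξ h)) ^ J (h, j0)) * ∏ j ∈ univ.erase j0, Ψ (X (h, j)) ^ J (h, j) := by
      intro h
      rw [← mul_prod_erase _ _ (mem_univ j0), map_pow, hΨ0, C_pow]
      simp only [map_pow]
    simp only [h3]
    rw [prod_mul_distrib, map_prod]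
    ring
  obtain ⟨G, hG⟩ := hfac
  rw [hG, coeff_C_mul]
  have hw : ∀ h, 0 ≤ 1 / (r h : ℝ) := fun h => by positivity
  have hmono : IdxGE ξ (fun h => 1 / (r h : ℝ)) (∑ h, (J (h, j0) : ℝ) / r h) (∏ h, (X h - C (ξ h)) ^ J (h, j0)) := by
    intro x hx
    have hs : shift ξ (∏ h, (X h - C (ξ h)) ^ J (h, j0)) = monomial (xe j0 J) 1 := by
      rw [map_prod, ← mono_eq]
      refine prod_congr rfl fun h _ => ?_
      simp [shift, xe]
    rw [hs, coeff_monomial] at hx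
    split_ifs at hx with hh
    · rw [← hh]
      refine le_of_eq (sum_congr rfl fun h _ => ?_)
      simp [xe, div_eq_mul_inv]
    · exact absurd rfl hx
  have := hmono.mul (idxGE_zero (ξ := ξ) hw (coeff e G))
  exact this.mono (by linarith)

end
end SchmidtPf

namespace SchmidtPf
open Finset MvPolynomial Filter
noncomputable section
set_option linter.unusedSectionVars false
set_option linter.style.haveILetI false

variable {ι : Type} [Fintype ι] [DecidableEq ι]

lemma prim_q {u : ι → ℤ} (hprim : univ.gcd u = 1) (hnt : Nontrivial ι) (i0 : ι) (h0 : u i0 ≠ 0) :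
    ∃ i1, i1 ≠ i0 ∧ (((u i0).natAbs : ℕ)) ≤ ((u i0).natAbs / Int.gcd (u i0) (u i1)) ^ Fintype.card ι := by
  set n := (u i0).natAbs with hn
  have hn0 : 0 < n := Int.natAbs_pos.2 h0
  set q : ι → ℕ := fun i => n / Int.gcd (u i0) (u i) with hq
  have hg : ∀ i, Int.gcd (u i0) (u i) ∣ n := fun i => Int.natCast_dvd.1 (Int.gcd_dvd_left _ _)
  have hq1 : ∀ i, 1 ≤ q i := fun i => Nat.div_pos (Nat.le_of_dvd hn0 (hg i)) (Int.gcd_pos_of_ne_zero_left _ h0)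
  have hdvd : (n : ℤ) ∣ ((∏ i ∈ univ.erase i0, q i : ℕ) : ℤ) := by
    have h1 : ∀ i, (n : ℤ) ∣ ((∏ i ∈ univ.erase i0, q i : ℕ) : ℤ) * u i := by
      intro i
      by_cases hi : i = i0
      · subst hi
        exact Dvd.dvd.mul_left (Int.natAbs_dvd.2 dvd_rfl) _
      · have h2 : (n : ℤ) ∣ (q i : ℤ) * u i := by
          obtain ⟨k, hk⟩ : (Int.gcd (u i0) (u i) : ℤ) ∣ u i := Int.gcd_dvd_right _ _
          have : (n : ℤ) = q i * (Int.gcd (u i0) (u i) : ℤ) := by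
            exact_mod_cast (Nat.div_mul_cancel (hg i)).symm
          refine ⟨k, ?_⟩
          conv_lhs => rw [hk]
          rw [this]; ring
        have h3 : (q i : ℤ) ∣ ((∏ i ∈ univ.erase i0, q i : ℕ) : ℤ) := by
          exact_mod_cast dvd_prod_of_mem q (mem_erase.2 ⟨hi, mem_univ i⟩)
        exact h2.trans (mul_dvd_mul_right h3 _)
    have h4 : (n : ℤ) ∣ univ.gcd fun i => ((∏ i ∈ univ.erase i0, q i : ℕ) : ℤ) * u i := dvd_gcd fun i _ => h1 i
    rw [Finset.gcd_mul_left, hprim, mul_one] at h4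
    exact h4.trans (by simp [normalize_dvd_iff])
  have hle : n ≤ ∏ i ∈ univ.erase i0, q i :=
    Nat.le_of_dvd (prod_pos fun i _ => hq1 i) (by exact_mod_cast hdvd)
  have hne : (univ.erase i0).Nonempty := by
    obtain ⟨j, hj⟩ := exists_ne i0
    exact ⟨j, mem_erase.2 ⟨hj, mem_univ _⟩⟩
  obtain ⟨i1, hi1, hmax⟩ := exists_max_image _ q hne
  refine ⟨i1, ne_of_mem_erase hi1, ?_⟩
  calc n ≤ ∏ i ∈ univ.erase i0, q i := hle
    _ ≤ ∏ _i ∈ univ.erase i0, q i1 := prod_le_prod' hmax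
    _ = q i1 ^ (univ.erase i0).card := by simp
    _ ≤ q i1 ^ Fintype.card ι := Nat.pow_le_pow_right (hq1 i1) (by rw [← card_univ]; exact card_le_card (erase_subset _ _))

/-- replace column `j0` by the basis vector `k` -/
def repl (Y : Matrix ι ι ℤ) (j0 k : ι) : Matrix ι ι ℤ := Y.updateCol j0 (Pi.single k 1)

lemma repl_dot (Y : Matrix ι ι ℤ) (j0 k : ι) (u : ι → ℤ) (hu : ∀ j, j ≠ j0 → ∑ l, u l * Y l j = 0) (j : ι) :
    ∑ l, u l * repl Y j0 k l j = if j = j0 then u k else 0 := by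
  split_ifs with h
  · subst h; simp [repl, Pi.single_apply]
  · rw [← hu j h]; simp [repl, Matrix.updateCol_ne h]

lemma repl_det (Y : Matrix ι ι ℤ) (j0 k : ι) (u : ι → ℤ) (hu : ∀ j, j ≠ j0 → ∑ l, u l * Y l j = 0) (huk : u k ≠ 0)
    (hli : ∀ x : ι → ℤ, x j0 = 0 → Y.mulVec x = 0 → x = 0) : (repl Y j0 k).det ≠ 0 := by
  intro h0
  obtain ⟨x, hx0, hx⟩ := Matrix.exists_mulVec_eq_zero_iff.2 h0
  have h1 : u ⬝ᵥ ((repl Y j0 k).mulVec x) = u k * x j0 := by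
    rw [Matrix.dotProduct_mulVec]
    have : Matrix.vecMul u (repl Y j0 k) = fun j => if j = j0 then u k else 0 := by
      funext j; exact repl_dot Y j0 k u hu j
    rw [this]
    simp [dotProduct]
  rw [hx, dotProduct_zero] at h1
  have hxj : x j0 = 0 := by
    rcases mul_eq_zero.1 h1.symm with h | h
    · exact absurd h huk
    · exact h
  apply hx0
  apply hli x hxj
  rw [← hx]
  funext l
  simp only [Matrix.mulVec, dotProduct]
  refine sum_congr rfl fun j _ => ?_
  by_cases hj : j = j0
  · subst hj; simp [hxj]
  · simp [repl, Matrix.updateCol_ne hj]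

lemma parallel (Y : Matrix ι ι ℤ) (j0 : ι) (u v : ι → ℤ) (hu : ∀ j, j ≠ j0 → ∑ l, u l * Y l j = 0)
    (hv : ∀ j, j ≠ j0 → ∑ l, v l * Y l j = 0) (hv0 : v ≠ 0)
    (hli : ∀ x : ι → ℤ, x j0 = 0 → Y.mulVec x = 0 → x = 0) : ∀ i l, u i * v l = u l * v i := by
  obtain ⟨k, hk⟩ := Function.ne_iff.1 hv0
  have hdet := repl_det Y j0 k v hv hk hli
  have h1 : Matrix.vecMul (fun i => v k * u i - u k * v i) (repl Y j0 k) = 0 := by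
    funext j
    have a := repl_dot Y j0 k u hu j
    have b := repl_dot Y j0 k v hv j
    simp only [Matrix.vecMul, dotProduct, Pi.zero_apply, sub_mul, sum_sub_distrib, mul_assoc, ← mul_sum, a, b]
    split_ifs <;> ring
  have h2 : (fun i => v k * u i - u k * v i) = 0 := by
    by_contra h
    exact hdet (Matrix.exists_vecMul_eq_zero_iff.1 ⟨_, h, h1⟩)
  have h3 : ∀ i, v k * u i = u k * v i := fun i => sub_eq_zero.1 (congrFun h2 i)
  intro i l
  have hk' : v k ≠ 0 := hk
  apply mul_left_cancel₀ hk'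
  calc v k * (u i * v l) = (v k * u i) * v l := by ring
    _ = (v k * u l) * v i := by rw [h3, h3]; ring
    _ = _ := by ring

lemma lac {S : ℕ → Prop} (hS : ∃ᶠ t in atTop, S t) {ℓ : ℕ → ℝ} (hℓ : Tendsto ℓ atTop atTop) (K l0 : ℝ) :
    ∃ f : ℕ → ℕ, (∀ n, S (f n) ∧ l0 ≤ ℓ (f n)) ∧ ∀ i j, i < j → K * ℓ (f i) ≤ ℓ (f j) := by
  refine exists_seq_of_forall_finset_exists (fun t => S t ∧ l0 ≤ ℓ t) (fun s t => K * ℓ s ≤ ℓ t) ?_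
  intro s _
  have h1 : ∀ᶠ t in atTop, l0 ≤ ℓ t := hℓ.eventually_ge_atTop l0
  have h2 : ∀ᶠ t in atTop, ∀ x ∈ s, K * ℓ x ≤ ℓ t := by
    rw [eventually_all_finset]
    intro x _
    exact hℓ.eventually_ge_atTop _
  obtain ⟨t, ht, ht1, ht2⟩ := (hS.and_eventually (h1.and h2)).exists
  exact ⟨t, ⟨ht, ht1⟩, ht2⟩

end
end SchmidtPf

namespace SchmidtPf
open Finset MvPolynomial Filter
noncomputable section
set_option linter.unusedSectionVars false
set_option linter.style.haveILetI false

variable {ι : Type} [Fintype ι] [DecidableEq ι]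

lemma frac_red (a b : ℤ) (ha : a ≠ 0) : ∃ p : ℤ, 1 ≤ a.natAbs / Int.gcd a b ∧
    IsCoprime p ((a.natAbs / Int.gcd a b : ℕ) : ℤ) ∧ (-(b : ℚ) / a = (p : ℚ) / (a.natAbs / Int.gcd a b : ℕ)) := by
  have hg : 0 < Int.gcd a b := Int.gcd_pos_of_ne_zero_left _ ha
  have hgz : (Int.gcd a b : ℤ) ≠ 0 := by exact_mod_cast hg.ne'
  obtain ⟨a', ha'⟩ : (Int.gcd a b : ℤ) ∣ a := Int.gcd_dvd_left _ _
  obtain ⟨b', hb'⟩ : (Int.gcd a b : ℤ) ∣ b := Int.gcd_dvd_right _ _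
  set g := Int.gcd a b with hgd
  have hq : a.natAbs / g = a'.natAbs := by
    rw [ha', Int.natAbs_mul, Int.natAbs_natCast, Nat.mul_div_cancel_left _ hg]
  have ha0 : a' ≠ 0 := by rintro rfl; simp at ha'; exact ha ha'
  have hcop : IsCoprime b' a' := by
    rw [Int.isCoprime_iff_gcd_eq_one]
    have h1 : Int.gcd a b = g * Int.gcd a' b' := by
      conv_lhs => rw [ha', hb', Int.gcd_mul_left, Int.natAbs_natCast]
    have h2 : g * Int.gcd a' b' = g * 1 := by rw [← h1, mul_one]
    rw [Int.gcd_comm]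
    exact Nat.eq_of_mul_eq_mul_left hg h2
  have hgq : (g : ℚ) ≠ 0 := by exact_mod_cast hg.ne'
  have haq : (a' : ℚ) ≠ 0 := by exact_mod_cast ha0
  rw [hq]
  have hfr : -(b : ℚ) / a = -(b' : ℚ) / a' := by
    have e1 : (a : ℚ) = g * a' := by exact_mod_cast ha'
    have e2 : (b : ℚ) = g * b' := by exact_mod_cast hb'
    rw [e1, e2]; field_simp
  rcases le_total 0 a' with h | h
  · refine ⟨-b', Int.natAbs_pos.2 ha0, ?_, ?_⟩
    · rw [Int.natAbs_of_nonneg h]; exact hcop.neg_left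
    · rw [hfr]
      have : ((a'.natAbs : ℕ) : ℚ) = a' := by rw [← Int.cast_natCast, Int.natAbs_of_nonneg h]
      rw [this]; push_cast; rfl
  · refine ⟨b', Int.natAbs_pos.2 ha0, ?_, ?_⟩
    · rw [Int.ofNat_natAbs_of_nonpos h]; exact hcop.neg_right
    · rw [hfr]
      have : ((a'.natAbs : ℕ) : ℚ) = -a' := by rw [← Int.cast_natCast, Int.ofNat_natAbs_of_nonpos h, Int.cast_neg]
      rw [this, neg_div, div_neg]

theorem caseB {A : Type} [CommRing A] [Nontrivial A] [Module.Free ℤ A] [Module.Finite ℤ A] (ψ : A →+* ℝ)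
    (E : Matrix ι ι A) (M : Matrix ι ι ℝ) (hEM : E.map ψ * M = 1) (j0 : ι)
    {b : ι → ℝ} (hb : ∑ i, b i = 0) {δ η : ℝ} (hδ : 0 < δ) (hη : 0 < η) {ℓ : ℕ → ℝ} (hℓ : Tendsto ℓ atTop atTop)
    (u : ℕ → ι → ℤ) (Y : ℕ → Matrix ι ι ℤ) (huY : ∀ t j, j ≠ j0 → ∑ l, u t l * Y t l j = 0)
    (hYb : ∀ t i j, j ≠ j0 → |(M * (Y t).map (Int.castRingHom ℝ)) i j| ≤ Real.exp (ℓ t * (b i - δ)))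
    (hli : ∀ t, ∀ x : ι → ℤ, x j0 = 0 → (Y t).mulVec x = 0 → x = 0)
    {i0 i1 : ι} (hne : i0 ≠ i1)
    (hS : ∃ᶠ t in atTop, u t i0 ≠ 0 ∧ η * ℓ t ≤ Real.log (((u t i0).natAbs / Int.gcd (u t i0) (u t i1) : ℕ) : ℝ)) :
    False := by
  haveI : Nonempty ι := ⟨j0⟩
  set β := ∑ i, |b i| with hβ
  have hβ0 : 0 ≤ β := sum_nonneg fun _ _ => abs_nonneg _
  set ε := δ / (16 * (β + 1)) with hε
  have hε0 : 0 < ε := by positivity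
  have hβε : β * ε ≤ δ / 16 := by
    rw [hε, mul_div_assoc', div_le_div_iff₀ (by positivity) (by norm_num)]
    nlinarith
  set τ := min 1 ε with hτ
  have hτ0 : 0 < τ := lt_min one_pos hε0
  have hβτ : β * τ ≤ δ / 16 := (mul_le_mul_of_nonneg_left (min_le_right _ _) hβ0).trans hβε
  obtain ⟨m, hm, c, hc1, haux⟩ := auxPoly A E hε0
  set SE := ∑ k, ∑ i, ‖ψ (E k i)‖ with hSE
  have hSE0 : 0 ≤ SE := sum_nonneg fun _ _ => sum_nonneg fun _ _ => norm_nonneg _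
  set SM := ∑ k, ∑ i, |M k i| with hSM
  have hSM0 : 0 ≤ SM := sum_nonneg fun _ _ => sum_nonneg fun _ _ => abs_nonneg _
  have hME : ∀ k i, |M k i| ≤ SM := fun k i =>
    (single_le_sum (f := fun i => |M k i|) (fun _ _ => abs_nonneg _) (mem_univ i)).trans
      (single_le_sum (f := fun k => ∑ i, |M k i|) (fun _ _ => sum_nonneg fun _ _ => abs_nonneg _) (mem_univ k))
  set c0 := c * (1 + SE) with hc0
  have hc00 : 0 ≤ c0 := by positivity
  set B := 1 + δ + β + SM with hB
  have hB0 : 0 < B := by positivity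
  have hm' : (1:ℝ) ≤ m := by exact_mod_cast hm
  have hκ : 0 < δ / (4 * B) * m := by positivity
  obtain ⟨ω, hω0, hω1, hroth⟩ := rothLemma m (min 1 (δ / (4 * B) * m)) (lt_min one_pos hκ) (min_le_left _ _)
  have hlc : 0 ≤ Real.log c := Real.log_nonneg hc1
  set l0 := max (max 1 (16 / δ * (c0 * Fintype.card ι))) (2 * (m * Real.log c + 1) / (ω * η)) with hl0
  obtain ⟨f, hf, hfl⟩ := lac hS hℓ (2 / ω) l0
  have hl01 : 1 ≤ l0 := (le_max_left _ _).trans (le_max_left _ _)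
  have hl1 : ∀ n, 1 ≤ ℓ (f n) := fun n => hl01.trans (hf n).2
  set L := ∑ h : Fin m, ℓ (f h) / τ with hL
  have hLh : ∀ h : Fin m, ℓ (f h) ≤ τ * L := by
    intro h
    have := single_le_sum (f := fun h : Fin m => ℓ (f h) / τ) (fun h _ => div_nonneg (by linarith [hl1 h]) hτ0.le) (mem_univ h)
    rw [div_le_iff₀ hτ0] at this
    linarith
  have hL0 : 0 < L := by
    have := hLh ⟨0, hm⟩
    have h1 := hl1 0
    by_contra hcon
    push Not at hcon
    have : τ * L ≤ 0 := mul_nonpos_of_nonneg_of_nonpos hτ0.le hcon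
    linarith [hLh ⟨0, hm⟩, hl1 (⟨0, hm⟩ : Fin m)]
  set r : Fin m → ℕ := fun h => ⌈L / ℓ (f h)⌉₊ with hr
  have hr1 : ∀ h, 1 ≤ r h := fun h => Nat.ceil_pos.2 (div_pos hL0 (by linarith [hl1 h]))
  have hrl : ∀ h, L ≤ r h * ℓ (f h) := fun h => by
    have := Nat.le_ceil (L / ℓ (f h))
    rwa [div_le_iff₀ (by linarith [hl1 h])] at this
  have hrl2 : ∀ h, r h * ℓ (f h) ≤ (1 + τ) * L := fun h => by
    have h1 := Nat.ceil_lt_add_one (div_nonneg hL0.le (by linarith [hl1 h] : 0 ≤ ℓ (f h)))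
    have h2 : (r h : ℝ) * ℓ (f h) ≤ (L / ℓ (f h) + 1) * ℓ (f h) :=
      mul_le_mul_of_nonneg_right h1.le (by linarith [hl1 h])
    have h3 : (L / ℓ (f h) + 1) * ℓ (f h) = L + ℓ (f h) := by
      have : ℓ (f h) ≠ 0 := by linarith [hl1 h]
      field_simp
    linarith [hLh h]
  have hrl3 : ∀ h, r h * ℓ (f h) ≤ 2 * L := fun h => by
    have : τ * L ≤ 1 * L := mul_le_mul_of_nonneg_right (min_le_left _ _) hL0.le
    linarith [hrl2 h]
  obtain ⟨P, hP0, hPM, hPl, hPg⟩ := haux r hr1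
  set Y' : Fin m → Matrix ι ι ℤ := fun h => repl (Y (f h)) j0 i0 with hY'
  set W : Fin m → Matrix ι ι ℝ := fun h => M * (Y' h).map (Int.castRingHom ℝ) with hWd
  have hW : ∀ h, (E.map ψ) * W h = (Y' h).map (Int.castRingHom ℝ) := fun h => by
    rw [hWd]; simp only; rw [← Matrix.mul_assoc, hEM, Matrix.one_mul]
  have hWb : ∀ h i j, |W h i j| ≤ Real.exp (ℓ (f h) * (b i - δ + if j = j0 then B else 0)) := by
    intro h i j
    by_cases hj : j = j0
    · subst hj
      have h1 : W h i j = M i i0 := by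
        simp [hWd, hY', repl, Matrix.mul_apply, Pi.single_apply]
      rw [h1, if_pos rfl]
      have h2 : SM ≤ b i - δ + B := by
        have : |b i| ≤ β := single_le_sum (f := fun i => |b i|) (fun _ _ => abs_nonneg _) (mem_univ i)
        have := neg_abs_le (b i)
        linarith
      calc |M i i0| ≤ SM := hME _ _
        _ ≤ b i - δ + B := h2
        _ ≤ ℓ (f h) * (b i - δ + B) := by nlinarith [hl1 h]
        _ ≤ _ := by linarith [Real.add_one_le_exp (ℓ (f h) * (b i - δ + B))]
    · rw [if_neg hj, add_zero]
      refine le_trans (le_of_eq ?_) (hYb (f h) i j hj)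
      simp [hWd, hY', repl, Matrix.mul_apply, Matrix.updateCol_ne hj]
  have hl1P : l1 (lsub (Int.castRingHom ℝ) (fun _ => E.map ψ) P) ≤ c0 ^ (∑ h, r h) := by
    refine (l1_lsub hPM (c := 1 + SE) ?_).trans ?_
    · intro h k
      have := single_le_sum (f := fun k => ∑ i, ‖ψ (E k i)‖) (fun _ _ => sum_nonneg fun _ _ => norm_nonneg _) (mem_univ k)
      simp only [Matrix.map_apply]
      linarith
    · rw [hc0, mul_pow]
      refine mul_le_mul_of_nonneg_right (le_trans (le_of_eq ?_) hPl) (by positivity)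
      simp only [l1]
      exact sum_congr rfl fun J _ => by rw [eq_intCast, Int.norm_cast_real]
  have hcN : ∀ h : Fin m, c0 * Fintype.card ι ≤ Real.exp (δ * ℓ (f h) / 16) := by
    intro h
    have h1 : 16 / δ * (c0 * Fintype.card ι) ≤ ℓ (f h) :=
      ((le_max_right _ _).trans (le_max_left _ _)).trans (hf h).2
    have h2 : c0 * Fintype.card ι ≤ δ * ℓ (f h) / 16 := by
      rw [div_mul_eq_mul_div, div_le_iff₀ hδ] at h1
      linarith
    linarith [Real.add_one_le_exp (δ * ℓ (f h) / 16)]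
  have hidx := idx_hat ψ E Y' W hW hm j0 hr1 hL0 hb le_rfl hδ hB0 hrl hrl2 (min_le_left _ _) hβε hβτ hWb hPM hc00 hPg hl1P hcN
  obtain ⟨Q, hQ0, hQd, hQl, hQi⟩ := dehom hne j0 (fun h : Fin m => u (f h)) (fun h => (hf h).1.1) Y'
    (fun h => repl_det _ _ _ (u (f h)) (huY _) (hf h).1.1 (hli _)) (fun h j => repl_dot _ _ _ _ (huY _) j) hP0 hPM _ hidx
  choose p hp1 hp2 hp3 using fun h : Fin m => frac_red (u (f h) i0) (u (f h) i1) (hf h).1.1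
  set R := 2 * L / l0 with hR
  have hrR : ∀ h, (r h : ℝ) ≤ R := fun h => by
    rw [hR, le_div_iff₀ (by linarith)]
    exact (mul_le_mul_of_nonneg_left (hf h).2 (by positivity)).trans (hrl3 h)
  refine hroth r R p (fun h => (u (f h) i0).natAbs / Int.gcd (u (f h) i0) (u (f h) i1)) Q hr1 hrR ?_ hp1 hp2 hQ0 hQd ?_ ?_
  · intro i j hij
    have h1 := hfl i j hij
    have h2 := hrl3 j
    have h3 := hrl i
    have hi := hl1 i
    have h4 : (r j : ℝ) * (2 / ω * ℓ (f i)) ≤ 2 * (r i * ℓ (f i)) :=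
      (mul_le_mul_of_nonneg_left h1 (by positivity)).trans (h2.trans (by linarith))
    have h5 : (r j : ℝ) * (2 / ω * ℓ (f i)) = 2 * (ℓ (f i)) * (r j / ω) := by ring
    have h6 : 2 * (ℓ (f i)) * (r j / ω) ≤ 2 * (ℓ (f i)) * r i := by rw [← h5]; linarith
    have h7 := le_of_mul_le_mul_left h6 (by linarith)
    rw [div_le_iff₀ hω0] at h7
    linarith
  · intro h
    have hR0 : 0 ≤ R := by positivity
    have hlog : Real.log (l1 Q) ≤ m * R * Real.log c := by
      rcases (l1_nonneg Q).eq_or_lt with h0 | h0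
      · rw [← h0, Real.log_zero]; positivity
      · calc Real.log (l1 Q) ≤ Real.log (c ^ (∑ h, r h)) := Real.log_le_log h0 (hQl.trans hPl)
          _ = (∑ h, (r h : ℝ)) * Real.log c := by rw [Real.log_pow]; push_cast; rfl
          _ ≤ (∑ h : Fin m, R) * Real.log c := mul_le_mul_of_nonneg_right (sum_le_sum fun h _ => hrR h) hlc
          _ = _ := by simp
    have h1 : η * ℓ (f h) ≤ _ := (hf h).1.2
    have h2 : ω * (η * L) ≤ ω * (r h * Real.log (((u (f h) i0).natAbs / Int.gcd (u (f h) i0) (u (f h) i1) : ℕ) : ℝ)) := by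
      refine mul_le_mul_of_nonneg_left ?_ hω0.le
      calc η * L ≤ η * (r h * ℓ (f h)) := mul_le_mul_of_nonneg_left (hrl h) hη.le
        _ = r h * (η * ℓ (f h)) := by ring
        _ ≤ _ := mul_le_mul_of_nonneg_left h1 (by positivity)
    refine le_trans ?_ h2
    have h3 : 2 * (m * Real.log c + 1) / (ω * η) ≤ l0 := le_max_right _ _
    rw [div_le_iff₀ (by positivity)] at h3
    have h4 : m * R * Real.log c + R ≤ ω * (η * L) := by
      have : m * R * Real.log c + R = L * (2 * (m * Real.log c + 1)) / l0 := by rw [hR]; ring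
      rw [this, div_le_iff₀ (by linarith)]
      nlinarith
    linarith
  · have : (fun h => (p h : ℚ) / ((u (f h) i0).natAbs / Int.gcd (u (f h) i0) (u (f h) i1) : ℕ)) = (fun h : Fin m => -(u (f h) i1 : ℚ) / u (f h) i0) := by
      funext h; exact (hp3 h).symm
    rw [this]
    intro e he
    exact (min_le_right _ _).trans (hQi e he)

lemma nA_lin {A : Type} [CommRing A] [Nontrivial A] [Module.Free ℤ A] [Module.Finite ℤ A] (E : Matrix ι ι A)
    (u : ι → ℤ) {H : ℝ} (hu : ∀ k, |(u k : ℝ)| ≤ H) (i : ι) :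
    nA A (∑ k, (u k : A) * E k i) ≤ (∑ k, nA A (E k i)) * H := by
  letI := normA A
  rw [← nA_eq, sum_mul]
  refine (norm_sum_le _ _).trans (sum_le_sum fun k _ => ?_)
  rw [← zsmul_eq_mul, mul_comm]
  refine (norm_zsmul_le _ _).trans ?_
  rw [nA_eq]
  exact mul_le_mul_of_nonneg_right (by rw [Int.norm_eq_abs]; exact hu k) (nA_nonneg _)

theorem caseA {A : Type} [CommRing A] [IsDomain A] [Module.Free ℤ A] [Module.Finite ℤ A] (ψ : A →+* ℝ)
    (E : Matrix ι ι A) (M : Matrix ι ι ℝ) (hEM : E.map ψ * M = 1) (j0 : ι)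
    {b : ι → ℝ} {δ : ℝ} (hδ : 0 < δ) {ℓ : ℕ → ℝ} (hℓ : Tendsto ℓ atTop atTop)
    (u : ℕ → ι → ℤ) (hu0 : ∀ t, u t ≠ 0) (Y : ℕ → Matrix ι ι ℤ)
    (hub : ∀ t i, |ψ (∑ k, (u t k : A) * E k i)| ≤ Real.exp (ℓ t * (-b i + δ / 4)))
    (huY : ∀ t j, j ≠ j0 → ∑ l, u t l * Y t l j = 0)
    (hYb : ∀ t i j, j ≠ j0 → |(M * (Y t).map (Int.castRingHom ℝ)) i j| ≤ Real.exp (ℓ t * (b i - δ)))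
    (hli : ∀ t, ∀ x : ι → ℤ, x j0 = 0 → (Y t).mulVec x = 0 → x = 0) :
    ∃ η : ℝ, 0 < η ∧ ((∃ᶠ t in atTop, ∀ k, |(u t k : ℝ)| ≤ Real.exp (η * ℓ t)) →
      ∃ u0 : ι → ℤ, u0 ≠ 0 ∧ ∃ᶠ t in atTop, ∀ i l, u0 i * u t l = u0 l * u t i) := by
  obtain ⟨c, hc, D, hD⟩ := liouville (A := A) ψ
  set η := δ / (8 * (D + 1)) with hη
  have hη0 : 0 < η := by positivity
  have hηD : η * D ≤ δ / 8 := by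
    rw [hη, div_mul_eq_mul_div, div_le_div_iff₀ (by positivity) (by norm_num)]
    nlinarith
  refine ⟨η, hη0, fun hfr => ?_⟩
  set C := 1 + ∑ i, ∑ k, nA A (E k i) with hC
  have hCi : ∀ i, ∑ k, nA A (E k i) ≤ C := fun i => by
    have := single_le_sum (f := fun i => ∑ k, nA A (E k i)) (fun _ _ => sum_nonneg fun _ _ => nA_nonneg _) (mem_univ i)
    linarith
  have hC1 : 1 ≤ C := by
    have : 0 ≤ ∑ i, ∑ k, nA A (E k i) := sum_nonneg fun _ _ => sum_nonneg fun _ _ => nA_nonneg _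
    linarith
  have hl1 : ∀ᶠ t in atTop, max 0 (8 * C ^ D / (δ * c)) ≤ ℓ t := hℓ.eventually_ge_atTop _
  obtain ⟨t0, ht0, ht1⟩ := (hfr.and_eventually hl1).exists
  have hl0 : 0 ≤ ℓ t0 := (le_max_left _ _).trans ht1
  have hl2 : 8 * C ^ D / (δ * c) ≤ ℓ t0 := (le_max_right _ _).trans ht1
  have hbi : ∀ i, (∑ k, (u t0 k : A) * E k i) ≠ 0 → b i ≤ δ / 2 := by
    intro i hi
    by_contra hcon
    push Not at hcon
    have h1 := hD _ hi
    have h2 := nA_lin E (u t0) ht0 i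
    have h3 : max 1 (nA A (∑ k, (u t0 k : A) * E k i)) ≤ C * Real.exp (η * ℓ t0) := by
      refine max_le ?_ (h2.trans (mul_le_mul_of_nonneg_right (hCi i) (Real.exp_pos _).le))
      exact one_le_mul_of_one_le_of_one_le hC1 (Real.one_le_exp (by positivity))
    have h4 : c ≤ Real.exp (ℓ t0 * (-b i + δ / 4)) * (C * Real.exp (η * ℓ t0)) ^ D :=
      h1.trans (mul_le_mul (hub t0 i) (pow_le_pow_left₀ (by positivity) h3 _) (by positivity) (Real.exp_pos _).le)
    rw [mul_pow, ← Real.exp_nat_mul] at h4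
    have h5 : Real.exp (ℓ t0 * (-b i + δ / 4)) * (C ^ D * Real.exp (D * (η * ℓ t0))) =
        C ^ D * Real.exp (ℓ t0 * (-b i + δ / 4) + D * (η * ℓ t0)) := by rw [Real.exp_add]; ring
    rw [h5] at h4
    have h6 : Real.exp (ℓ t0 * (-b i + δ / 4) + D * (η * ℓ t0)) ≤ Real.exp (-(δ / 8 * ℓ t0)) := by
      apply Real.exp_le_exp.2
      have : D * (η * ℓ t0) ≤ δ / 8 * ℓ t0 := by nlinarith
      nlinarith
    have h7 : c ≤ C ^ D * Real.exp (-(δ / 8 * ℓ t0)) := h4.trans (mul_le_mul_of_nonneg_left h6 (by positivity))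
    rw [Real.exp_neg, ← div_eq_mul_inv, le_div_iff₀ (Real.exp_pos _)] at h7
    rw [div_le_iff₀ (by positivity)] at hl2
    have h8 := Real.add_one_le_exp (δ / 8 * ℓ t0)
    nlinarith
  refine ⟨u t0, hu0 t0, Eventually.frequently ?_⟩
  set S := ∑ i, |ψ (∑ k, (u t0 k : A) * E k i)| with hS
  have hl3 : ∀ᶠ t in atTop, max 0 (2 * S / δ) ≤ ℓ t := hℓ.eventually_ge_atTop _
  filter_upwards [hl3] with t ht
  have hlt0 : 0 ≤ ℓ t := (le_max_left _ _).trans ht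
  have hlt1 : 2 * S / δ ≤ ℓ t := (le_max_right _ _).trans ht
  refine parallel (Y t) j0 (u t0) (u t) ?_ (huY t) (hu0 t) (hli t)
  intro j hj
  have hvec : Matrix.vecMul (fun k => (u t0 k : ℝ)) (E.map ψ) = fun i => ψ (∑ k, (u t0 k : A) * E k i) := by
    funext i
    simp [Matrix.vecMul, dotProduct]
  have hkey : ((∑ l, u t0 l * Y t l j : ℤ) : ℝ) =
      ∑ i, ψ (∑ k, (u t0 k : A) * E k i) * (M * (Y t).map (Int.castRingHom ℝ)) i j := by
    have h1 : Matrix.vecMul (Matrix.vecMul (fun k => (u t0 k : ℝ)) (E.map ψ)) (M * (Y t).map (Int.castRingHom ℝ))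
        = Matrix.vecMul (fun k => (u t0 k : ℝ)) ((Y t).map (Int.castRingHom ℝ)) := by
      rw [Matrix.vecMul_vecMul, ← Matrix.mul_assoc, hEM, Matrix.one_mul]
    rw [hvec] at h1
    have h2 := congrFun h1 j
    simp only [Matrix.vecMul, dotProduct] at h2
    rw [h2]
    simp
  have hlt : |((∑ l, u t0 l * Y t l j : ℤ) : ℝ)| < 1 := by
    rw [hkey]
    calc |∑ i, ψ (∑ k, (u t0 k : A) * E k i) * (M * (Y t).map (Int.castRingHom ℝ)) i j|
        ≤ ∑ i, |ψ (∑ k, (u t0 k : A) * E k i) * (M * (Y t).map (Int.castRingHom ℝ)) i j| := abs_sum_le_sum_abs _ _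
      _ ≤ ∑ i, |ψ (∑ k, (u t0 k : A) * E k i)| * Real.exp (-(δ / 2 * ℓ t)) := by
        refine sum_le_sum fun i _ => ?_
        rw [abs_mul]
        by_cases hi : (∑ k, (u t0 k : A) * E k i) = 0
        · rw [hi]; simp
        · refine mul_le_mul_of_nonneg_left ((hYb t i j hj).trans (Real.exp_le_exp.2 ?_)) (abs_nonneg _)
          have := hbi i hi
          nlinarith
      _ = S * Real.exp (-(δ / 2 * ℓ t)) := by rw [← sum_mul]
      _ < 1 := by
        rw [Real.exp_neg, ← div_eq_mul_inv, div_lt_one (Real.exp_pos _)]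
        have h8 := Real.add_one_le_exp (δ / 2 * ℓ t)
        rw [div_le_iff₀ hδ] at hlt1
        linarith
  have : |∑ l, u t0 l * Y t l j| < 1 := by exact_mod_cast hlt
  exact Int.abs_lt_one_iff.1 this

/-- Penultimate-minimum theorem (Roth–Schmidt). -/
theorem pt [Nontrivial ι] {A : Type} [CommRing A] [IsDomain A] [Module.Free ℤ A] [Module.Finite ℤ A] (ψ : A →+* ℝ)
    (E : Matrix ι ι A) (M : Matrix ι ι ℝ) (hEM : E.map ψ * M = 1) (j0 : ι)
    {b : ι → ℝ} (hb : ∑ i, b i = 0) {δ : ℝ} (hδ : 0 < δ) {ℓ : ℕ → ℝ} (hℓ : Tendsto ℓ atTop atTop)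
    (u : ℕ → ι → ℤ) (hu0 : ∀ t, u t ≠ 0) (Y : ℕ → Matrix ι ι ℤ)
    (hub : ∀ t i, |ψ (∑ k, (u t k : A) * E k i)| ≤ Real.exp (ℓ t * (-b i + δ / 4)))
    (huY : ∀ t j, j ≠ j0 → ∑ l, u t l * Y t l j = 0)
    (hYb : ∀ t i j, j ≠ j0 → |(M * (Y t).map (Int.castRingHom ℝ)) i j| ≤ Real.exp (ℓ t * (b i - δ)))
    (hli : ∀ t, ∀ x : ι → ℤ, x j0 = 0 → (Y t).mulVec x = 0 → x = 0) :
    ∃ u0 : ι → ℤ, u0 ≠ 0 ∧ ∃ᶠ t in atTop, ∀ i l, u0 i * u t l = u0 l * u t i := by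
  have hne : (univ : Finset ι).Nonempty := ⟨j0, mem_univ _⟩
  choose v hv hgv using fun t => Finset.extract_gcd (u t) hne
  have hg0 : ∀ t, univ.gcd (u t) ≠ 0 := by
    intro t h
    rw [Finset.gcd_eq_zero_iff] at h
    exact hu0 t (funext fun i => h i (mem_univ i))
  have hv' : ∀ t k, u t k = univ.gcd (u t) * v t k := fun t k => hv t k (mem_univ k)
  have hv0 : ∀ t, v t ≠ 0 := by
    intro t h
    apply hu0 t
    funext k
    rw [hv', h]; simp
  have hvY : ∀ t j, j ≠ j0 → ∑ l, v t l * Y t l j = 0 := by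
    intro t j hj
    have h1 := huY t j hj
    simp only [hv' t, mul_assoc, ← mul_sum] at h1
    exact (mul_eq_zero.1 h1).resolve_left (hg0 t)
  have hvb : ∀ t i, |ψ (∑ k, (v t k : A) * E k i)| ≤ Real.exp (ℓ t * (-b i + δ / 4)) := by
    intro t i
    refine le_trans ?_ (hub t i)
    have h1 : ∑ k, (u t k : A) * E k i = ((univ.gcd (u t) : ℤ) : A) * ∑ k, (v t k : A) * E k i := by
      rw [mul_sum]
      refine sum_congr rfl fun k _ => ?_
      rw [hv' t k]
      push_cast
      ring
    rw [h1, map_mul, map_intCast, abs_mul]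
    refine le_mul_of_one_le_left (abs_nonneg _) ?_
    have := Int.one_le_abs (hg0 t)
    exact_mod_cast this
  obtain ⟨η, hη, hA⟩ := caseA ψ E M hEM j0 hδ hℓ v hv0 Y hvb hvY hYb hli
  by_cases hfr : ∃ᶠ t in atTop, ∀ k, |(v t k : ℝ)| ≤ Real.exp (η * ℓ t)
  · obtain ⟨u0, hu00, h⟩ := hA hfr
    refine ⟨u0, hu00, h.mono fun t ht i l => ?_⟩
    rw [hv' t l, hv' t i]
    linear_combination (univ.gcd (u t)) * ht i l
  · exfalso
    rw [not_frequently] at hfr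
    have hN : (0:ℝ) < Fintype.card ι := by exact_mod_cast Fintype.card_pos_iff.2 ⟨j0⟩
    have hlp : ∀ᶠ t in atTop, 0 ≤ ℓ t := hℓ.eventually_ge_atTop 0
    have hex : ∀ᶠ t in atTop, ∃ p : ι × ι, p.1 ≠ p.2 ∧ (v t p.1 ≠ 0 ∧ η / Fintype.card ι * ℓ t ≤
        Real.log (((v t p.1).natAbs / Int.gcd (v t p.1) (v t p.2) : ℕ) : ℝ)) := by
      filter_upwards [hfr, hlp] with t ht hlt
      push Not at ht
      obtain ⟨k, hk⟩ := ht
      have hk0 : v t k ≠ 0 := by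
        intro h
        rw [h] at hk
        simp at hk
        linarith [Real.exp_pos (η * ℓ t)]
      obtain ⟨i1, hi1, hle⟩ := prim_q (hgv t) inferInstance k hk0
      refine ⟨(k, i1), hi1.symm, hk0, ?_⟩
      simp only
      set q := (v t k).natAbs / Int.gcd (v t k) (v t i1) with hq
      have h1 : Real.exp (η * ℓ t) ≤ (q : ℝ) ^ Fintype.card ι := by
        refine hk.le.trans ?_
        have h2 : |(v t k : ℝ)| = ((v t k).natAbs : ℝ) := by
          rw [Nat.cast_natAbs]; push_cast; rfl
        rw [h2]
        exact_mod_cast hle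
      have h3 := Real.log_le_log (Real.exp_pos _) h1
      rw [Real.log_exp, Real.log_pow] at h3
      rw [div_mul_eq_mul_div, div_le_iff₀ hN]
      linarith
    have hex2 : ∃ p : ι × ι, ∃ᶠ t in atTop, p.1 ≠ p.2 ∧ (v t p.1 ≠ 0 ∧ η / Fintype.card ι * ℓ t ≤
        Real.log (((v t p.1).natAbs / Int.gcd (v t p.1) (v t p.2) : ℕ) : ℝ)) := by
      by_contra hcon
      push Not at hcon
      have h1 := eventually_all.2 hcon
      obtain ⟨t, ⟨p, hp⟩, h⟩ := (hex.and h1).exists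
      exact absurd hp.2.2 (not_le.2 (h p hp.1 hp.2.1))
    obtain ⟨p, hp⟩ := hex2
    have hpne : p.1 ≠ p.2 := hp.exists.choose_spec.1
    exact caseB ψ E M hEM j0 hb hδ (by positivity) hℓ v Y hvY hYb hli hpne (hp.mono fun t ht => ht.2)

end
end SchmidtPf

namespace SchmidtPf
open Finset
noncomputable section
set_option linter.unusedSectionVars false
set_option linter.style.haveILetI false

variable {ι : Type} [Fintype ι] [DecidableEq ι]

lemma dep_exists (n : ℕ) (f : ι → ℕ → ℝ) (S : Finset ι) (hS : S.card = n + 1) :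
    ∃ i0 ∈ S, ∀ a : ℕ → ℝ, ∀ T : ℝ, (∀ i ∈ S.erase i0, |∑ k ∈ range n, f i k * a k| ≤ T) →
      |∑ k ∈ range n, f i0 k * a k| ≤ n * T := by
  set Φ : (S → ℝ) →ₗ[ℝ] (Fin n → ℝ) :=
    { toFun := fun c k => ∑ i, c i * f i k
      map_add' := by intro x y; funext k; simp [add_mul, sum_add_distrib]
      map_smul' := by intro r x; funext k; simp [mul_sum, mul_assoc] } with hΦ
  have hker : LinearMap.ker Φ ≠ ⊥ := LinearMap.ker_ne_bot_of_finrank_lt (by simp [hS])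
  obtain ⟨c, hc, hc0⟩ := (Submodule.ne_bot_iff _).1 hker
  have hne : (univ : Finset S).Nonempty := by
    have : 0 < S.card := by omega
    obtain ⟨x, hx⟩ := card_pos.1 this
    exact ⟨⟨x, hx⟩, mem_univ _⟩
  obtain ⟨i0, -, hmax⟩ := exists_max_image univ (fun i : S => |c i|) hne
  have hci : 0 < |c i0| := by
    obtain ⟨j, hj⟩ := Function.ne_iff.1 hc0
    exact (abs_pos.2 hj).trans_le (hmax j (mem_univ _))
  refine ⟨i0, i0.2, fun a T hT => ?_⟩
  have hrel : ∑ i : S, c i * (∑ k ∈ range n, f i k * a k) = 0 := by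
    have h1 : ∀ k ∈ range n, ∑ i : S, c i * f i k = 0 := by
      intro k hk
      have := congrFun (LinearMap.mem_ker.1 hc) ⟨k, mem_range.1 hk⟩
      exact this
    calc ∑ i : S, c i * (∑ k ∈ range n, f i k * a k) = ∑ k ∈ range n, (∑ i : S, c i * f i k) * a k := by
          simp only [mul_sum, sum_mul]
          rw [sum_comm]
          simp only [mul_assoc]
      _ = 0 := sum_eq_zero fun k hk => by rw [h1 k hk, zero_mul]
  rw [← add_sum_erase _ _ (mem_univ i0)] at hrel
  have h2 : |c i0| * |∑ k ∈ range n, f i0 k * a k| ≤ ∑ i ∈ univ.erase i0, |c i0| * T := by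
    rw [← abs_mul, eq_neg_of_add_eq_zero_left hrel, abs_neg]
    refine (abs_sum_le_sum_abs _ _).trans (sum_le_sum fun i hi => ?_)
    rw [abs_mul]
    refine mul_le_mul (hmax i (mem_univ _)) (hT i (mem_erase.2 ⟨?_, i.2⟩)) (abs_nonneg _) hci.le
    intro h
    exact (ne_of_mem_erase hi) (Subtype.ext h)
  rw [sum_const, card_erase_of_mem (mem_univ _), card_univ, Fintype.card_coe, hS, nsmul_eq_mul] at h2
  have h3 : |c i0| * |∑ k ∈ range n, f i0 k * a k| ≤ |c i0| * (n * T) := by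
    refine h2.trans (le_of_eq ?_)
    push_cast
    ring
  exact le_of_mul_le_mul_left h3 hci

lemma davenport_nat (c : ℝ) (hc : 1 ≤ c) (n : ℕ) : ∀ (f : ι → ℕ → ℝ) (S : Finset ι), S.card = n → (n : ℝ) ≤ c →
    ∃ π : ι → ℕ, Set.BijOn π S (range n) ∧ ∀ j ≤ n, ∀ (a : ℕ → ℝ) (T : ℝ), 0 ≤ T →
      (∀ i ∈ S, π i < j → |∑ k ∈ range j, f i k * a k| ≤ T) → ∀ i ∈ S, |∑ k ∈ range j, f i k * a k| ≤ c ^ n * T := by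
  induction n with
  | zero =>
    intro f S hS _
    rw [card_eq_zero] at hS
    subst hS
    exact ⟨fun _ => 0, by simp, by simp⟩
  | succ n ih =>
    intro f S hS hnc
    push_cast at hnc
    obtain ⟨i0, hi0, hdep⟩ := dep_exists n f S hS
    obtain ⟨π, hπ, h⟩ := ih f (S.erase i0) (by rw [card_erase_of_mem hi0, hS]; rfl) (by linarith)
    refine ⟨Function.update π i0 n, ?_, ?_⟩
    · have h1 : Set.BijOn (Function.update π i0 n) (S.erase i0) (range n) := by
        refine hπ.congr fun i hi => ?_
        have : i ≠ i0 := ne_of_mem_erase hi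
        rw [Function.update_of_ne this]
      have h2 : (S : Set ι) = insert i0 (S.erase i0 : Set ι) := by
        rw [← coe_insert, insert_erase hi0]
      have h3 : ((range (n+1) : Finset ℕ) : Set ℕ) = insert (Function.update π i0 n i0) (range n : Set ℕ) := by
        rw [Function.update_self, ← coe_insert, range_add_one]
      rw [h2, h3]
      exact h1.insert (by simp)
    · intro j hj a T hT hb
      rcases hj.eq_or_lt with rfl | hj
      · intro i hi
        have hlt : Function.update π i0 n i < n + 1 := by
          by_cases h1 : i = i0
          · subst h1; simp
          · rw [Function.update_of_ne h1]
            have := hπ.mapsTo (mem_coe.2 (mem_erase.2 ⟨h1, hi⟩))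
            simp at this
            omega
        exact (hb i hi hlt).trans (le_mul_of_one_le_left hT (one_le_pow₀ hc))
      · have hjn : j ≤ n := by omega
        have h1 := h j hjn a T hT (fun i hi hij => by
          have hne : i ≠ i0 := ne_of_mem_erase hi
          exact hb i (mem_of_mem_erase hi) (by rwa [Function.update_of_ne hne]))
        have hcn : 0 ≤ c ^ n * T := by positivity
        intro i hi
        by_cases hii : i = i0
        · subst hii
          have h2 := hdep (fun k => if k < j then a k else 0) (c ^ n * T)
          have h3 : ∀ i, ∑ k ∈ range n, f i k * (if k < j then a k else 0) = ∑ k ∈ range j, f i k * a k := by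
            intro i
            simp only [mul_ite, mul_zero]
            rw [← sum_filter]
            refine sum_congr ?_ fun _ _ => rfl
            ext k
            simp
            omega
          simp only [h3] at h2
          refine (h2 h1).trans ?_
          rw [pow_succ', mul_assoc]
          exact mul_le_mul_of_nonneg_right (by linarith) hcn
        · refine (h1 i (mem_erase.2 ⟨hii, hi⟩)).trans ?_
          rw [pow_succ', mul_assoc]
          exact le_mul_of_one_le_left hcn hc

/-- Davenport's lemma -/
lemma davenport (U : Matrix ι ι ℝ) {N : ℕ} (o : ι ≃ Fin N) :
    ∃ π : Equiv.Perm ι, ∀ (j : ι) (a : ι → ℝ), (∀ k, o j < o k → a k = 0) → ∀ T : ℝ, 0 ≤ T →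
      (∀ i, o (π i) ≤ o j → |∑ k, U i k * a k| ≤ T) → ∀ i, |∑ k, U i k * a k| ≤ ((N : ℝ) + 1) ^ N * T := by
  have hN : Fintype.card ι = N := by simpa using Fintype.card_congr o
  have hmem : ∀ k, k < N ↔ ∃ x : ι, (o x : ℕ) = k := by
    intro k
    constructor
    · intro h; exact ⟨o.symm ⟨k, h⟩, by simp⟩
    · rintro ⟨x, rfl⟩; exact (o x).2
  set g : ℕ → Option ι := fun k => if h : k < N then some (o.symm ⟨k, h⟩) else none
  obtain ⟨π, hπ, h⟩ := davenport_nat ((N : ℝ) + 1) (by linarith [Nat.cast_nonneg (α := ℝ) N]) N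
    (fun i k => if h : k < N then U i (o.symm ⟨k, h⟩) else 0) univ (by rw [card_univ, hN]) (by linarith)
  have hlt : ∀ i, π i < N := fun i => by simpa using hπ.mapsTo (mem_coe.2 (mem_univ i))
  set p : ι → ι := fun i => o.symm ⟨π i, hlt i⟩ with hp
  have hpi : Function.Injective p := by
    intro x y hxy
    have := o.symm.injective hxy
    rw [Fin.mk.injEq] at this
    exact hπ.injOn (by simp) (by simp) this
  refine ⟨Equiv.ofBijective p (Finite.injective_iff_bijective.1 hpi), ?_⟩
  intro j a ha T hT hb
  have hsum : ∀ i, ∑ k, U i k * a k = ∑ k ∈ range ((o j : ℕ) + 1),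
      (if h : k < N then U i (o.symm ⟨k, h⟩) else 0) * (if h : k < N then a (o.symm ⟨k, h⟩) else 0) := by
    intro i
    have e1 : ∑ k, U i k * a k = ∑ k : Fin N, (if h : (k:ℕ) < N then U i (o.symm ⟨k, h⟩) else 0) * (if h : (k:ℕ) < N then a (o.symm ⟨k, h⟩) else 0) := by
      rw [← Equiv.sum_comp o.symm]
      refine sum_congr rfl fun k _ => ?_
      simp
    rw [e1, Fin.sum_univ_eq_sum_range (fun k => (if h : (k:ℕ) < N then U i (o.symm ⟨k, h⟩) else 0) * (if h : (k:ℕ) < N then a (o.symm ⟨k, h⟩) else 0)) N]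
    symm
    refine sum_subset ?_ ?_
    · intro k hk
      have := (o j).2
      simp at hk ⊢
      omega
    · intro k hk hk2
      simp at hk hk2
      have : a (o.symm ⟨k, hk⟩) = 0 := ha _ (by rw [Equiv.apply_symm_apply, Fin.lt_def]; simp; omega)
      simp [hk, this]
  have h1 := h ((o j : ℕ) + 1) (by have := (o j).2; omega) (fun k => if h : k < N then a (o.symm ⟨k, h⟩) else 0) T hT
  intro i
  rw [hsum i]
  refine h1 (fun i' _ hi' => ?_) i (mem_univ i)
  rw [← hsum i']
  apply hb
  rw [Equiv.ofBijective_apply, hp, Equiv.apply_symm_apply, Fin.le_def]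
  simp
  omega

end
end SchmidtPf

namespace SchmidtPf
open Finset
noncomputable section
set_option linter.unusedSectionVars false
set_option linter.style.haveILetI false

variable {ι : Type} [Fintype ι] [DecidableEq ι]

/-- `Y` lies in the box of size `T` -/
def Bd (M : Matrix ι ι ℝ) (w : ι → ℝ) (T : ℝ) (Y : ι → ℤ) : Prop :=
  ∀ i, |∑ k, M i k * (Y k : ℝ)| ≤ w i * T

lemma cramer_sum (Z : Matrix ι ι ℤ) (Y : ι → ℤ) (l : ι) :
    ∑ k, Z l k * (Z.updateCol k Y).det = Z.det * Y l := by
  have := congrFun (Matrix.mulVec_cramer Z Y) l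
  simpa [Matrix.mulVec, dotProduct, Matrix.cramer_apply] using this

lemma flatten (M : Matrix ι ι ℝ) {w : ι → ℝ} (hw : ∀ i, 0 < w i) (Z : Matrix ι ι ℤ) (hZ : Z.det ≠ 0)
    {B : ι → ℝ} {K : ℝ} (hK : 0 ≤ K)
    (hP : ∀ (Y : ι → ℤ) (j : ι), (Z.updateCol j Y).det ≠ 0 → ∀ T : ℝ, 0 ≤ T → Bd M w T Y → B j ≤ K * T)
    {N : ℕ} (o : ι ≃ Fin N) {ρ : ι → ℝ} (hρ0 : ∀ i, 0 < ρ i) (hρ : ∀ k l, o k ≤ o l → ρ l ≤ ρ k) :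
    ∃ π : Equiv.Perm ι, ∀ Y : ι → ℤ, Y ≠ 0 → ∃ j, (Z.updateCol j Y).det ≠ 0 ∧
      (∀ k, o j < o k → (Z.updateCol k Y).det = 0) ∧
      ∀ T : ℝ, 0 ≤ T → Bd M (fun i => w i / ρ (π i)) T Y → ρ j * B j ≤ K * ((N : ℝ) + 1) ^ N * T := by
  obtain ⟨π, hπ⟩ := davenport (Matrix.of fun i k => (∑ l, M i l * (Z l k : ℝ)) / w i) o
  refine ⟨π, fun Y hY => ?_⟩
  have hne : (univ.filter fun k => (Z.updateCol k Y).det ≠ 0).Nonempty := by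
    by_contra hcon
    rw [not_nonempty_iff_eq_empty, filter_eq_empty_iff] at hcon
    apply hY
    funext l
    have h1 := cramer_sum Z Y l
    rw [sum_eq_zero (fun k _ => by have := hcon (mem_univ k); push Not at this; rw [this, mul_zero])] at h1
    exact (mul_eq_zero.1 h1.symm).resolve_left hZ
  obtain ⟨j, hj, hmax⟩ := exists_max_image _ o hne
  rw [mem_filter] at hj
  refine ⟨j, hj.2, ?_, ?_⟩
  · intro k hk
    by_contra hcon
    exact absurd (hmax k (mem_filter.2 ⟨mem_univ _, hcon⟩)) (not_le.2 hk)
  · intro T hT hb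
    have hD : (Z.det : ℝ) ≠ 0 := by exact_mod_cast hZ
    set a : ι → ℝ := fun k => ((Z.updateCol k Y).det : ℝ) / Z.det with ha
    have hU : ∀ i, ∑ k, (∑ l, M i l * (Z l k : ℝ)) / w i * a k = (∑ l, M i l * (Y l : ℝ)) / w i := by
      intro i
      have h1 : ∀ l, ∑ k, (Z l k : ℝ) * a k = Y l := by
        intro l
        have h2 : ∑ k, (Z l k : ℝ) * ((Z.updateCol k Y).det : ℝ) = Z.det * Y l := by exact_mod_cast cramer_sum Z Y l
        simp only [ha, mul_div_assoc', ← sum_div]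
        rw [h2, mul_div_cancel_left₀ _ hD]
      calc ∑ k, (∑ l, M i l * (Z l k : ℝ)) / w i * a k = ∑ k, ∑ l, M i l * ((Z l k : ℝ) * a k) / w i := by
            refine sum_congr rfl fun k _ => ?_
            rw [sum_div, sum_mul]
            exact sum_congr rfl fun l _ => by ring
        _ = _ := by
            rw [sum_comm, sum_div]
            refine sum_congr rfl fun l _ => ?_
            rw [← sum_div, ← mul_sum, h1]
    have hρj := hρ0 j
    have h3 := hπ j a (fun k hk => by
      have : (Z.updateCol k Y).det = 0 := by
        by_contra hcon
        exact absurd (hmax k (mem_filter.2 ⟨mem_univ _, hcon⟩)) (not_le.2 hk)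
      simp [ha, this]) (T / ρ j) (by positivity) (by
      intro i hi
      simp only [Matrix.of_apply]
      rw [hU, abs_div, abs_of_pos (hw i), div_le_iff₀ (hw i)]
      refine (hb i).trans ?_
      have h4 := hρ _ _ hi
      have h5 := hρ0 (π i)
      have h6 := hw i
      calc w i / ρ (π i) * T = w i * T / ρ (π i) := by ring
        _ ≤ w i * T / ρ j := div_le_div_of_nonneg_left (by positivity) hρj h4
        _ = _ := by ring)
    have h7 : B j ≤ K * (((N : ℝ) + 1) ^ N * (T / ρ j)) := by
      refine hP Y j hj.2 _ (by positivity) fun i => ?_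
      have h8 := h3 i
      simp only [Matrix.of_apply] at h8
      rw [hU, abs_div, abs_of_pos (hw i), div_le_iff₀ (hw i)] at h8
      linarith
    calc ρ j * B j ≤ ρ j * (K * (((N : ℝ) + 1) ^ N * (T / ρ j))) := mul_le_mul_of_nonneg_left h7 hρj.le
      _ = _ := by field_simp

lemma det_bound (V : Matrix ι ι ℝ) {w B : ι → ℝ} (hw : ∀ i, 0 ≤ w i) (hB : ∀ j, 0 ≤ B j)
    (h : ∀ i j, |V i j| ≤ w i * B j) : |V.det| ≤ (Fintype.card ι).factorial * ((∏ i, w i) * ∏ j, B j) := by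
  rw [Matrix.det_apply]
  refine (abs_sum_le_sum_abs _ _).trans ?_
  have : ∀ σ ∈ (univ : Finset (Equiv.Perm ι)), |Equiv.Perm.sign σ • ∏ i, V (σ i) i| ≤ (∏ i, w i) * ∏ j, B j := by
    intro σ _
    have h1 : |Equiv.Perm.sign σ • ∏ i, V (σ i) i| = ∏ i, |V (σ i) i| := by
      rw [Units.smul_def, zsmul_eq_mul, abs_mul, Finset.abs_prod]
      rcases Int.units_eq_one_or (Equiv.Perm.sign σ) with h | h <;> rw [h] <;> simp
    rw [h1]
    calc ∏ i, |V (σ i) i| ≤ ∏ i, w (σ i) * B i := prod_le_prod (fun _ _ => abs_nonneg _) fun i _ => h _ _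
      _ = _ := by rw [prod_mul_distrib, Equiv.prod_comp σ w]
  refine (sum_le_card_nsmul _ _ _ this).trans (le_of_eq ?_)
  rw [card_univ, Fintype.card_perm, nsmul_eq_mul]

/-- product of sizes is bounded below -/
lemma prod_lower (M : Matrix ι ι ℝ) {w B : ι → ℝ} (hw : ∀ i, 0 ≤ w i) (hwp : ∏ i, w i = 1) (hB : ∀ j, 0 ≤ B j)
    (Z : Matrix ι ι ℤ) (hZ : Z.det ≠ 0) (h : ∀ j, Bd M w (B j) (fun k => Z k j)) :
    |M.det| ≤ (Fintype.card ι).factorial * ∏ j, B j := by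
  have h1 : ∀ i j, |(M * Z.map (Int.castRingHom ℝ)) i j| ≤ w i * B j := by
    intro i j
    simpa [Matrix.mul_apply] using h j i
  have h2 := det_bound _ hw hB h1
  rw [hwp, one_mul, Matrix.det_mul, abs_mul] at h2
  refine le_trans ?_ h2
  refine le_mul_of_one_le_right (abs_nonneg _) ?_
  have h3 : (Z.map (Int.castRingHom ℝ)).det = ((Z.det : ℤ) : ℝ) := by
    have := (RingHom.map_det (Int.castRingHom ℝ) Z).symm
    simpa using this
  rw [h3]
  have := Int.one_le_abs hZ
  exact_mod_cast this

/-- exchange property (P) -/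
lemma exchange (M : Matrix ι ι ℝ) (hM : M.det ≠ 0) {w B : ι → ℝ} (hw : ∀ i, 0 < w i) (hwp : ∏ i, w i = 1)
    (hB : ∀ j, 0 < B j) {C : ℝ} (hC : ∏ j, B j ≤ C)
    (Z : Matrix ι ι ℤ) (h : ∀ j, Bd M w (B j) (fun k => Z k j)) (Y : ι → ℤ) (j : ι)
    (hY : (Z.updateCol j Y).det ≠ 0) (T : ℝ) (hT : 0 ≤ T) (hb : Bd M w T Y) :
    B j ≤ ((Fintype.card ι).factorial * C / |M.det|) * T := by
  have h1 := prod_lower M (B := Function.update B j T) (fun i => (hw i).le) hwp (fun k => by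
    by_cases hk : k = j
    · subst hk; simpa using hT
    · simpa [hk] using (hB k).le) _ hY (fun k => by
    by_cases hk : k = j
    · subst hk; simpa using hb
    · have := h k
      simpa [hk, Matrix.updateCol_ne hk] using this)
  have h2 : (∏ k, Function.update B j T k) * B j = T * ∏ k, B k := by
    rw [prod_update_of_mem (mem_univ j), ← mul_prod_erase univ B (mem_univ j), sdiff_singleton_eq_erase]
    ring
  have hMp : 0 < |M.det| := abs_pos.2 hM
  rw [div_mul_eq_mul_div, le_div_iff₀ hMp]
  calc B j * |M.det| ≤ B j * ((Fintype.card ι).factorial * ∏ k, Function.update B j T k) :=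
        mul_le_mul_of_nonneg_left h1 (hB j).le
    _ = (Fintype.card ι).factorial * (T * ∏ k, B k) := by rw [← h2]; ring
    _ ≤ (Fintype.card ι).factorial * (T * C) := by gcongr
    _ = _ := by ring

end
end SchmidtPf

namespace SchmidtPf
open Finset
noncomputable section
set_option linter.unusedSectionVars false
set_option linter.style.haveILetI false

variable {ι : Type} [Fintype ι] [DecidableEq ι]

open MeasureTheory in
lemma mink1 [Nonempty ι] (M : Matrix ι ι ℝ) (hM : M.det ≠ 0) {w : ι → ℝ} (hw : ∀ i, 0 < w i) (hwp : ∏ i, w i = 1) :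
    ∃ Y : ι → ℤ, Y ≠ 0 ∧ Bd M w (1 + |M.det|) Y := by
  set T := 1 + |M.det| with hT
  have hMp : 0 < |M.det| := abs_pos.2 hM
  set f := Matrix.toLin' M with hf
  have hdet : LinearMap.det f = M.det := LinearMap.det_toLin' M
  set s : Set (ι → ℝ) := f ⁻¹' (Set.pi Set.univ fun i => Set.Ioo (-(w i * T)) (w i * T)) with hs
  have hvol : volume s = ENNReal.ofReal (|M.det|⁻¹ * (2 * T) ^ Fintype.card ι) := by
    rw [hs, Measure.addHaar_preimage_linearMap volume (by rw [hdet]; exact hM), Real.volume_pi_Ioo, hdet,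
      ← ENNReal.ofReal_prod_of_nonneg, ← ENNReal.ofReal_mul (abs_nonneg _), abs_inv]
    · congr 2
      have : ∀ i, w i * T - -(w i * T) = w i * (2 * T) := fun i => by ring
      simp only [this, prod_mul_distrib, hwp, one_mul, prod_const, card_univ, mul_pow]
    · intro i _
      have := hw i
      have : 0 < w i * T := by positivity
      linarith
  haveI : Countable (Submodule.span ℤ (Set.range (Pi.basisFun ℝ ι))).toAddSubgroup :=
    inferInstanceAs (Countable (Submodule.span ℤ (Set.range (Pi.basisFun ℝ ι))))
  have hfund := ZSpan.isAddFundamentalDomain' (Pi.basisFun ℝ ι) volume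
  obtain ⟨x, hx0, hx⟩ := exists_ne_zero_mem_lattice_of_measure_mul_two_pow_lt_measure (s := s) hfund
    (by
      intro x hx i hi
      have := hx i hi
      rw [map_neg]
      simp only [Pi.neg_apply, Set.mem_Ioo] at this ⊢
      constructor <;> linarith)
    ((convex_pi fun i _ => convex_Ioo _ _).linear_preimage f)
    (by
      rw [hvol, ZSpan.volume_fundamentalDomain]
      have h1 : (Matrix.of (Pi.basisFun ℝ ι)).det = 1 := by
        have : Matrix.of (Pi.basisFun ℝ ι) = (1 : Matrix ι ι ℝ) := by
          ext i j
          simp [Matrix.one_apply, Pi.single_apply, eq_comm]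
        rw [this, Matrix.det_one]
      rw [h1, abs_one, ENNReal.ofReal_one, one_mul, Module.finrank_fintype_fun_eq_card]
      have h2 : (2 : ENNReal) ^ Fintype.card ι = ENNReal.ofReal (2 ^ Fintype.card ι) := by
        rw [ENNReal.ofReal_pow (by norm_num)]; simp
      rw [h2, ENNReal.ofReal_lt_ofReal_iff (by positivity), mul_pow, inv_mul_eq_div, lt_div_iff₀ hMp]
      have h3 : |M.det| < T ^ Fintype.card ι := by
        have : T ≤ T ^ Fintype.card ι := le_self_pow₀ (by linarith) Fintype.card_ne_zero
        linarith
      have : (0:ℝ) < 2 ^ Fintype.card ι := by positivity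
      nlinarith)
  have hmem := ((Pi.basisFun ℝ ι).mem_span_iff_repr_mem ℤ (x : ι → ℝ)).1 x.2
  choose Y hY using hmem
  have hY' : ∀ k, (Y k : ℝ) = (x : ι → ℝ) k := fun k => by simpa using hY k
  refine ⟨Y, ?_, ?_⟩
  · rintro rfl
    apply hx0
    ext k
    rw [← hY' k]; simp
  · intro i
    have := hx i (Set.mem_univ _)
    simp only [hf, Matrix.toLin'_apply, Matrix.mulVec, dotProduct, Set.mem_Ioo] at this
    rw [abs_le]
    simp only [hY']
    exact ⟨this.1.le, this.2.le⟩

lemma exists_sort (B : ι → ℝ) : ∃ o : ι ≃ Fin (Fintype.card ι), ∀ k l, o k ≤ o l → B k ≤ B l := by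
  set e := Fintype.equivFin ι
  set σ := Tuple.sort (B ∘ e.symm)
  have hm := Tuple.monotone_sort (B ∘ e.symm)
  refine ⟨e.trans σ.symm, fun k l h => ?_⟩
  have := hm h
  simpa [σ] using this

/-- the weighted norm -/
def nw (M : Matrix ι ι ℝ) (w : ι → ℝ) (Y : ι → ℤ) : ℝ := ‖fun i => (∑ k, M i k * (Y k : ℝ)) / w i‖

lemma nw_nonneg (M : Matrix ι ι ℝ) (w : ι → ℝ) (Y : ι → ℤ) : 0 ≤ nw M w Y := norm_nonneg _

lemma nw_le_iff (M : Matrix ι ι ℝ) {w : ι → ℝ} (hw : ∀ i, 0 < w i) (Y : ι → ℤ) {T : ℝ} (hT : 0 ≤ T) :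
    nw M w Y ≤ T ↔ Bd M w T Y := by
  rw [nw, pi_norm_le_iff_of_nonneg hT]
  refine forall_congr' fun i => ?_
  rw [Real.norm_eq_abs, abs_div, abs_of_pos (hw i), div_le_iff₀ (hw i), mul_comm]

lemma nw_coord (M : Matrix ι ι ℝ) (hM : M.det ≠ 0) {w : ι → ℝ} (hw : ∀ i, 0 < w i) :
    ∃ C : ℝ, 0 < C ∧ ∀ (Y : ι → ℤ) (k : ι), |(Y k : ℝ)| ≤ C * nw M w Y := by
  refine ⟨1 + ∑ k, ∑ i, |M⁻¹ k i| * w i, ?_, ?_⟩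
  · have : 0 ≤ ∑ k, ∑ i, |M⁻¹ k i| * w i := sum_nonneg fun k _ => sum_nonneg fun i _ => mul_nonneg (abs_nonneg _) (hw i).le
    linarith
  · intro Y k
    have hb := (nw_le_iff M hw Y (nw_nonneg M w Y)).1 le_rfl
    have h1 : (Y k : ℝ) = ∑ i, M⁻¹ k i * ∑ l, M i l * (Y l : ℝ) := by
      have h2 : M⁻¹.mulVec (M.mulVec (fun l => (Y l : ℝ))) = fun l => (Y l : ℝ) := by
        rw [Matrix.mulVec_mulVec, Matrix.nonsing_inv_mul _ (Ne.isUnit hM), Matrix.one_mulVec]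
      exact (congrFun h2 k).symm
    rw [h1]
    have h3 : ∑ i, |M⁻¹ k i| * w i ≤ ∑ k, ∑ i, |M⁻¹ k i| * w i :=
      single_le_sum (f := fun k => ∑ i, |M⁻¹ k i| * w i) (fun k _ => sum_nonneg fun i _ => mul_nonneg (abs_nonneg _) (hw i).le) (mem_univ k)
    calc |∑ i, M⁻¹ k i * ∑ l, M i l * (Y l : ℝ)| ≤ ∑ i, |M⁻¹ k i * ∑ l, M i l * (Y l : ℝ)| := abs_sum_le_sum_abs _ _
      _ ≤ ∑ i, |M⁻¹ k i| * (w i * nw M w Y) := sum_le_sum fun i _ => by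
          rw [abs_mul]; exact mul_le_mul_of_nonneg_left (hb i) (abs_nonneg _)
      _ = (∑ i, |M⁻¹ k i| * w i) * nw M w Y := by rw [sum_mul]; exact sum_congr rfl fun i _ => by ring
      _ ≤ _ := mul_le_mul_of_nonneg_right (by linarith) (nw_nonneg _ _ _)

lemma exists_min_Z (M : Matrix ι ι ℝ) (hM : M.det ≠ 0) {w : ι → ℝ} (hw : ∀ i, 0 < w i) :
    ∃ Z : Matrix ι ι ℤ, Z.det ≠ 0 ∧ (∀ j, 0 < nw M w (fun k => Z k j)) ∧ ∀ (Y : ι → ℤ) (j : ι), (Z.updateCol j Y).det ≠ 0 →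
      nw M w (fun k => Z k j) ≤ nw M w Y := by
  obtain ⟨C, hC, hCY⟩ := nw_coord M hM hw
  have hlow : ∀ Y : ι → ℤ, Y ≠ 0 → C⁻¹ ≤ nw M w Y := by
    intro Y hY
    obtain ⟨k, hk⟩ := Function.ne_iff.1 hY
    have h1 : (1:ℝ) ≤ |(Y k : ℝ)| := by exact_mod_cast Int.one_le_abs hk
    rw [inv_le_iff_one_le_mul₀' hC]
    exact h1.trans (hCY Y k)
  have hcol : ∀ Z : Matrix ι ι ℤ, Z.det ≠ 0 → ∀ j, (fun k => Z k j) ≠ 0 := by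
    intro Z hZ j h
    exact hZ (Matrix.det_eq_zero_of_column_eq_zero j fun i => congrFun h i)
  set F : Matrix ι ι ℤ → ℝ := fun Z => ∏ j, nw M w (fun k => Z k j) with hF
  set S : Set (Matrix ι ι ℤ) := {Z | Z.det ≠ 0 ∧ F Z ≤ F 1} with hS
  have hF1 : 0 ≤ F 1 := prod_nonneg fun _ _ => nw_nonneg _ _ _
  have hfin : S.Finite := by
    set H := F 1 * C ^ (Fintype.card ι - 1) with hH
    have hH0 : 0 ≤ H := by positivity
    have hsub : S ⊆ {Z | ∀ k, Z k ∈ {z : ι → ℤ | ∀ j, z j ∈ Set.Icc (-⌈C * H⌉) ⌈C * H⌉}} := by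
      intro Z hZ k j
      have h1 : nw M w (fun k => Z k j) ≤ H := by
        have h2 : nw M w (fun k => Z k j) * C⁻¹ ^ (Fintype.card ι - 1) ≤ F 1 := by
          refine le_trans ?_ hZ.2
          rw [hF]
          simp only
          rw [← mul_prod_erase univ _ (mem_univ j)]
          refine mul_le_mul_of_nonneg_left ?_ (nw_nonneg _ _ _)
          calc C⁻¹ ^ (Fintype.card ι - 1) = ∏ _l ∈ univ.erase j, C⁻¹ := by
                rw [prod_const, card_erase_of_mem (mem_univ _), card_univ]
            _ ≤ _ := prod_le_prod (fun _ _ => by positivity) fun l _ => hlow _ (hcol Z hZ.1 l)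
        rw [inv_pow, mul_inv_le_iff₀ (by positivity)] at h2
        exact h2
      have h3 : |(Z k j : ℝ)| ≤ C * H := (hCY (fun k => Z k j) k).trans (mul_le_mul_of_nonneg_left h1 hC.le)
      have h4 := (abs_le.1 h3)
      have h5 := Int.le_ceil (C * H)
      constructor
      · have : (-(⌈C * H⌉ : ℝ)) ≤ Z k j := by linarith
        exact_mod_cast this
      · have : (Z k j : ℝ) ≤ ⌈C * H⌉ := by linarith
        exact_mod_cast this
    refine Set.Finite.subset ?_ hsub
    have hf1 : {z : ι → ℤ | ∀ j, z j ∈ Set.Icc (-⌈C * H⌉) ⌈C * H⌉}.Finite := Set.Finite.pi' fun j => Set.finite_Icc _ _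
    exact Set.Finite.pi' fun k => hf1
  obtain ⟨Z, hZ, hmin⟩ := Set.exists_min_image S F hfin ⟨1, by simp [hS]⟩
  have hpos : ∀ j, 0 < nw M w (fun k => Z k j) := fun j => (inv_pos.2 hC).trans_le (hlow _ (hcol Z hZ.1 j))
  refine ⟨Z, hZ.1, hpos, ?_⟩
  intro Y j hY
  by_contra hcon
  push Not at hcon
  have hlt : F (Z.updateCol j Y) < F Z := by
    rw [hF]
    simp only
    rw [← mul_prod_erase univ _ (mem_univ j), ← mul_prod_erase univ (fun j => nw M w (fun k => Z k j)) (mem_univ j)]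
    have h1 : ∏ x ∈ univ.erase j, nw M w (fun k => Z.updateCol j Y k x) = ∏ x ∈ univ.erase j, nw M w (fun k => Z k x) := by
      refine prod_congr rfl fun x hx => ?_
      have : x ≠ j := ne_of_mem_erase hx
      simp [Matrix.updateCol_ne this]
    rw [h1]
    refine mul_lt_mul_of_pos_right ?_ (prod_pos fun x _ => hpos x)
    simpa using hcon
  exact absurd (hmin _ ⟨hY, hlt.le.trans hZ.2⟩) (not_le.2 hlt)

/-- Minkowski's second theorem (upper bound), in the form we need. -/
theorem mink2 [Nonempty ι] (M : Matrix ι ι ℝ) (hM : M.det ≠ 0) : ∃ C : ℝ, 0 < C ∧ ∀ w : ι → ℝ, (∀ i, 0 < w i) → ∏ i, w i = 1 →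
    ∃ (Z : Matrix ι ι ℤ) (B : ι → ℝ), Z.det ≠ 0 ∧ (∀ j, 0 < B j) ∧ (∀ j, Bd M w (B j) (fun k => Z k j)) ∧ ∏ j, B j ≤ C := by
  set N := Fintype.card ι with hN
  have hN0 : N ≠ 0 := Fintype.card_ne_zero
  refine ⟨(((N : ℝ) + 1) ^ N * (1 + |M.det|)) ^ N, by positivity, fun w hw hwp => ?_⟩
  obtain ⟨Z, hZ, hpos, hmin⟩ := exists_min_Z M hM hw
  set B : ι → ℝ := fun j => nw M w (fun k => Z k j) with hB
  refine ⟨Z, B, hZ, hpos, fun j => (nw_le_iff M hw _ (hpos j).le).1 le_rfl, ?_⟩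
  have hBp : 0 < ∏ j, B j := prod_pos fun j _ => hpos j
  set μ := (∏ j, B j) ^ ((N : ℝ)⁻¹) with hμ
  have hμ0 : 0 < μ := Real.rpow_pos_of_pos hBp _
  have hμN : μ ^ N = ∏ j, B j := Real.rpow_inv_natCast_pow hBp.le hN0
  obtain ⟨o, ho⟩ := exists_sort B
  obtain ⟨π, hπ⟩ := flatten M hw Z hZ (B := B) (K := 1) zero_le_one (fun Y j hY T hT hb => by
    rw [one_mul]
    exact (hmin Y j hY).trans ((nw_le_iff M hw _ hT).2 hb)) o (ρ := fun j => μ / B j)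
    (fun j => div_pos hμ0 (hpos j)) (fun k l hkl => div_le_div_of_nonneg_left hμ0.le (hpos k) (ho k l hkl))
  have hw' : ∀ i, 0 < w i / (μ / B (π i)) := fun i => div_pos (hw i) (div_pos hμ0 (hpos _))
  obtain ⟨Y, hY0, hY⟩ := mink1 M hM hw' (by
    rw [prod_div_distrib, hwp, prod_div_distrib, Equiv.prod_comp π B, prod_const, card_univ, ← hN, hμN]
    rw [div_self hBp.ne', div_one])
  obtain ⟨j, -, -, hj⟩ := hπ Y hY0
  have h1 := hj _ (by positivity) hY
  rw [div_mul_cancel₀ _ (hpos j).ne', one_mul] at h1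
  rw [← hμN]
  exact pow_le_pow_left₀ hμ0.le h1 N

end
end SchmidtPf

namespace SchmidtPf
open Finset
noncomputable section
set_option linter.unusedSectionVars false
set_option linter.unusedVariables false
set_option linter.style.haveILetI false

variable {ι : Type} [Fintype ι] [DecidableEq ι]

lemma updateCol_det_eq (Z : Matrix ι ι ℤ) (Y : ι → ℤ) (j : ι) :
    (Z.updateCol j Y).det = ∑ l, Z.adjugate j l * Y l := by
  rw [← Matrix.cramer_apply, Matrix.cramer_eq_adjugate_mulVec]; rfl

lemma adj_row_ne (Z : Matrix ι ι ℤ) (hZ : Z.det ≠ 0) (j : ι) : Z.adjugate j ≠ 0 := by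
  intro h
  have := congrFun (congrFun (Matrix.adjugate_mul Z) j) j
  rw [Matrix.mul_apply] at this
  simp [h] at this
  exact hZ this.symm

lemma adj_row_perp (Z : Matrix ι ι ℤ) (j k : ι) (h : k ≠ j) : ∑ l, Z.adjugate j l * Z l k = 0 := by
  have := congrFun (congrFun (Matrix.adjugate_mul Z) j) k
  rw [Matrix.mul_apply] at this
  rw [this]
  simp [Matrix.one_apply_ne' h]

lemma adj_bound (V : Matrix ι ι ℝ) {w B : ι → ℝ} (hw : ∀ i, 0 < w i) (hwp : ∏ i, w i = 1) (hB : ∀ j, 0 < B j)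
    (h : ∀ i j, |V i j| ≤ w i * B j) (i j : ι) :
    |V.adjugate j i| ≤ (Fintype.card ι).factorial * (∏ j, B j) / (w i * B j) := by
  rw [Matrix.adjugate_apply]
  have h1 := det_bound (V.updateRow i (Pi.single j 1)) (w := Function.update w i (B j)⁻¹) (B := B)
    (by
      intro l
      by_cases hl : l = i
      · subst hl; simpa using (hB j).le
      · simpa [hl] using (hw l).le)
    (fun j => (hB j).le)
    (by
      intro l k
      by_cases hl : l = i
      · subst hl
        simp only [Matrix.updateRow_self, Function.update_self]
        by_cases hk : k = j
        · subst hk; simp [(hB k).ne']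
        · simp only [ne_eq, hk, not_false_eq_true, Pi.single_eq_of_ne, abs_zero]
          exact mul_nonneg (inv_nonneg.2 (hB j).le) (hB k).le
      · simpa [hl] using h l k)
  refine h1.trans (le_of_eq ?_)
  have h2 : ∏ l, Function.update w i (B j)⁻¹ l = (B j)⁻¹ / w i := by
    rw [prod_update_of_mem (mem_univ i), eq_div_iff (hw i).ne', mul_assoc]
    have := mul_prod_erase univ w (mem_univ i)
    rw [hwp] at this
    rw [sdiff_singleton_eq_erase, mul_comm _ (w i), this, mul_one]
  rw [h2]
  have := (hw i).ne'
  have := (hB j).ne'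
  field_simp

lemma aux_pow1 (r g K : ℝ) (hK : K ≠ 0) (N : ℕ) (hN : 2 ≤ N) :
    (r * g / K) * (r / K) ^ (N - 2) = r ^ (N - 1) * g / K ^ (N - 1) := by
  obtain ⟨n, rfl⟩ : ∃ n, N = n + 2 := ⟨N - 2, by omega⟩
  simp only [Nat.add_sub_cancel, show n + 2 - 1 = n + 1 by omega]
  rw [div_pow, pow_succ, pow_succ]
  field_simp

lemma aux_pow2 (r g : ℝ) (N : ℕ) (hN : 2 ≤ N) : r * (r ^ (N - 1) * g) = r ^ N * g := by
  obtain ⟨n, rfl⟩ : ∃ n, N = n + 1 := ⟨N - 1, by omega⟩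
  simp only [Nat.add_sub_cancel]
  ring

set_option maxHeartbeats 1000000 in
/-- single step: from a gap to a configuration with all but one vectors very small. -/
lemma gap_step [Nontrivial ι] (E M : Matrix ι ι ℝ) (hEM : E * M = 1) {C : ℝ} (hC : 0 < C) :
    ∃ C1 : ℝ, 1 ≤ C1 ∧ ∀ (w : ι → ℝ) (Z : Matrix ι ι ℤ) (B : ι → ℝ) (j0 : ι) (g L : ℝ), (∀ i, 0 < w i) → ∏ i, w i = 1 →
      Z.det ≠ 0 → (∀ j, 0 < B j) → (∀ j, Bd M w (B j) (fun k => Z k j)) → ∏ j, B j ≤ C → C1 < g →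
      (∀ j, j ≠ j0 → g * B j ≤ B j0) → (∀ i, |Real.log (w i)| ≤ L) → (∀ j, |Real.log (B j)| ≤ L) →
      ∃ (w' : ι → ℝ) (Z' : Matrix ι ι ℤ) (j1 : ι) (r : ℝ) (u : ι → ℤ), (∀ i, 0 < w' i) ∧ ∏ i, w' i = 1 ∧
        (∀ i, |Real.log (w' i)| ≤ 3 * L) ∧ Z'.det ≠ 0 ∧ 0 < r ∧ (∀ j, j ≠ j1 → Bd M w' (C1 * r) (fun k => Z' k j)) ∧
        r ^ Fintype.card ι * g ≤ C1 ∧ u ≠ 0 ∧ (∀ j, j ≠ j1 → ∑ l, u l * Z' l j = 0) ∧ (∀ j, j ≠ j0 → ∑ l, u l * Z l j = 0) ∧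
        ∀ i, |∑ k, (u k : ℝ) * E k i| ≤ C1 / w' i := by
  have hdet : E.det * M.det = 1 := by rw [← Matrix.det_mul, hEM, Matrix.det_one]
  have hM : M.det ≠ 0 := right_ne_zero_of_mul (hdet ▸ one_ne_zero)
  have hMp : 0 < |M.det| := abs_pos.2 hM
  set N := Fintype.card ι with hN
  have hN2 : 2 ≤ N := Fintype.one_lt_card
  obtain ⟨C2, hC2, hmk⟩ := mink2 M hM
  set f : ℝ := (N.factorial : ℝ) with hf
  have hf0 : 0 < f := by positivity
  set K := f * C / |M.det| * ((N:ℝ)+1)^N with hK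
  have hK0 : 0 < K := by positivity
  set c0 := |M.det| / f with hc0
  have hc00 : 0 < c0 := by positivity
  set C3 := C2 * K ^ (N - 1) / c0 with hC3
  have hC30 : 0 < C3 := by positivity
  set C4 := f * C2 * K / c0 / |M.det| with hC4
  have hC40 : 0 < C4 := by positivity
  refine ⟨1 + C + K * C3 + C3 + C4, by nlinarith [mul_pos hK0 hC30], ?_⟩
  intro w Z B j0 g L hw hwp hZ hB hBd hBC hg hgap hLw hLB
  have hKC := mul_pos hK0 hC30
  have hg1 : 1 < g := by linarith
  -- sorting
  obtain ⟨o, ho⟩ := exists_sort B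
  have hlt : ∀ j, j ≠ j0 → B j < B j0 := fun j hj => by
    have := hgap j hj
    have := hB j
    nlinarith
  obtain ⟨p, hp, hpmax⟩ := exists_max_image (univ.erase j0) B (by
    obtain ⟨a, ha⟩ := exists_ne j0
    exact ⟨a, by simp [ha]⟩)
  have hpj : p ≠ j0 := ne_of_mem_erase hp
  set B1 := Function.update B j0 (B p) with hB1
  have hB1j : ∀ j, j ≠ j0 → B1 j = B j := fun j hj => by simp [hB1, hj]
  have hB10 : B1 j0 = B p := by simp [hB1]
  have hB1p : ∀ j, 0 < B1 j := fun j => by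
    by_cases h : j = j0
    · rw [h, hB10]; exact hB p
    · rw [hB1j j h]; exact hB j
  have hB1L : ∀ j, |Real.log (B1 j)| ≤ L := fun j => by
    by_cases h : j = j0
    · rw [h, hB10]; exact hLB p
    · rw [hB1j j h]; exact hLB j
  have hB1o : ∀ k l, o k ≤ o l → B1 k ≤ B1 l := by
    intro k l h
    have h1 := ho k l h
    by_cases hk : k = j0
    · by_cases hl : l = j0
      · rw [hk, hl]
      · subst hk; exact absurd h1 (not_le.2 (hlt l hl))
    · by_cases hl : l = j0
      · rw [hl, hB10, hB1j k hk]
        exact hpmax k (by simp [hk])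
      · rw [hB1j k hk, hB1j l hl]; exact h1
  have hBp : 0 < ∏ j, B j := prod_pos fun j _ => hB j
  have hB1pp : 0 < ∏ j, B1 j := prod_pos fun j _ => hB1p j
  set r := (∏ j, B1 j) ^ ((N:ℝ)⁻¹) with hr
  have hr0 : 0 < r := Real.rpow_pos_of_pos hB1pp _
  have hrN : r ^ N = ∏ j, B1 j := Real.rpow_inv_natCast_pow hB1pp.le (by omega)
  set g' := B j0 / B p with hg'
  have hgg' : g ≤ g' := by
    rw [hg', le_div_iff₀ (hB p)]; exact hgap p hpj
  have hprod : r ^ N * g' = ∏ j, B j := by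
    rw [hrN, hB1, prod_update_of_mem (mem_univ j0), sdiff_singleton_eq_erase, ← mul_prod_erase univ B (mem_univ j0), hg']
    have := (hB p).ne'
    field_simp
  have hlow : c0 ≤ r ^ N * g' := by
    rw [hprod, hc0, div_le_iff₀' hf0]
    exact prod_lower M (fun i => (hw i).le) hwp (fun j => (hB j).le) Z hZ hBd
  have hrg : r ^ N * g ≤ C := by
    have : r ^ N * g ≤ r ^ N * g' := mul_le_mul_of_nonneg_left hgg' (by positivity)
    linarith
  have hr1 : r ≤ 1 := by
    by_contra h
    push Not at h
    have : 1 ≤ r ^ N := one_le_pow₀ h.le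
    nlinarith
  have hLr : |Real.log r| ≤ L := by
    rw [hr, Real.log_rpow hB1pp, Real.log_prod (fun j _ => (hB1p j).ne'), abs_mul, abs_of_nonneg (by positivity), inv_mul_le_iff₀ (by positivity)]
    refine (abs_sum_le_sum_abs _ _).trans ?_
    refine (sum_le_sum fun j _ => hB1L j).trans (le_of_eq ?_)
    rw [sum_const, card_univ, nsmul_eq_mul]
  obtain ⟨π, hπ⟩ := flatten M hw Z hZ (B := B) (K := f * C / |M.det|) (by positivity)
    (fun Y j hY T hT hb => exchange M hM hw hwp hB hBC Z hBd Y j hY T hT hb) o (ρ := fun j => r / B1 j)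
    (fun j => div_pos hr0 (hB1p j)) (fun k l hkl => div_le_div_of_nonneg_left hr0.le (hB1p k) (hB1o k l hkl))
  set w' : ι → ℝ := fun i => w i / (r / B1 (π i)) with hw'
  have hw'0 : ∀ i, 0 < w' i := fun i => div_pos (hw i) (div_pos hr0 (hB1p _))
  have hw'p : ∏ i, w' i = 1 := by
    rw [hw', prod_div_distrib, hwp, prod_div_distrib, Equiv.prod_comp π B1, prod_const, card_univ, ← hN, hrN,
      div_self hB1pp.ne', div_one]
  have hw'L : ∀ i, |Real.log (w' i)| ≤ 3 * L := fun i => by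
    rw [hw']
    simp only
    rw [Real.log_div (hw i).ne' (div_pos hr0 (hB1p _)).ne', Real.log_div hr0.ne' (hB1p _).ne']
    have h1 := abs_le.1 (hLw i)
    have h2 := abs_le.1 hLr
    have h3 := abs_le.1 (hB1L (π i))
    rw [abs_le]
    constructor <;> linarith [h1.1, h1.2, h2.1, h2.2, h3.1, h3.2]
  obtain ⟨Z', B', hZ', hB', hBd', hBC'⟩ := hmk w' hw'0 hw'p
  have hcol : ∀ j, (fun k => Z' k j) ≠ 0 := fun j h => hZ' (Matrix.det_eq_zero_of_column_eq_zero j fun i => congrFun h i)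
  have hall : ∀ j, r ≤ K * B' j := by
    intro j
    obtain ⟨k, -, -, hk⟩ := hπ _ (hcol j)
    refine le_trans ?_ (hk (B' j) (hB' j).le (hBd' j))
    rw [div_mul_eq_mul_div, le_div_iff₀ (hB1p k)]
    refine mul_le_mul_of_nonneg_left ?_ hr0.le
    by_cases h : k = j0
    · rw [h, hB10]; exact (hlt p hpj).le
    · rw [hB1j k h]
  have hout : ∀ j, (Z.updateCol j0 (fun k => Z' k j)).det ≠ 0 → r * g' ≤ K * B' j := by
    intro j hj
    obtain ⟨k, hk1, hk2, hk⟩ := hπ _ (hcol j)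
    have hkj : k = j0 := by
      by_contra hne
      have : ¬ o k < o j0 := fun h => hj (hk2 j0 h)
      exact absurd (ho j0 k (not_lt.1 this)) (not_le.2 (hlt k hne))
    subst hkj
    have := hk (B' j) (hB' j).le (hBd' j)
    rw [hB10] at this
    rw [hg']
    refine le_trans (le_of_eq ?_) this
    have := (hB p).ne'
    field_simp
  -- the outside index
  have hex : ∃ j1, (Z.updateCol j0 (fun k => Z' k j1)).det ≠ 0 := by
    by_contra hcon
    push Not at hcon
    have h1 : Matrix.vecMul (Z.adjugate j0) Z' = 0 := by
      ext j
      have := hcon j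
      rw [updateCol_det_eq] at this
      exact this
    exact adj_row_ne Z hZ j0 (Matrix.eq_zero_of_vecMul_eq_zero hZ' h1)
  obtain ⟨j1, hj1⟩ := hex
  have hb1 := hout j1 hj1
  have hg'0 : 0 < g' := by linarith
  have hin : ∀ j, j ≠ j1 → B' j ≤ C3 * r := by
    intro j hj
    have h1 : B' j * (B' j1 * ∏ l ∈ (univ.erase j).erase j1, B' l) ≤ C2 := by
      rw [mul_prod_erase _ _ (by simp [hj.symm]), mul_prod_erase _ _ (mem_univ _)]
      exact hBC'
    have h2 : (r / K) ^ (N - 2) ≤ ∏ l ∈ (univ.erase j).erase j1, B' l := by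
      calc (r / K) ^ (N - 2) = ∏ l ∈ (univ.erase j).erase j1, (r / K) := by
            rw [prod_const, card_erase_of_mem (by simp [hj.symm]), card_erase_of_mem (mem_univ _), card_univ]; rfl
        _ ≤ _ := prod_le_prod (fun _ _ => by positivity) fun l _ => by
            rw [div_le_iff₀ hK0, mul_comm]; exact hall l
    have h3 : r * g' / K ≤ B' j1 := by rw [div_le_iff₀' hK0]; exact hb1
    have h4 : B' j * ((r * g' / K) * (r / K) ^ (N - 2)) ≤ C2 := by
      refine le_trans (mul_le_mul_of_nonneg_left (mul_le_mul h3 h2 (by positivity) (hB' j1).le) (hB' j).le) h1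
    have h5 : (r * g' / K) * (r / K) ^ (N - 2) = r ^ (N - 1) * g' / K ^ (N - 1) := by
      exact aux_pow1 r g' K hK0.ne' N hN2
    have h6 : r * (r ^ (N - 1) * g') = r ^ N * g' := by
      exact aux_pow2 r g' N hN2
    rw [h5, mul_div_assoc', div_le_iff₀ (by positivity)] at h4
    rw [hC3, div_mul_eq_mul_div, le_div_iff₀ hc00]
    calc B' j * c0 ≤ B' j * (r ^ N * g') := mul_le_mul_of_nonneg_left hlow (hB' j).le
      _ = (B' j * (r ^ (N - 1) * g')) * r := by rw [← h6]; ring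
      _ ≤ _ := mul_le_mul_of_nonneg_right h4 hr0.le
  have hinside : ∀ j, j ≠ j1 → (Z.updateCol j0 (fun k => Z' k j)).det = 0 := by
    intro j hj
    by_contra hne
    have h1 := hout j hne
    have h2 : K * B' j ≤ K * (C3 * r) := mul_le_mul_of_nonneg_left (hin j hj) hK0.le
    have h3 : g' * r ≤ (K * C3) * r := by linarith
    have := le_of_mul_le_mul_right h3 hr0
    linarith
  have hpar := parallel Z' j1 (Z'.adjugate j1) (Z.adjugate j0) (fun j hj => adj_row_perp Z' j1 j hj)
    (fun j hj => by have := hinside j hj; rwa [updateCol_det_eq] at this) (adj_row_ne Z hZ j0)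
    (fun x _ hx => Matrix.eq_zero_of_mulVec_eq_zero hZ' hx)
  refine ⟨w', Z', j1, r, Z'.adjugate j1, hw'0, hw'p, hw'L, hZ', hr0, ?_, by linarith, adj_row_ne Z' hZ' j1,
    fun j hj => adj_row_perp Z' j1 j hj, ?_, ?_⟩
  · intro j hj i
    refine (hBd' j i).trans (mul_le_mul_of_nonneg_left ?_ (hw'0 i).le)
    exact (hin j hj).trans (mul_le_mul_of_nonneg_right (by linarith) hr0.le)
  · intro j hj
    obtain ⟨i, hi⟩ := Function.ne_iff.1 (adj_row_ne Z hZ j0)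
    have h1 : (∑ l, Z'.adjugate j1 l * Z l j) * Z.adjugate j0 i = Z'.adjugate j1 i * ∑ l, Z.adjugate j0 l * Z l j := by
      rw [sum_mul, mul_sum]
      refine sum_congr rfl fun l _ => ?_
      have := hpar l i
      calc _ = (Z'.adjugate j1 l * Z.adjugate j0 i) * Z l j := by ring
        _ = _ := by rw [this]; ring
    rw [adj_row_perp Z j0 j hj, mul_zero] at h1
    exact (mul_eq_zero.1 h1).resolve_right hi
  · intro i
    have hV : ∀ i j, |(M * Z'.map (Int.castRingHom ℝ)) i j| ≤ w' i * B' j := by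
      intro i j
      have := hBd' j i
      simpa [Matrix.mul_apply] using this
    have h1 := adj_bound _ hw'0 hw'p hB' hV i j1
    have hadjM : M.adjugate = M.det • E := by
      have h2 : M * E = 1 := mul_eq_one_comm.1 hEM
      calc M.adjugate = M.adjugate * (M * E) := by rw [h2, mul_one]
        _ = _ := by rw [← mul_assoc, Matrix.adjugate_mul, Matrix.smul_mul, one_mul]
    have h2 : (M * Z'.map (Int.castRingHom ℝ)).adjugate j1 i = M.det * ∑ k, (Z'.adjugate j1 k : ℝ) * E k i := by
      rw [Matrix.adjugate_mul_distrib, hadjM, Matrix.mul_smul, Matrix.smul_apply, smul_eq_mul, Matrix.mul_apply]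
      congr 1
      refine sum_congr rfl fun k _ => ?_
      congr 1
      have := RingHom.map_adjugate (Int.castRingHom ℝ) Z'
      simp only [RingHom.mapMatrix_apply] at this
      rw [← this]
      simp
    rw [h2, abs_mul] at h1
    have h3 : c0 ≤ K * B' j1 := by
      have : r ^ N ≤ r := pow_le_of_le_one hr0.le hr1 (by omega)
      have := mul_le_mul_of_nonneg_right this hg'0.le
      linarith
    have h4 : f * (∏ j, B' j) / (w' i * B' j1) ≤ |M.det| * (C4 / w' i) := by
      have hwi := hw'0 i
      have hbi := hB' j1
      rw [hC4, div_le_iff₀ (by positivity)]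
      have : |M.det| * (f * C2 * K / c0 / |M.det| / w' i) * (w' i * B' j1) = f * C2 * ((K * B' j1) / c0) := by
        field_simp
      rw [this]
      have h5 : 1 ≤ K * B' j1 / c0 := by rw [one_le_div hc00]; exact h3
      have h6 : f * (∏ j, B' j) ≤ f * C2 := mul_le_mul_of_nonneg_left hBC' hf0.le
      nlinarith [mul_pos hf0 hC2]
    have h5 := le_of_mul_le_mul_left (h1.trans h4) hMp
    refine h5.trans (div_le_div_of_nonneg_right (by linarith) (hw'0 i).le)

end
end SchmidtPf

namespace SchmidtPf
open Finset Filter Topology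
noncomputable section
set_option linter.unusedSectionVars false
set_option linter.unusedVariables false
set_option linter.style.haveILetI false

variable {ι : Type} [Fintype ι] [DecidableEq ι]

lemma gapT [Nontrivial ι] {A : Type} [CommRing A] [IsDomain A] [Module.Free ℤ A] [Module.Finite ℤ A] (ψ : A →+* ℝ)
    (E : Matrix ι ι A) (M : Matrix ι ι ℝ) (hEM : E.map ψ * M = 1) {C : ℝ} (hC : 0 < C) {δ A' : ℝ} (hδ : 0 < δ)
    {ℓ : ℕ → ℝ} (hℓ : Tendsto ℓ atTop atTop) (w : ℕ → ι → ℝ) (hw : ∀ t i, 0 < w t i) (hwp : ∀ t, ∏ i, w t i = 1)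
    (Z : ℕ → Matrix ι ι ℤ) (hZ : ∀ t, (Z t).det ≠ 0) (B : ℕ → ι → ℝ) (hB : ∀ t j, 0 < B t j)
    (hBd : ∀ t j, Bd M (w t) (B t j) (fun k => Z t k j)) (hBC : ∀ t, ∏ j, B t j ≤ C) (j0 : ι)
    (hgap : ∀ t j, j ≠ j0 → Real.exp (δ * ℓ t) * B t j ≤ B t j0) (hLw : ∀ t i, |Real.log (w t i)| ≤ A' * ℓ t)
    (hLB : ∀ t j, |Real.log (B t j)| ≤ A' * ℓ t) :
    ∃ v0 : ι → ℤ, v0 ≠ 0 ∧ ∃ᶠ t in atTop, ∀ j, j ≠ j0 → ∑ l, v0 l * Z t l j = 0 := by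
  obtain ⟨C1, hC1, hstep⟩ := gap_step (E.map ψ) M hEM hC
  have hC1p : 0 < C1 := by linarith
  set N := Fintype.card ι with hN
  have hN0 : (0:ℝ) < N := by
    have : 0 < N := Fintype.card_pos
    exact_mod_cast this
  have hev : ∀ᶠ t in atTop, C1 < Real.exp (δ * ℓ t) ∧ 0 < ℓ t := by
    have h1 : Tendsto (fun t => Real.exp (δ * ℓ t)) atTop atTop := Real.tendsto_exp_atTop.comp (hℓ.const_mul_atTop hδ)
    exact (h1.eventually_gt_atTop C1).and (hℓ.eventually_gt_atTop 0)
  obtain ⟨T0, hT0⟩ := eventually_atTop.1 hev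
  have hall : ∀ t, ∃ (w' : ι → ℝ) (Z' : Matrix ι ι ℤ) (j1 : ι) (r : ℝ) (u : ι → ℤ), (∀ i, 0 < w' i) ∧ ∏ i, w' i = 1 ∧
        (∀ i, |Real.log (w' i)| ≤ 3 * (A' * ℓ (t + T0))) ∧ Z'.det ≠ 0 ∧ 0 < r ∧ (∀ j, j ≠ j1 → Bd M w' (C1 * r) (fun k => Z' k j)) ∧
        r ^ Fintype.card ι * Real.exp (δ * ℓ (t + T0)) ≤ C1 ∧ u ≠ 0 ∧ (∀ j, j ≠ j1 → ∑ l, u l * Z' l j = 0) ∧ (∀ j, j ≠ j0 → ∑ l, u l * Z (t + T0) l j = 0) ∧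
        ∀ i, |∑ k, (u k : ℝ) * E.map ψ k i| ≤ C1 / w' i := fun t =>
    hstep (w (t + T0)) (Z _) (B _) j0 _ _ (hw _) (hwp _) (hZ _) (hB _) (hBd _) (hBC _) (hT0 _ (by omega)).1 (hgap _) (hLw _) (hLB _)
  choose w' Z' j1 r u hw' hwp' hLw' hZ' hr hBd' hrg hu0 huZ' huZ hub using hall
  have hℓ0 : ∀ t, 0 < ℓ (t + T0) := fun t => (hT0 _ (by omega)).2
  have hℓ1 : Tendsto (fun t => ℓ (t + T0)) atTop atTop := hℓ.comp (tendsto_add_atTop_nat T0)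
  -- fix `j1`
  obtain ⟨j2, hj2⟩ := Finite.exists_infinite_fiber j1
  obtain ⟨φ1, hφ1, hφj⟩ := extraction_of_frequently_atTop (P := fun t => j1 t = j2)
    (Nat.frequently_atTop_iff_infinite.2 (Set.infinite_coe_iff.1 hj2))
  -- converge
  obtain ⟨b, -, φ2, hφ2, hlim⟩ := tendsto_subseq_of_bounded (s := Metric.closedBall (0 : ι → ℝ) (3 * |A'|)) Metric.isBounded_closedBall
    (x := fun t => fun i => Real.log (w' (φ1 t) i) / ℓ (φ1 t + T0)) (by
      intro t
      rw [mem_closedBall_zero_iff, pi_norm_le_iff_of_nonneg (by positivity)]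
      intro i
      rw [Real.norm_eq_abs, abs_div, abs_of_pos (hℓ0 _), div_le_iff₀ (hℓ0 _)]
      refine (hLw' _ i).trans ?_
      have := mul_le_mul_of_nonneg_right (le_abs_self A') (hℓ0 (φ1 t)).le
      linarith)
  set φ := φ1 ∘ φ2 with hφ
  have hφm : StrictMono φ := hφ1.comp hφ2
  have hlimi : ∀ i, Tendsto (fun t => Real.log (w' (φ t) i) / ℓ (φ t + T0)) atTop (𝓝 (b i)) := fun i =>
    (tendsto_pi_nhds.1 hlim i)
  have hb0 : ∑ i, b i = 0 := by
    have h1 := tendsto_finsetSum univ fun i _ => hlimi i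
    have h2 : (fun t => ∑ i, Real.log (w' (φ t) i) / ℓ (φ t + T0)) = fun _ => 0 := by
      funext t
      rw [← sum_div, ← Real.log_prod (fun i _ => (hw' _ i).ne'), hwp', Real.log_one, zero_div]
    rw [h2] at h1
    exact tendsto_nhds_unique h1 tendsto_const_nhds
  set δ' := δ / (4 * N) with hδ'
  have hδ'0 : 0 < δ' := by positivity
  have hℓφ : Tendsto (fun t => ℓ (φ t + T0)) atTop atTop := hℓ1.comp hφm.tendsto_atTop
  have hev2 : ∀ᶠ t in atTop, (∀ i, |Real.log (w' (φ t) i) / ℓ (φ t + T0) - b i| < δ' / 8) ∧ 16 * Real.log C1 / δ' ≤ ℓ (φ t + T0) := by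
    refine (eventually_all.2 fun i => ?_).and (hℓφ.eventually_ge_atTop _)
    have := Metric.tendsto_nhds.1 (hlimi i) (δ' / 8) (by positivity)
    simpa [Real.dist_eq] using this
  obtain ⟨T1, hT1⟩ := eventually_atTop.1 hev2
  have hlogC : 0 ≤ Real.log C1 := Real.log_nonneg hC1
  have hkey : ∀ t i, |Real.log (w' (φ (t + T1)) i) - b i * ℓ (φ (t + T1) + T0)| ≤ δ' / 8 * ℓ (φ (t + T1) + T0) := by
    intro t i
    have h1 := (hT1 (t + T1) (by omega)).1 i
    have h2 := hℓ0 (φ (t + T1))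
    have h3 : Real.log (w' (φ (t + T1)) i) - b i * ℓ (φ (t + T1) + T0) =
      (Real.log (w' (φ (t + T1)) i) / ℓ (φ (t + T1) + T0) - b i) * ℓ (φ (t + T1) + T0) := by
      field_simp
    rw [h3, abs_mul, abs_of_pos h2]
    exact mul_le_mul_of_nonneg_right h1.le h2.le
  have hkey2 : ∀ t, Real.log C1 ≤ δ' / 16 * ℓ (φ (t + T1) + T0) := by
    intro t
    have h1 := (hT1 (t + T1) (by omega)).2
    rw [div_le_iff₀ hδ'0] at h1
    linarith
  obtain ⟨u0, hu00, hfr⟩ : ∃ u0 : ι → ℤ, u0 ≠ 0 ∧ ∃ᶠ t in atTop, ∀ i l, u0 i * u (φ (t + T1)) l = u0 l * u (φ (t + T1)) i := by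
    refine pt ψ E M hEM j2 hb0 hδ'0 (ℓ := fun t => ℓ (φ (t + T1) + T0)) (hℓφ.comp (tendsto_add_atTop_nat T1))
      (fun t => u (φ (t + T1))) (fun t => hu0 _) (fun t => Z' (φ (t + T1))) ?_ ?_ ?_ ?_
    · intro t i
      have h1 := hub (φ (t + T1)) i
      have h2 : ψ (∑ k, (u (φ (t + T1)) k : A) * E k i) = ∑ k, (u (φ (t + T1)) k : ℝ) * E.map ψ k i := by
        simp
      rw [h2]
      refine h1.trans ?_
      rw [← Real.log_le_log_iff (div_pos hC1p (hw' _ _)) (Real.exp_pos _), Real.log_exp, Real.log_div hC1p.ne' (hw' _ _).ne']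
      have h3 := abs_le.1 (hkey t i)
      have h4 := hkey2 t
      have h5 := mul_pos hδ'0 (hℓ0 (φ (t + T1)))
      nlinarith [h3.1]
    · intro t j hj
      exact huZ' _ j (by rw [hφ]; simp only [Function.comp]; rw [hφj]; exact hj)
    · intro t i j hj
      have h1 := hBd' (φ (t + T1)) j (by rw [hφ]; simp only [Function.comp]; rw [hφj]; exact hj) i
      have h2 : (M * (Z' (φ (t + T1))).map (Int.castRingHom ℝ)) i j = ∑ k, M i k * (Z' (φ (t + T1)) k j : ℝ) := by
        simp [Matrix.mul_apply]
      rw [h2]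
      refine h1.trans ?_
      have hr0 := hr (φ (t + T1))
      rw [← Real.log_le_log_iff (mul_pos (hw' _ _) (mul_pos hC1p hr0)) (Real.exp_pos _), Real.log_exp,
        Real.log_mul (hw' _ _).ne' (mul_pos hC1p hr0).ne', Real.log_mul hC1p.ne' hr0.ne']
      have h3 := abs_le.1 (hkey t i)
      have h4 := hkey2 t
      have h5 := mul_pos hδ'0 (hℓ0 (φ (t + T1)))
      have h6 := Real.log_le_log (mul_pos (pow_pos hr0 _) (Real.exp_pos _)) (hrg (φ (t + T1)))
      rw [Real.log_mul (pow_pos hr0 _).ne' (Real.exp_pos _).ne', Real.log_pow, Real.log_exp, ← hN] at h6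
      have h7 : δ = 4 * N * δ' := by rw [hδ']; field_simp
      have hN1 : (1:ℝ) ≤ N := by
        have : 0 < N := Fintype.card_pos
        exact_mod_cast this
      have h8 : Real.log (r (φ (t + T1))) ≤ Real.log C1 - 4 * δ' * ℓ (φ (t + T1) + T0) := by
        have h9 : N * Real.log (r (φ (t + T1))) ≤ N * (Real.log C1 - 4 * δ' * ℓ (φ (t + T1) + T0)) := by
          rw [h7] at h6
          have := mul_le_mul_of_nonneg_right hN1 hlogC
          linarith
        exact le_of_mul_le_mul_left h9 hN0
      nlinarith [h3.2]
    · intro t x _ hx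
      exact Matrix.eq_zero_of_mulVec_eq_zero (hZ' _) hx
  refine ⟨u0, hu00, ?_⟩
  have htend : Tendsto (fun t => φ (t + T1) + T0) atTop atTop :=
    (tendsto_add_atTop_nat T0).comp (hφm.tendsto_atTop.comp (tendsto_add_atTop_nat T1))
  refine htend.frequently (hfr.mono fun t ht j hj => ?_)
  obtain ⟨i, hi⟩ := Function.ne_iff.1 (hu0 (φ (t + T1)))
  have h1 : (∑ l, u0 l * Z (φ (t + T1) + T0) l j) * u (φ (t + T1)) i = u0 i * ∑ l, u (φ (t + T1)) l * Z (φ (t + T1) + T0) l j := by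
    rw [sum_mul, mul_sum]
    refine sum_congr rfl fun l _ => ?_
    have := ht l i
    calc _ = (u0 l * u (φ (t + T1)) i) * Z (φ (t + T1) + T0) l j := by ring
      _ = _ := by rw [this]; ring
  rw [huZ _ j hj, mul_zero] at h1
  exact (mul_eq_zero.1 h1).resolve_right hi

end
end SchmidtPf

namespace SchmidtPf
open Finset
noncomputable section
set_option linter.unusedSectionVars false
set_option linter.unusedVariables false
set_option linter.style.haveILetI false

abbrev Pw (n p : ℕ) := ↥(Set.powersetCard (Fin n) p)
variable {R : Type} [CommRing R] {n : ℕ}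
def em {p : ℕ} (s : Pw n p) : Fin p ↪o Fin n := Set.powersetCard.ofFinEmbEquiv.symm s
def cp (p : ℕ) (M : Matrix (Fin n) (Fin n) R) : Matrix (Pw n p) (Pw n p) R :=
  Matrix.of fun s t => (M.submatrix (em s) (em t)).det

lemma cp_eq (p : ℕ) (M : Matrix (Fin n) (Fin n) R) :
    cp p M = LinearMap.toMatrix ((Pi.basisFun R (Fin n)).exteriorPower p) ((Pi.basisFun R (Fin n)).exteriorPower p)
      (exteriorPower.map p (Matrix.toLin' M)) := by
  ext s t
  rw [LinearMap.toMatrix_apply, exteriorPower.basis_apply, exteriorPower.map_apply_ιMulti_family, exteriorPower.basis_repr_apply,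
    exteriorPower.ιMulti_family, exteriorPower.ιMultiDual_apply_ιMulti, cp, Matrix.of_apply, ← Matrix.det_transpose]
  congr 1
  ext i j
  simp [em]

lemma cp_mul (p : ℕ) (M N : Matrix (Fin n) (Fin n) R) : cp p (M * N) = cp p M * cp p N := by
  rw [cp_eq, cp_eq, cp_eq, ← LinearMap.toMatrix_comp, ← exteriorPower.map_comp, Matrix.toLin'_mul]

lemma cp_one (p : ℕ) : cp p (1 : Matrix (Fin n) (Fin n) R) = 1 := by
  rw [cp_eq, Matrix.toLin'_one, exteriorPower.map_id, LinearMap.toMatrix_id]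
lemma cp_map {S : Type} [CommRing S] (f : R →+* S) (p : ℕ) (M : Matrix (Fin n) (Fin n) R) : (cp p M).map f = cp p (M.map f) := by
  ext s t
  simp only [cp, Matrix.map_apply, Matrix.of_apply, RingHom.map_det]
  rfl

lemma cp_det_ne (p : ℕ) (Z : Matrix (Fin n) (Fin n) ℤ) (hZ : Z.det ≠ 0) : (cp p Z).det ≠ 0 := by
  intro h
  have h1 : (cp p (Z.map (Int.castRingHom ℚ))).det = 0 := by
    rw [← cp_map, ← RingHom.mapMatrix_apply, ← RingHom.map_det, h, map_zero]
  have h2 : (Z.map (Int.castRingHom ℚ)).det ≠ 0 := by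
    rw [← RingHom.mapMatrix_apply, ← RingHom.map_det]
    simpa using hZ
  have h3 := cp_mul p (Z.map (Int.castRingHom ℚ)) (Z.map (Int.castRingHom ℚ))⁻¹
  rw [Matrix.mul_nonsing_inv _ (Ne.isUnit h2), cp_one] at h3
  have := congrArg Matrix.det h3
  rw [Matrix.det_mul, h1, Matrix.det_one, zero_mul] at this
  exact one_ne_zero this

def pw {p : ℕ} (w : Fin n → ℝ) (s : Pw n p) : ℝ := ∏ j ∈ s.1, w j

lemma pw_eq {p : ℕ} (w : Fin n → ℝ) (s : Pw n p) : pw w s = ∏ i, w (em s i) := by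
  rw [pw, ← Finset.map_orderEmbOfFin_univ s.1 s.2, prod_map]
  rfl

lemma pw_pos {p : ℕ} {w : Fin n → ℝ} (hw : ∀ i, 0 < w i) (s : Pw n p) : 0 < pw w s := prod_pos fun i _ => hw i

lemma prod_pw (p : ℕ) (hp : 1 ≤ p) (w : Fin n → ℝ) : ∏ s : Pw n p, pw w s = (∏ i, w i) ^ ((n - 1).choose (p - 1)) := by
  have h1 : ∏ s : Pw n p, pw w s = ∏ s ∈ univ.powersetCard p, ∏ j ∈ s, w j := by
    rw [Finset.prod_subtype (univ.powersetCard p) (p := fun s => s ∈ Set.powersetCard (Fin n) p)]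
    · rfl
    · intro x
      simp [Set.powersetCard]
  rw [h1]
  have h2 : ∀ s : Finset (Fin n), ∏ j ∈ s, w j = ∏ j, if j ∈ s then w j else 1 := fun s => by simp
  rw [prod_congr rfl fun s _ => h2 s]
  rw [prod_comm, ← prod_pow]
  refine prod_congr rfl fun j _ => ?_
  rw [← prod_filter, prod_const]
  congr 1
  have := card_filter_powersetCard_subset {j} (univ : Finset (Fin n)) p (subset_univ _) (by simpa using hp)
  simp only [singleton_subset_iff, card_univ, Fintype.card_fin, card_singleton] at this
  exact this

lemma cp_bound (p : ℕ) (V : Matrix (Fin n) (Fin n) ℝ) {w B : Fin n → ℝ} (hw : ∀ i, 0 ≤ w i) (hB : ∀ j, 0 ≤ B j)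
    (h : ∀ i j, |V i j| ≤ w i * B j) (s t : Pw n p) : |cp p V s t| ≤ p.factorial * (pw w s * pw B t) := by
  rw [pw_eq, pw_eq, cp, Matrix.of_apply]
  have := det_bound (V.submatrix (em s) (em t)) (w := fun i => w (em s i)) (B := fun j => B (em t j)) (fun i => hw _) (fun j => hB _)
    (fun i j => h _ _)
  simpa using this

def top0 (n k p : ℕ) (h : p + k = n) : Pw n p := ⟨univ.filter fun j : Fin n => k ≤ j.1, by
  show Finset.card _ = p
  have h1 : (univ.filter fun j : Fin n => k ≤ j.1) = univ \ (univ.filter fun j : Fin n => j.1 < k) := by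
    ext j; simp
  rw [h1, card_sdiff_of_subset (by simp), card_univ, Fintype.card_fin, Fin.card_filter_val_lt]
  omega⟩

lemma mem_top0 (n k p : ℕ) (h : p + k = n) (j : Fin n) : j ∈ (top0 n k p h).1 ↔ k ≤ j.1 := by
  simp [top0]

lemma top_gap (k p : ℕ) (h : p + k = n) (lam : Fin n → ℝ) (hl : ∀ j, 0 < lam j) {a b g : ℝ} (ha : 0 < a) (hg : 1 ≤ g) (hab : g * a ≤ b)
    (h1 : ∀ j, j.1 < k → lam j ≤ a) (h2 : ∀ j, k ≤ j.1 → b ≤ lam j) (τ : Pw n p) (hτ : τ ≠ top0 n k p h) :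
    g * pw lam τ ≤ pw lam (top0 n k p h) := by
  set τ0 := top0 n k p h with hτ0
  have hc : (τ.1 \ τ0.1).card = (τ0.1 \ τ.1).card := card_sdiff_comm (τ.2.trans τ0.2.symm)
  have hne : (τ.1 \ τ0.1).card ≠ 0 := by
    intro h0
    rw [card_eq_zero, sdiff_eq_empty_iff_subset] at h0
    exact hτ (Subtype.ext (eq_of_subset_of_card_le h0 (le_of_eq (τ0.2.trans τ.2.symm))))
  set m := (τ.1 \ τ0.1).card with hm
  have e1 : pw lam τ = (∏ j ∈ τ.1 \ τ0.1, lam j) * ∏ j ∈ τ.1 ∩ τ0.1, lam j := by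
    rw [pw, mul_comm, prod_inter_mul_prod_sdiff]
  have e2 : pw lam τ0 = (∏ j ∈ τ0.1 \ τ.1, lam j) * ∏ j ∈ τ.1 ∩ τ0.1, lam j := by
    rw [pw, mul_comm, inter_comm, prod_inter_mul_prod_sdiff]
  have hin : 0 ≤ ∏ j ∈ τ.1 ∩ τ0.1, lam j := prod_nonneg fun j _ => (hl j).le
  have b1 : ∏ j ∈ τ.1 \ τ0.1, lam j ≤ a ^ m := by
    rw [hm, ← prod_const]
    refine prod_le_prod (fun j _ => (hl j).le) fun j hj => h1 j ?_
    have := (mem_sdiff.1 hj).2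
    rw [hτ0, mem_top0] at this
    omega
  have hb : 0 < b := lt_of_lt_of_le (by positivity) hab
  have b2 : b ^ m ≤ ∏ j ∈ τ0.1 \ τ.1, lam j := by
    rw [hc, ← prod_const]
    refine prod_le_prod (fun j _ => hb.le) fun j hj => h2 j ?_
    have := (mem_sdiff.1 hj).1
    rwa [hτ0, mem_top0] at this
  rw [e1, e2, ← mul_assoc]
  refine mul_le_mul_of_nonneg_right ?_ hin
  calc g * ∏ j ∈ τ.1 \ τ0.1, lam j ≤ g * a ^ m := mul_le_mul_of_nonneg_left b1 (by linarith)
    _ ≤ g ^ m * a ^ m := mul_le_mul_of_nonneg_right (le_self_pow₀ hg hne) (by positivity)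
    _ = (g * a) ^ m := (mul_pow _ _ _).symm
    _ ≤ b ^ m := pow_le_pow_left₀ (by positivity) hab m
    _ ≤ _ := b2

lemma Pw_nontrivial (p : ℕ) (hp : 1 ≤ p) (hpn : p < n) : Nontrivial (Pw n p) := by
  exact Set.powersetCard.nontrivial' (by omega) (by simpa using hpn)

lemma kill {p : ℕ} (hp : 1 ≤ p) (v0 : Pw n p → ℤ) (hv0 : v0 ≠ 0) : ∃ a : Fin n → ℚ, a ≠ 0 ∧ ∀ (k : ℕ) (h : p + k = n)
    (Z : Matrix (Fin n) (Fin n) ℤ), Z.det ≠ 0 → (∀ τ, τ ≠ top0 n k p h → ∑ σ, v0 σ * cp p Z σ τ = 0) → ∀ x : Fin n → ℤ,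
    (∀ j : Fin n, k ≤ j.1 → (Z.updateCol j x).det = 0) → ∑ l, a l * x l = 0 := by
  obtain ⟨q, rfl⟩ : ∃ q, p = q + 1 := ⟨p - 1, by omega⟩
  obtain ⟨σ0, hσ0⟩ := Function.ne_iff.1 hv0
  set e := Pi.basisFun ℚ (Fin n) with he
  set Λ : Module.Dual ℚ (⋀[ℚ]^(q+1) (Fin n → ℚ)) := ∑ σ, (v0 σ : ℚ) • exteriorPower.ιMultiDual ℚ (q+1) e σ with hΛ
  set F : (Fin n → ℚ) →ₗ[ℚ] ℚ := Λ ∘ₗ ((exteriorPower.ιMulti ℚ (q+1) (M := Fin n → ℚ)).toMultilinearMap.toLinearMap (fun i => e (em σ0 i)) 0) with hF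
  have hFx : ∀ x, F x = Λ (exteriorPower.ιMulti ℚ (q+1) (Function.update (fun i => e (em σ0 i)) 0 x)) := fun x => rfl
  refine ⟨fun l => F (e l), ?_, ?_⟩
  · intro h0
    have h1 : F (e (em σ0 0)) = 0 := congrFun h0 _
    rw [hFx, Function.update_eq_self_iff.2 rfl] at h1
    have h2 : exteriorPower.ιMulti ℚ (q+1) (fun i => e (em σ0 i)) = exteriorPower.ιMulti_family ℚ (q+1) e σ0 := rfl
    rw [h2, hΛ, LinearMap.sum_apply, sum_eq_single σ0] at h1
    · rw [LinearMap.smul_apply, exteriorPower.ιMultiDual_apply_diag] at h1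
      simp at h1
      exact hσ0 h1
    · intro σ _ hne
      rw [LinearMap.smul_apply, exteriorPower.ιMultiDual_apply_nondiag _ _ _ _ _ hne, smul_zero]
    · simp
  · intro k h Z hZ hτ x hx
    have hxe : ∑ l, F (e l) * (x l : ℚ) = F (fun l => (x l : ℚ)) := by
      conv_rhs => rw [← e.sum_repr (fun l => (x l : ℚ))]
      rw [map_sum]
      refine sum_congr rfl fun l _ => ?_
      rw [map_smul, smul_eq_mul, mul_comm]
      simp [he]
    rw [hxe]
    have hZq : IsUnit (Z.map (Int.castRingHom ℚ)).det := by
      rw [← RingHom.mapMatrix_apply, ← RingHom.map_det]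
      simpa using hZ
    haveI := Matrix.invertibleOfIsUnitDet _ hZq
    set L : (Fin n → ℚ) ≃ₗ[ℚ] (Fin n → ℚ) := Matrix.toLin'OfInv (M' := Z.map (Int.castRingHom ℚ)) (M := (Z.map (Int.castRingHom ℚ))⁻¹)
      (Matrix.nonsing_inv_mul _ hZq) (Matrix.mul_nonsing_inv _ hZq) with hL
    have hLa : ∀ y, L y = (Z.map (Int.castRingHom ℚ)).mulVec y := fun y => Matrix.toLin'_apply _ _
    set b := e.map L with hb
    have hbj : ∀ j l, b j l = Z l j := by
      intro j l
      rw [hb, Module.Basis.map_apply, hLa]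
      simp [he]
    have hxco : ∀ j : Fin n, k ≤ j.1 → b.coord j (fun l => (x l : ℚ)) = 0 := by
      have : (fun l => (x l : ℚ)) = ∑ j, ((Z.det : ℚ)⁻¹ * (Z.updateCol j x).det) • b j := by
        ext l
        rw [Finset.sum_apply]
        simp only [Pi.smul_apply, smul_eq_mul, hbj]
        have h1 := cramer_sum Z x l
        have h2 : ∑ k, (Z l k : ℚ) * ((Z.updateCol k x).det : ℚ) = Z.det * x l := by exact_mod_cast h1
        have hZ' : (Z.det : ℚ) ≠ 0 := by exact_mod_cast hZ
        rw [eq_comm, ← mul_right_inj' hZ', ← h2, mul_sum]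
        refine sum_congr rfl fun j _ => ?_
        field_simp
      intro j hj
      rw [this, map_sum, sum_eq_single j]
      · simp [hx j hj]
      · intro i _ hi
        simp [Finsupp.single_eq_of_ne hi.symm]
      · simp
    have hΛb : Λ = Λ (b.exteriorPower (q+1) (top0 n k (q+1) h)) • exteriorPower.ιMultiDual ℚ (q+1) b (top0 n k (q+1) h) := by
      refine (b.exteriorPower (q+1)).ext fun τ => ?_
      by_cases hne : τ = top0 n k (q+1) h
      · subst hne
        rw [LinearMap.smul_apply, exteriorPower.basis_apply, exteriorPower.ιMultiDual_apply_diag]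
        simp
      · rw [LinearMap.smul_apply, exteriorPower.basis_apply _ _ _ τ, exteriorPower.ιMultiDual_apply_nondiag _ _ _ _ _ (Ne.symm hne), smul_zero]
        rw [hΛ, LinearMap.sum_apply]
        have h1 := hτ τ hne
        have h2 : ∑ σ, (v0 σ : ℚ) * ((cp (q+1) Z σ τ : ℤ) : ℚ) = 0 := by exact_mod_cast h1
        rw [← h2]
        refine sum_congr rfl fun σ _ => ?_
        rw [LinearMap.smul_apply, smul_eq_mul, exteriorPower.ιMulti_family, exteriorPower.ιMultiDual_apply_ιMulti]
        congr 1
        have h3 := congrFun (congrFun (cp_map (Int.castRingHom ℚ) (q+1) Z) σ) τ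
        rw [Matrix.map_apply] at h3
        rw [eq_intCast] at h3
        rw [h3, cp, Matrix.of_apply, ← Matrix.det_transpose]
        congr 1
        ext i j
        simp [em, he, hbj]
    rw [hFx, hΛb, LinearMap.smul_apply, exteriorPower.ιMultiDual_apply_ιMulti, Matrix.det_eq_zero_of_row_eq_zero 0, smul_zero]
    intro j
    rw [Matrix.of_apply, Function.update_self]
    refine hxco _ ?_
    rw [← mem_top0 n k (q+1) h]
    exact Finset.orderEmbOfFin_mem _ (top0 n k (q+1) h).2 _

end
end SchmidtPf

namespace SchmidtPf
open Finset Filter Topology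
noncomputable section
set_option linter.unusedSectionVars false
set_option linter.unusedVariables false
set_option linter.style.haveILetI false

variable {n : ℕ}

lemma log_bd (E M : Matrix (Fin n) (Fin n) ℝ) (hEM : E * M = 1) {C A' : ℝ} :
    ∃ A1 : ℝ, 0 ≤ A1 ∧ ∀ (w : Fin n → ℝ) (Z : Matrix (Fin n) (Fin n) ℤ) (lam : Fin n → ℝ) (ℓ : ℝ), 1 ≤ ℓ → (∀ i, 0 < w i) →
      Z.det ≠ 0 → (∀ j, 0 < lam j) → (∀ j, Bd M w (lam j) (fun k => Z k j)) → ∏ j, lam j ≤ C → (∀ i, |Real.log (w i)| ≤ A' * ℓ) →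
      ∀ j, |Real.log (lam j)| ≤ A1 * ℓ := by
  set c := 1 + ∑ l, ∑ i, |E l i| with hc
  have hs0 : 0 ≤ ∑ l, ∑ i, |E l i| := sum_nonneg fun l _ => sum_nonneg fun i _ => abs_nonneg _
  have hc1 : 1 ≤ c := by linarith
  have hlc := Real.log_nonneg hc1
  set C' := max C 1 with hC'
  have hlC := Real.log_nonneg (le_max_right C 1)
  refine ⟨Real.log C' + n * (Real.log c + |A'|) + (Real.log c + |A'|), by positivity, ?_⟩
  intro w Z lam ℓ hℓ hw hZ hl hBd hC hLw
  set D := (Real.log c + |A'|) * ℓ with hD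
  have hD0 : 0 ≤ D := by positivity
  have hlow : ∀ j, -D ≤ Real.log (lam j) := by
    intro j
    have hcol : (fun k => Z k j) ≠ 0 := fun h => hZ (Matrix.det_eq_zero_of_column_eq_zero j fun i => congrFun h i)
    obtain ⟨l, hlne⟩ := Function.ne_iff.1 hcol
    have h1 : (1:ℝ) ≤ |(Z l j : ℝ)| := by exact_mod_cast Int.one_le_abs hlne
    have h2 : (Z l j : ℝ) = ∑ i, E l i * ∑ k, M i k * (Z k j : ℝ) := by
      have h3 : E.mulVec (M.mulVec (fun k => (Z k j : ℝ))) = fun k => (Z k j : ℝ) := by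
        rw [Matrix.mulVec_mulVec, hEM, Matrix.one_mulVec]
      exact (congrFun h3 l).symm
    have h3 : ∀ i, w i ≤ Real.exp (|A'| * ℓ) := fun i => by
      rw [← Real.exp_log (hw i)]
      refine Real.exp_le_exp.2 ((le_abs_self _).trans ((hLw i).trans ?_))
      exact mul_le_mul_of_nonneg_right (le_abs_self _) (by linarith)
    have h4 : |(Z l j : ℝ)| ≤ c * (Real.exp (|A'| * ℓ) * lam j) := by
      rw [h2]
      calc |∑ i, E l i * ∑ k, M i k * (Z k j : ℝ)| ≤ ∑ i, |E l i * ∑ k, M i k * (Z k j : ℝ)| := abs_sum_le_sum_abs _ _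
        _ ≤ ∑ i, |E l i| * (Real.exp (|A'| * ℓ) * lam j) := sum_le_sum fun i _ => by
            rw [abs_mul]
            refine mul_le_mul_of_nonneg_left ((hBd j i).trans ?_) (abs_nonneg _)
            exact mul_le_mul_of_nonneg_right (h3 i) (hl j).le
        _ = (∑ i, |E l i|) * (Real.exp (|A'| * ℓ) * lam j) := by rw [sum_mul]
        _ ≤ _ := by
            refine mul_le_mul_of_nonneg_right ?_ (mul_pos (Real.exp_pos _) (hl j)).le
            have := single_le_sum (f := fun l => ∑ i, |E l i|) (fun l _ => sum_nonneg fun i _ => abs_nonneg _) (mem_univ l)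
            linarith
    have h5 := Real.log_le_log one_pos (h1.trans h4)
    have hc0 : c ≠ 0 := by positivity
    rw [Real.log_one, Real.log_mul hc0 (mul_pos (Real.exp_pos _) (hl j)).ne', Real.log_mul (Real.exp_pos _).ne' (hl j).ne', Real.log_exp] at h5
    have h6 : Real.log c ≤ Real.log c * ℓ := le_mul_of_one_le_right hlc hℓ
    rw [hD]
    linarith
  intro j
  have hup : Real.log (lam j) ≤ Real.log C' + n * D := by
    have h1 : ∑ i, Real.log (lam i) ≤ Real.log C' := by
      rw [← Real.log_prod (fun i _ => (hl i).ne')]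
      exact Real.log_le_log (prod_pos fun i _ => hl i) (hC.trans (le_max_left _ _))
    rw [← add_sum_erase univ _ (mem_univ j)] at h1
    have h2 : -(n * D) ≤ ∑ i ∈ univ.erase j, Real.log (lam i) := by
      have h3 : ∑ i ∈ univ.erase j, (-D) ≤ ∑ i ∈ univ.erase j, Real.log (lam i) := sum_le_sum fun i _ => hlow i
      rw [sum_const, card_erase_of_mem (mem_univ _), card_univ, Fintype.card_fin, nsmul_eq_mul] at h3
      have h4 : ((n - 1 : ℕ) : ℝ) ≤ n := by exact_mod_cast Nat.sub_le n 1
      nlinarith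
    linarith
  have h7 : Real.log C' ≤ Real.log C' * ℓ := le_mul_of_one_le_right hlC hℓ
  have h8 := hlow j
  have hnD : 0 ≤ n * D := by positivity
  have e1 : (Real.log C' + n * (Real.log c + |A'|) + (Real.log c + |A'|)) * ℓ = Real.log C' * ℓ + n * D + D := by rw [hD]; ring
  have h9 : 0 ≤ Real.log C' * ℓ := by positivity
  rw [e1, abs_le]
  constructor <;> linarith

lemma gap_find (hn : 2 ≤ n) (E M : Matrix (Fin n) (Fin n) ℝ) (hEM : E * M = 1) {η A' : ℝ} (hη : 0 < η) :
    ∃ C L0 A1 : ℝ, 0 < C ∧ 1 ≤ L0 ∧ 0 ≤ A1 ∧ ∀ (w : Fin n → ℝ) (x : Fin n → ℤ) (ℓ : ℝ), L0 ≤ ℓ → (∀ i, 0 < w i) → ∏ i, w i = 1 →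
      (∀ i, |Real.log (w i)| ≤ A' * ℓ) → x ≠ 0 → Bd M w (Real.exp (-(η * ℓ))) x →
      ∃ (Z : Matrix (Fin n) (Fin n) ℤ) (lam : Fin n → ℝ) (k : Fin n) (a : ℝ), 1 ≤ k.1 ∧ Z.det ≠ 0 ∧ (∀ j, 0 < lam j) ∧
        (∀ j, Bd M w (lam j) (fun k => Z k j)) ∧ ∏ j, lam j ≤ C ∧ (∀ j, |Real.log (lam j)| ≤ A1 * ℓ) ∧ 0 < a ∧
        (∀ j, j.1 < k.1 → lam j ≤ a) ∧ (∀ j, k.1 ≤ j.1 → Real.exp (η / (2 * n) * ℓ) * a ≤ lam j) ∧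
        (∀ j, k.1 ≤ j.1 → (Z.updateCol j x).det = 0) := by
  have hdet : E.det * M.det = 1 := by rw [← Matrix.det_mul, hEM, Matrix.det_one]
  have hM : M.det ≠ 0 := right_ne_zero_of_mul (hdet ▸ one_ne_zero)
  have hMp : 0 < |M.det| := abs_pos.2 hM
  haveI : Nonempty (Fin n) := ⟨⟨0, by omega⟩⟩
  obtain ⟨C, hC, hmk⟩ := mink2 M hM
  obtain ⟨A1, hA1, hlog⟩ := log_bd E M hEM (C := C) (A' := A')
  set f : ℝ := (n.factorial : ℝ) with hf
  have hf0 : 0 < f := by positivity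
  set K := f * C / |M.det| with hK
  have hK0 : 0 < K := by positivity
  set c0 := |M.det| / f with hc0
  have hc00 : 0 < c0 := by positivity
  have hev : ∀ᶠ ℓ : ℝ in atTop, K ^ n * Real.exp (-(η / 2 * ℓ)) < c0 ∧ 1 ≤ ℓ := by
    have h1 : Tendsto (fun ℓ : ℝ => K ^ n * Real.exp (-(η / 2 * ℓ))) atTop (𝓝 (K ^ n * 0)) :=
      (Real.tendsto_exp_neg_atTop_nhds_zero.comp (tendsto_id.const_mul_atTop (by positivity))).const_mul _
    rw [mul_zero] at h1
    exact (h1.eventually_lt_const hc00).and (eventually_ge_atTop 1)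
  obtain ⟨L0, hL0⟩ := eventually_atTop.1 hev
  refine ⟨C, max L0 1, A1, hC, le_max_right _ _, hA1, ?_⟩
  intro w x ℓ hℓ hw hwp hLw hx0 hx
  have hℓ1 : 1 ≤ ℓ := (le_max_right _ _).trans hℓ
  have hbig := (hL0 ℓ ((le_max_left _ _).trans hℓ)).1
  obtain ⟨Z0, B0, hZ0, hB0, hBd0, hBC0⟩ := hmk w hw hwp
  obtain ⟨o0, ho0⟩ := exists_sort B0
  set o : Equiv.Perm (Fin n) := o0.trans (finCongr (Fintype.card_fin n)) with ho
  set lam : Fin n → ℝ := fun j => B0 (o.symm j) with hlam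
  set Z : Matrix (Fin n) (Fin n) ℤ := Z0.submatrix id o.symm with hZdef
  have hmono : ∀ i j : Fin n, i ≤ j → lam i ≤ lam j := by
    intro i j hij
    refine ho0 _ _ ?_
    have h1 : ∀ i, o0 (o.symm i) = (finCongr (Fintype.card_fin n)).symm i := fun i => by
      rw [Equiv.eq_symm_apply]
      exact o.apply_symm_apply i
    rw [h1, h1]
    exact hij
  have hl : ∀ j, 0 < lam j := fun j => hB0 _
  have hZ : Z.det ≠ 0 := by
    rw [hZdef, Matrix.det_permute']
    refine mul_ne_zero ?_ hZ0
    simp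
  have hBd : ∀ j, Bd M w (lam j) (fun k => Z k j) := fun j => hBd0 _
  have hprodl : ∏ j, lam j ≤ C := by
    rw [hlam, Equiv.prod_comp o.symm B0]; exact hBC0
  have hexch : ∀ j, (Z.updateCol j x).det ≠ 0 → lam j ≤ K * Real.exp (-(η * ℓ)) := fun j hj => by
    have := exchange M hM hw hwp hl hprodl Z hBd x j hj _ (Real.exp_pos _).le hx
    rwa [Fintype.card_fin] at this
  have hlow : c0 ≤ ∏ j, lam j := by
    rw [hc0, div_le_iff₀' hf0]
    have := prod_lower M (fun i => (hw i).le) hwp (fun j => (hl j).le) Z hZ hBd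
    rwa [Fintype.card_fin] at this
  have hne : (univ.filter fun j => (Z.updateCol j x).det ≠ 0).Nonempty := by
    by_contra hcon
    rw [not_nonempty_iff_eq_empty, filter_eq_empty_iff] at hcon
    obtain ⟨l, hl'⟩ := Function.ne_iff.1 hx0
    have h1 := cramer_sum Z x l
    rw [sum_eq_zero] at h1
    · exact mul_ne_zero hZ hl' h1.symm
    · intro k _
      have := hcon (mem_univ k)
      rw [not_not] at this
      rw [this, mul_zero]
  obtain ⟨js, hjs, hjmax⟩ := exists_max_image _ (fun j : Fin n => j) hne
  have hjs1 := hexch js (mem_filter.1 hjs).2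
  set G := Real.exp (η / (2 * n) * ℓ) with hG
  have hn0 : (0:ℝ) < n := by
    have : 0 < n := by omega
    exact_mod_cast this
  have hG1 : 1 ≤ G := Real.one_le_exp (by positivity)
  have hgap : ∃ i : ℕ, ∃ h : i + 1 < n, js.1 ≤ i ∧ G * lam ⟨i, by omega⟩ ≤ lam ⟨i + 1, h⟩ := by
    by_contra hcon
    push Not at hcon
    have hind : ∀ i : ℕ, ∀ h : i < n, js.1 ≤ i → lam ⟨i, h⟩ ≤ G ^ i * lam js := by
      intro i
      induction i with
      | zero =>
        intro h hj
        have : (⟨0, h⟩ : Fin n) = js := Fin.ext (show 0 = js.1 by omega)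
        rw [this, pow_zero, one_mul]
      | succ i ih =>
        intro h hj
        rcases Nat.lt_or_ge i js.1 with h1 | h1
        · have : (⟨i + 1, h⟩ : Fin n) = js := Fin.ext (by simp; omega)
          rw [this]
          exact le_mul_of_one_le_left (hl _).le (one_le_pow₀ hG1)
        · refine (hcon i h h1).le.trans ?_
          rw [pow_succ, mul_comm (G ^ i), mul_assoc]
          exact mul_le_mul_of_nonneg_left (ih (by omega) h1) (by positivity)
    have h1 := hind (n - 1) (by omega) (by omega)
    have hjall : ∀ j, lam j ≤ G ^ n * (K * Real.exp (-(η * ℓ))) := fun j => by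
      have h2 : lam j ≤ lam ⟨n - 1, by omega⟩ := hmono _ _ (by rw [Fin.le_def]; simp; omega)
      refine h2.trans (h1.trans ?_)
      exact mul_le_mul (pow_le_pow_right₀ hG1 (by omega)) hjs1 (hl _).le (by positivity)
    have h3 : G ^ n * (K * Real.exp (-(η * ℓ))) = K * Real.exp (-(η / 2 * ℓ)) := by
      rw [hG, ← Real.exp_nat_mul, mul_left_comm, ← Real.exp_add]
      congr 2
      field_simp
      ring
    have h4 : ∏ j, lam j ≤ (K * Real.exp (-(η / 2 * ℓ))) ^ n := by
      calc ∏ j, lam j ≤ ∏ _j : Fin n, (K * Real.exp (-(η / 2 * ℓ))) := prod_le_prod (fun j _ => (hl j).le) fun j _ => by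
            rw [← h3]; exact hjall j
        _ = _ := by rw [prod_const, card_univ, Fintype.card_fin]
    have h5 : Real.exp (-(η / 2 * ℓ)) ^ n ≤ Real.exp (-(η / 2 * ℓ)) := by
      refine pow_le_of_le_one (Real.exp_pos _).le ?_ (by omega)
      rw [Real.exp_le_one_iff]
      have : 0 ≤ η / 2 * ℓ := by positivity
      linarith
    rw [mul_pow] at h4
    have h6 : K ^ n * Real.exp (-(η / 2 * ℓ)) ^ n ≤ K ^ n * Real.exp (-(η / 2 * ℓ)) := mul_le_mul_of_nonneg_left h5 (by positivity)
    linarith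
  obtain ⟨i, hi, hji, hgi⟩ := hgap
  refine ⟨Z, lam, ⟨i + 1, hi⟩, lam ⟨i, by omega⟩, by simp, hZ, hl, hBd, hprodl, hlog w Z lam ℓ hℓ1 hw hZ hl hBd hprodl hLw, hl _, ?_, ?_, ?_⟩
  · intro j hj
    refine hmono _ _ ?_
    rw [Fin.le_def]
    simp only at hj ⊢
    omega
  · intro j hj
    exact hgi.trans (hmono _ _ hj)
  · intro j hj
    by_contra hne
    have := hjmax j (by simp [hne])
    rw [Fin.le_def] at this
    simp only at hj
    omega

/-- parametric subspace theorem -/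
theorem subsp (hn : 2 ≤ n) {A : Type} [CommRing A] [IsDomain A] [Module.Free ℤ A] [Module.Finite ℤ A] (ψ : A →+* ℝ)
    (E : Matrix (Fin n) (Fin n) A) (M : Matrix (Fin n) (Fin n) ℝ) (hEM : E.map ψ * M = 1) {η A' : ℝ} (hη : 0 < η)
    {ℓ : ℕ → ℝ} (hℓ : Tendsto ℓ atTop atTop) (w : ℕ → Fin n → ℝ) (hw : ∀ t i, 0 < w t i) (hwp : ∀ t, ∏ i, w t i = 1)
    (hLw : ∀ t i, |Real.log (w t i)| ≤ A' * ℓ t) (x : ℕ → Fin n → ℤ) (hx0 : ∀ t, x t ≠ 0)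
    (hx : ∀ t, Bd M (w t) (Real.exp (-(η * ℓ t))) (x t)) :
    ∃ a : Fin n → ℚ, a ≠ 0 ∧ ∃ᶠ t in atTop, ∑ l, a l * x t l = 0 := by
  obtain ⟨C, L0, A1, hC, hL0, hA1, hfind⟩ := gap_find hn (E.map ψ) M hEM (A' := A') hη
  have hev : ∀ᶠ t in atTop, L0 ≤ ℓ t := hℓ.eventually_ge_atTop L0
  obtain ⟨T0, hT0⟩ := eventually_atTop.1 hev
  have hall := fun t => hfind (w (t + T0)) (x (t + T0)) (ℓ (t + T0)) (hT0 _ (by omega)) (hw _) (hwp _) (hLw _) (hx0 _) (hx _)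
  choose Z lam k a hk hZ hl hBd hprod hlog ha hlo hhi hxz using hall
  have hℓ1 : ∀ t, 1 ≤ ℓ (t + T0) := fun t => hL0.trans (hT0 _ (by omega))
  obtain ⟨k0, hk0⟩ := Finite.exists_infinite_fiber k
  obtain ⟨φ, hφ, hφk⟩ := extraction_of_frequently_atTop (P := fun t => k t = k0)
    (Nat.frequently_atTop_iff_infinite.2 (Set.infinite_coe_iff.1 hk0))
  have hk01 : 1 ≤ k0.1 := by have := hk (φ 0); rwa [hφk] at this
  obtain ⟨p, hp⟩ : ∃ p, p + k0.1 = n := ⟨n - k0.1, by omega⟩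
  have hp1 : 1 ≤ p := by omega
  haveI := Pw_nontrivial (n := n) p hp1 (by omega)
  have hf1 : (1:ℝ) ≤ p.factorial := by exact_mod_cast Nat.one_le_iff_ne_zero.2 (Nat.factorial_ne_zero p)
  have hf0 : (0:ℝ) < p.factorial := by linarith
  have htend : Tendsto (fun t => φ t + T0) atTop atTop := (tendsto_add_atTop_nat T0).comp hφ.tendsto_atTop
  have hlpw : ∀ (v : Fin n → ℝ) (X : ℝ), (∀ i, 0 < v i) → (∀ i, |Real.log (v i)| ≤ X) → 0 ≤ X → ∀ s : Pw n p, |Real.log (pw v s)| ≤ p * X := by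
    intro v X hv hX hX0 s
    rw [pw, Real.log_prod (fun i _ => (hv i).ne')]
    refine (abs_sum_le_sum_abs _ _).trans ?_
    refine (sum_le_sum fun j _ => hX j).trans (le_of_eq ?_)
    rw [sum_const, nsmul_eq_mul]
    congr 2
    exact_mod_cast s.2
  have hA' : ∀ t, 0 ≤ A' * ℓ t := fun t => (abs_nonneg _).trans (hLw t ⟨0, by omega⟩)
  set A2 := (p : ℝ) * |A'| + p * A1 + Real.log p.factorial with hA2
  have hlogf := Real.log_nonneg hf1
  obtain ⟨v0, hv0, hfr⟩ : ∃ v0 : Pw n p → ℤ, v0 ≠ 0 ∧ ∃ᶠ t in atTop, ∀ j, j ≠ top0 n k0.1 p hp → ∑ l, v0 l * cp p (Z (φ t)) l j = 0 := by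
    refine gapT ψ (cp p E) (cp p M) ?_ (C := (p.factorial : ℝ) ^ Fintype.card (Pw n p) * C ^ ((n-1).choose (p-1))) (by positivity)
      (δ := η / (2 * n)) (A' := A2) (by positivity) (hℓ.comp htend) (fun t => pw (w (φ t + T0))) ?_ ?_ (fun t => cp p (Z (φ t))) ?_
      (fun t τ => p.factorial * pw (lam (φ t)) τ) ?_ ?_ ?_ (top0 n k0.1 p hp) ?_ ?_ ?_
    · rw [cp_map, ← cp_mul, hEM, cp_one]
    · exact fun t s => pw_pos (hw _) s
    · intro t
      rw [prod_pw p hp1, hwp, one_pow]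
    · exact fun t => cp_det_ne p _ (hZ _)
    · exact fun t s => mul_pos hf0 (pw_pos (hl _) s)
    · intro t τ σ
      have h1 : ∑ k, cp p M σ k * ((cp p (Z (φ t)) k τ : ℤ) : ℝ) = cp p (M * (Z (φ t)).map (Int.castRingHom ℝ)) σ τ := by
        rw [cp_mul, Matrix.mul_apply, ← cp_map]
        simp
      rw [h1]
      refine (cp_bound p _ (fun i => (hw (φ t + T0) i).le) (fun j => (hl (φ t) j).le) ?_ σ τ).trans (le_of_eq (by ring))
      intro i j
      have := hBd (φ t) j i
      simpa [Matrix.mul_apply] using this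
    · intro t
      rw [prod_mul_distrib, prod_const, card_univ, prod_pw p hp1]
      exact mul_le_mul_of_nonneg_left (pow_le_pow_left₀ (prod_nonneg fun j _ => (hl _ j).le) (hprod _) _) (by positivity)
    · intro t τ hτ
      have hkk := hφk t
      have := top_gap k0.1 p hp (lam (φ t)) (hl _) (a := a (φ t)) (b := Real.exp (η / (2 * n) * ℓ (φ t + T0)) * a (φ t)) (ha _)
        (Real.one_le_exp (by have := hℓ1 (φ t); positivity)) le_rfl (fun j hj => hlo _ _ (by rwa [hkk]))
        (fun j hj => hhi _ _ (by rwa [hkk])) τ hτ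
      have h2 := mul_le_mul_of_nonneg_left this hf0.le
      simp only [Function.comp]
      linarith
    · intro t s
      have h1 := hlpw (w (φ t + T0)) _ (hw _) (hLw _) (hA' _) s
      refine h1.trans ?_
      have h2 := hℓ1 (φ t)
      simp only [Function.comp]
      have h3 : A' * ℓ (φ t + T0) ≤ |A'| * ℓ (φ t + T0) := mul_le_mul_of_nonneg_right (le_abs_self _) (by linarith)
      have h4 : (p:ℝ) * (A' * ℓ (φ t + T0)) ≤ p * (|A'| * ℓ (φ t + T0)) := mul_le_mul_of_nonneg_left h3 (by positivity)
      have h5 : 0 ≤ (p * A1 + Real.log p.factorial) * ℓ (φ t + T0) := by positivity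
      rw [hA2]
      linarith
    · intro t s
      have h2 := hℓ1 (φ t)
      have h1 := hlpw (lam (φ t)) _ (hl _) (hlog _) (by positivity) s
      simp only [Function.comp]
      rw [Real.log_mul hf0.ne' (pw_pos (hl _) s).ne']
      refine (abs_add_le _ _).trans ?_
      rw [abs_of_nonneg hlogf]
      have h3 : Real.log p.factorial ≤ Real.log p.factorial * ℓ (φ t + T0) := le_mul_of_one_le_right hlogf h2
      have h5 : 0 ≤ (p * |A'|) * ℓ (φ t + T0) := by positivity
      rw [hA2]
      linarith
  obtain ⟨c, hc, hkill⟩ := kill hp1 v0 hv0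
  refine ⟨c, hc, htend.frequently (hfr.mono fun t ht => ?_)⟩
  exact hkill k0.1 hp (Z (φ t)) (hZ _) ht (x (φ t + T0)) (fun j hj => hxz _ j (by rw [hφk t]; exact hj))

end
end SchmidtPf

namespace SchmidtPf
open Finset Filter Topology
noncomputable section
set_option linter.unusedSectionVars false
set_option linter.unusedVariables false
set_option linter.style.haveILetI false

/-- distance to the nearest integer -/
def nd (x : ℝ) : ℝ := |x - round x|

/-- the matrix of the forms `x₀, a_i x₀ - x_{i+1}` -/
def LM {R : Type} [CommRing R] {d : ℕ} (a : Fin d → R) : Matrix (Fin (d + 1)) (Fin (d + 1)) R :=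
  Matrix.of fun i => Fin.cases (Fin.cons 1 0 : Fin (d + 1) → R)
    (fun i => (Fin.cons (a i) (fun k => if k = i then -1 else 0) : Fin (d + 1) → R)) i

lemma LM_sq {R : Type} [CommRing R] {d : ℕ} (a : Fin d → R) : LM a * LM a = 1 := by
  ext i j
  refine Fin.cases ?_ (fun i => ?_) i <;> refine Fin.cases ?_ (fun j => ?_) j
  · simp [LM, Matrix.mul_apply, Fin.sum_univ_succ]
  · simp [LM, Matrix.mul_apply, Fin.sum_univ_succ, Fin.succ_ne_zero, eq_comm]
  · simp [LM, Matrix.mul_apply, Fin.sum_univ_succ, Fin.succ_ne_zero]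
  · simp [LM, Matrix.mul_apply, Fin.sum_univ_succ, Matrix.one_apply, eq_comm]
    split_ifs <;> simp

lemma LM_map {R S : Type} [CommRing R] [CommRing S] {d : ℕ} (a : Fin d → R) (ψ : R →+* S) :
    (LM a).map ψ = LM (fun i => ψ (a i)) := by
  ext i j
  refine Fin.cases ?_ (fun i => ?_) i <;> refine Fin.cases ?_ (fun j => ?_) j
  · simp [LM]
  · simp [LM]
  · simp [LM]
  · simp only [LM, Matrix.map_apply, Matrix.of_apply, Fin.cases_succ, Fin.cons_succ]
    split_ifs <;> simp

lemma LM_zero {d : ℕ} (a : Fin d → ℝ) (Y : Fin (d + 1) → ℝ) : ∑ k, LM a 0 k * Y k = Y 0 := by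
  simp [LM, Fin.sum_univ_succ]

lemma LM_succ {d : ℕ} (a : Fin d → ℝ) (Y : Fin (d + 1) → ℝ) (i : Fin d) :
    ∑ k, LM a i.succ k * Y k = a i * Y 0 - Y i.succ := by
  simp [LM, Fin.sum_univ_succ, sub_eq_add_neg]

lemma li_rel {d : ℕ} {α : Fin d → ℝ}
    (hli : LinearIndependent ℚ (Fin.cons 1 α : Fin (d + 1) → ℝ)) (a : Fin (d + 1) → ℚ)
    (h : (a 0 : ℝ) + ∑ i : Fin d, (a i.succ : ℝ) * α i = 0) : a = 0 := by
  rw [Fintype.linearIndependent_iff] at hli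
  funext i
  refine hli a ?_ i
  rw [Fin.sum_univ_succ]
  simpa [Rat.smul_def] using h

lemma rel_li {d : ℕ} {α : Fin d → ℝ}
    (h : ∀ a : Fin (d + 1) → ℚ, (a 0 : ℝ) + ∑ i : Fin d, (a i.succ : ℝ) * α i = 0 → a = 0) :
    LinearIndependent ℚ (Fin.cons 1 α : Fin (d + 1) → ℝ) := by
  rw [Fintype.linearIndependent_iff]
  intro g hg i
  refine congrFun (h g ?_) i
  rw [Fin.sum_univ_succ] at hg
  simpa [Rat.smul_def] using hg

lemma nd_pos {d : ℕ} {α : Fin d → ℝ}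
    (hli : LinearIndependent ℚ (Fin.cons 1 α : Fin (d + 1) → ℝ)) {m : ℕ} (hm : 1 ≤ m) (i : Fin d) :
    0 < nd (m * α i) := by
  refine abs_pos.2 fun h => ?_
  have := li_rel hli (Fin.cons (-(round ((m : ℝ) * α i) : ℚ)) (Pi.single i (m : ℚ))) (by
    simp only [Fin.cons_zero, Fin.cons_succ]
    rw [Finset.sum_eq_single i]
    · simp; linarith
    · intro b _ hb; simp [hb]
    · simp)
  have h2 := congrFun this i.succ
  simp at h2
  omega

lemma wt {d : ℕ} {ε l : ℝ} (hε1 : ε ≤ 1) (hl : 0 ≤ l) (q : Fin d → ℝ)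
    (hq0 : ∀ i, 0 < q i) (hq1 : ∀ i, q i ≤ 1) (h : (1 + ε) * l + ∑ i, Real.log (q i) ≤ 0) :
    ∃ u : Fin (d + 1) → ℝ, u 0 = l ∧ (∀ i, q i ≤ Real.exp (u i.succ)) ∧ (∀ i, |u i| ≤ 2 * l) ∧
      ∑ i, u i ≤ -(ε * l) := by
  refine ⟨Fin.cons l fun i => max (Real.log (q i)) (-(2 * l)), by simp, fun i => ?_, fun i => ?_, ?_⟩
  · simp only [Fin.cons_succ]
    rw [← Real.log_le_iff_le_exp (hq0 i)]
    exact le_max_left _ _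
  · refine Fin.cases ?_ (fun i => ?_) i
    · simp only [Fin.cons_zero]; rw [abs_of_nonneg hl]; linarith
    · simp only [Fin.cons_succ]
      have := Real.log_nonpos (hq0 i).le (hq1 i)
      rw [abs_le]
      exact ⟨le_max_right _ _, max_le (by linarith) (by linarith)⟩
  · rw [Fin.sum_univ_succ]
    simp only [Fin.cons_zero, Fin.cons_succ]
    by_cases hc : ∀ i, -(2 * l) ≤ Real.log (q i)
    · rw [Finset.sum_congr rfl fun i _ => max_eq_left (hc i)]
      linarith
    · push Not at hc
      obtain ⟨j, hj⟩ := hc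
      rw [← Finset.add_sum_erase _ _ (mem_univ j), max_eq_right hj.le]
      have : ∑ x ∈ univ.erase j, max (Real.log (q x)) (-(2 * l)) ≤ 0 :=
        Finset.sum_nonpos fun i _ => max_le (Real.log_nonpos (hq0 i).le (hq1 i)) (by linarith)
      nlinarith

lemma schmidt_int {d : ℕ} (hd : 1 ≤ d) {α : Fin d → ℝ} (hintg : ∀ i, IsIntegral ℤ (α i))
    (hli : LinearIndependent ℚ (Fin.cons 1 α : Fin (d + 1) → ℝ)) {ε : ℝ} (hε : 0 < ε) (hε1 : ε ≤ 1) :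
    ∃ c > (0 : ℝ), ∀ m : ℕ, 1 ≤ m → c ≤ (m : ℝ) ^ (1 + ε) * ∏ i, nd (m * α i) := by
  by_contra hcon
  push Not at hcon
  have hpos : ∀ m : ℕ, 1 ≤ m → 0 < (m : ℝ) ^ (1 + ε) * ∏ i, nd (m * α i) := fun m hm =>
    mul_pos (Real.rpow_pos_of_pos (by exact_mod_cast hm) _) (prod_pos fun i _ => nd_pos hli hm i)
  have hmin : ∀ B : ℕ, ∃ c > (0 : ℝ), c ≤ 1 ∧ ∀ m : ℕ, 1 ≤ m → m ≤ B →
      c ≤ (m : ℝ) ^ (1 + ε) * ∏ i, nd (m * α i) := by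
    intro B
    induction B with
    | zero => exact ⟨1, one_pos, le_rfl, fun m h1 h2 => by omega⟩
    | succ B ih =>
      obtain ⟨c, hc, hc1, h⟩ := ih
      refine ⟨min c _, lt_min hc (hpos (B + 1) (by omega)), (min_le_left _ _).trans hc1, fun m h1 h2 => ?_⟩
      rcases Nat.lt_or_ge B m with h3 | h3
      · obtain rfl : m = B + 1 := by omega
        exact min_le_right _ _
      · exact (min_le_left _ _).trans (h m h1 h3)
  have hex : ∀ t : ℕ, ∃ m : ℕ, t + 2 ≤ m ∧ (m : ℝ) ^ (1 + ε) * ∏ i, nd (m * α i) < 1 := by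
    intro t
    obtain ⟨c, hc, hc1, h⟩ := hmin (t + 2)
    obtain ⟨m, hm, hlt⟩ := hcon c hc
    refine ⟨m, ?_, hlt.trans_le hc1⟩
    by_contra h2
    exact absurd (h m hm (by omega)) (not_le.2 hlt)
  choose m hm hlt using hex
  have hmR : ∀ t, (1 : ℝ) < m t := fun t => by exact_mod_cast (show 1 < m t by have := hm t; omega)
  have hmtend : Tendsto (fun t => (m t : ℝ)) atTop atTop := by
    refine tendsto_natCast_atTop_atTop.comp (tendsto_atTop_mono (fun t => ?_) tendsto_id)
    have := hm t; simp only [id]; omega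
  set ℓ : ℕ → ℝ := fun t => Real.log (m t) with hℓd
  have hℓ : Tendsto ℓ atTop atTop := Real.tendsto_log_atTop.comp hmtend
  have hℓ0 : ∀ t, 0 ≤ ℓ t := fun t => Real.log_nonneg (hmR t).le
  have hqp : ∀ t i, 0 < nd (m t * α i) := fun t i => nd_pos hli (by have := hm t; omega) i
  have hwt : ∀ t, _ := fun t => wt (d := d) hε1 (hℓ0 t) (fun i => nd (m t * α i)) (hqp t)
    (fun i => (abs_sub_round _).trans (by norm_num)) (by
      have h0 : (0 : ℝ) < m t := by linarith [hmR t]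
      have h1 := Real.log_nonpos (hpos (m t) (by have := hm t; omega)).le (hlt t).le
      rw [Real.log_mul (Real.rpow_pos_of_pos h0 _).ne' (prod_pos fun i _ => hqp t i).ne',
        Real.log_rpow h0, Real.log_prod fun i _ => (hqp t i).ne'] at h1
      exact h1)
  choose u hu0 huq hul hus using hwt
  have hfin : Module.Finite ℤ (Algebra.adjoin ℤ (Set.range α)) :=
    Module.Finite.iff_fg.2 (fg_adjoin_of_finite (Set.finite_range α) (by rintro _ ⟨i, rfl⟩; exact hintg i))
  have hfree : Module.Free ℤ (Algebra.adjoin ℤ (Set.range α)) := Module.free_of_finite_type_torsion_free'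
  set a : Fin d → Algebra.adjoin ℤ (Set.range α) :=
    fun i => ⟨α i, Algebra.subset_adjoin ⟨i, rfl⟩⟩ with ha
  set σ : ℕ → ℝ := fun t => (∑ i, u t i) / ((d + 1 : ℕ) : ℝ) with hσ
  have hn0 : (0 : ℝ) < ((d + 1 : ℕ) : ℝ) := by positivity
  have hσs : ∀ t, ((d + 1 : ℕ) : ℝ) * σ t = ∑ i, u t i := fun t => by
    simp only [hσ]; field_simp
  have hσb : ∀ t, |σ t| ≤ 2 * ℓ t := fun t => by
    have h1 : |∑ i, u t i| ≤ ((d + 1 : ℕ) : ℝ) * (2 * ℓ t) := by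
      refine (abs_sum_le_sum_abs _ _).trans ((sum_le_sum fun i _ => hul t i).trans ?_)
      simp
    rw [← hσs, abs_mul, abs_of_pos hn0] at h1
    exact le_of_mul_le_mul_left h1 hn0
  have hσ' : ∀ t, σ t ≤ -(ε / ((d + 1 : ℕ) : ℝ) * ℓ t) := fun t => by
    have h1 := hus t
    rw [← hσs] at h1
    refine le_of_mul_le_mul_left (h1.trans (le_of_eq ?_)) hn0
    field_simp
  obtain ⟨b, hb0, hb⟩ := subsp (n := d + 1) (by omega) (A := Algebra.adjoin ℤ (Set.range α))
    (Subalgebra.val _ : Algebra.adjoin ℤ (Set.range α) →ₐ[ℤ] ℝ).toRingHom (LM a) (LM α)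
    (by
      rw [LM_map]
      exact LM_sq α)
    (η := ε / ((d + 1 : ℕ) : ℝ)) (A' := 4) (by positivity) hℓ
    (fun t i => Real.exp (u t i - σ t)) (fun t i => Real.exp_pos _)
    (fun t => by
      rw [← Real.exp_sum, Finset.sum_sub_distrib, ← hσs]
      simp)
    (fun t i => by
      rw [Real.log_exp]
      have h1 := abs_sub (u t i) (σ t)
      linarith [hul t i, hσb t])
    (fun t => Fin.cons (m t : ℤ) fun i => round ((m t : ℝ) * α i))
    (fun t h => by
      have h1 := congrFun h 0
      simp at h1
      have := hm t
      omega)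
    (fun t i => by
      have key : ∀ v : ℝ, v ≤ Real.exp (u t i) →
          v ≤ Real.exp (u t i - σ t) * Real.exp (-(ε / ((d + 1 : ℕ) : ℝ) * ℓ t)) := fun v hv => by
        refine hv.trans ?_
        rw [← Real.exp_add]
        exact Real.exp_le_exp.2 (by linarith [hσ' t])
      refine key _ ?_
      clear key
      refine Fin.cases ?_ (fun i => ?_) i
      · rw [LM_zero α (fun k => ((Fin.cons (m t : ℤ) fun i => round ((m t : ℝ) * α i) : Fin (d + 1) → ℤ) k : ℝ))]
        rw [hu0, Real.exp_log (by linarith [hmR t])]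
        simp
      · rw [LM_succ α (fun k => ((Fin.cons (m t : ℤ) fun i => round ((m t : ℝ) * α i) : Fin (d + 1) → ℤ) k : ℝ))]
        refine le_trans (le_of_eq ?_) (huq t i)
        simp [nd, mul_comm])
  -- the final contradiction
  refine hb0 (li_rel hli b ?_)
  set s : ℝ := (b 0 : ℝ) + ∑ i : Fin d, (b i.succ : ℝ) * α i with hs
  by_contra hs0
  have hev : ∀ᶠ t in atTop, ∑ i : Fin d, |(b i.succ : ℝ)| < |s| * m t :=
    (hmtend.const_mul_atTop (abs_pos.2 hs0)).eventually_gt_atTop _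
  obtain ⟨t, ht1, ht2⟩ := (hb.and_eventually hev).exists
  rw [Fin.sum_univ_succ] at ht1
  simp only [Fin.cons_zero, Fin.cons_succ] at ht1
  have ht3 : (b 0 : ℝ) * m t + ∑ i : Fin d, (b i.succ : ℝ) * round ((m t : ℝ) * α i) = 0 := by
    exact_mod_cast congrArg (fun q : ℚ => (q : ℝ)) ht1
  have h4 : s * m t = ∑ i : Fin d, (b i.succ : ℝ) * ((m t : ℝ) * α i - round ((m t : ℝ) * α i)) := by
    simp only [mul_sub, Finset.sum_sub_distrib]
    rw [hs, add_mul, Finset.sum_mul]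
    rw [Finset.sum_congr rfl fun i _ => (by ring :
      (b i.succ : ℝ) * α i * m t = (b i.succ : ℝ) * ((m t : ℝ) * α i))]
    linarith
  have h5 : |s| * m t ≤ ∑ i : Fin d, |(b i.succ : ℝ)| := by
    rw [← abs_of_pos (show (0 : ℝ) < m t by linarith [hmR t]), ← abs_mul, h4]
    refine (abs_sum_le_sum_abs _ _).trans (sum_le_sum fun i _ => ?_)
    rw [abs_mul]
    exact mul_le_of_le_one_right (abs_nonneg _) ((abs_sub_round _).trans (by norm_num))
  linarith

lemma nd_mul_le (D : ℕ) (x : ℝ) : nd (D * x) ≤ D * nd x := by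
  refine (round_le ((D : ℝ) * x) (D * round x)).trans (le_of_eq ?_)
  rw [nd, ← abs_of_nonneg (Nat.cast_nonneg (α := ℝ) D), ← abs_mul, abs_of_nonneg (Nat.cast_nonneg (α := ℝ) D)]
  push_cast
  ring_nf

/-- Schmidt's theorem. -/
lemma schmidt {d : ℕ} (hd : 1 ≤ d) {α : Fin d → ℝ} (halg : ∀ i, IsAlgebraic ℚ (α i))
    (hli : LinearIndependent ℚ (Fin.cons 1 α : Fin (d + 1) → ℝ)) {ε : ℝ} (hε : 0 < ε) (hε1 : ε ≤ 1) :
    ∃ c > (0 : ℝ), ∀ m : ℕ, 1 ≤ m → c ≤ (m : ℝ) ^ (1 + ε) * ∏ i, nd (m * α i) := by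
  have h1 : ∀ i, ∃ y : ℤ, y ≠ 0 ∧ IsIntegral ℤ (y • α i) := fun i =>
    IsAlgebraic.exists_integral_multiple ((IsFractionRing.isAlgebraic_iff ℤ ℚ ℝ).2 (halg i))
  choose y hy0 hy using h1
  set D : ℕ := ∏ i, (y i).natAbs with hD
  have hD0 : 1 ≤ D := Nat.one_le_iff_ne_zero.2 (prod_ne_zero_iff.2 fun i _ => by simpa using hy0 i)
  have hDi : ∀ i, IsIntegral ℤ ((D : ℝ) * α i) := by
    intro i
    have h2 : (y i : ℤ) ∣ (D : ℤ) := by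
      rw [← Int.natAbs_dvd_natAbs, Int.natAbs_natCast]
      exact dvd_prod_of_mem _ (mem_univ i)
    obtain ⟨z, hz⟩ := h2
    have h3 : (D : ℝ) * α i = z • (y i • α i) := by
      have : (D : ℝ) = (y i : ℝ) * z := by exact_mod_cast congrArg (fun q : ℤ => (q : ℝ)) hz
      rw [this, zsmul_eq_mul, zsmul_eq_mul]; ring
    rw [h3]
    exact (hy i).smul z
  have hli' : LinearIndependent ℚ (Fin.cons 1 (fun i => (D : ℝ) * α i) : Fin (d + 1) → ℝ) := by
    refine rel_li fun a ha => ?_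
    have h2 := li_rel hli (Fin.cons (a 0) fun i => a i.succ * D) (by
      simp only [Fin.cons_zero, Fin.cons_succ]
      rw [← ha]
      push_cast
      simp only [mul_assoc])
    funext i
    refine Fin.cases ?_ (fun i => ?_) i
    · simpa using congrFun h2 0
    · have h3 := congrFun h2 i.succ
      simp only [Fin.cons_succ, Pi.zero_apply, mul_eq_zero, Nat.cast_eq_zero] at h3
      rcases h3 with h3 | h3
      · exact h3
      · omega
  obtain ⟨c, hc, h⟩ := schmidt_int hd hDi hli' hε hε1
  have hDp : (0 : ℝ) < (D : ℝ) ^ d := by positivity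
  refine ⟨c / (D : ℝ) ^ d, by positivity, fun m hm => ?_⟩
  rw [div_le_iff₀ hDp]
  refine (h m hm).trans ?_
  rw [mul_assoc]
  refine mul_le_mul_of_nonneg_left ?_ (Real.rpow_nonneg (Nat.cast_nonneg _) _)
  calc ∏ i, nd (m * ((D : ℝ) * α i)) ≤ ∏ i : Fin d, nd (m * α i) * D := by
        refine prod_le_prod (fun i _ => abs_nonneg _) fun i _ => ?_
        rw [mul_left_comm, mul_comm (nd _)]
        exact nd_mul_le D _
    _ = _ := by rw [prod_mul_distrib]; simp

end
end SchmidtPf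

namespace SchmidtPf
open Finset Filter Topology
noncomputable section
set_option linter.unusedSectionVars false
set_option linter.unusedVariables false
set_option linter.style.haveILetI false

lemma nd_sub_le (r m m' : ℕ) (h : m' = m + r) (x : ℝ) :
    nd (r * x) ≤ |((m' : ℝ) * x - round ((m' : ℝ) * x)) - ((m : ℝ) * x - round ((m : ℝ) * x))| := by
  refine (round_le _ (round ((m' : ℝ) * x) - round ((m : ℝ) * x))).trans (le_of_eq ?_)
  subst h
  push_cast
  ring_nf

lemma box_bd {d : ℕ} (hd : 1 ≤ d) {α : Fin d → ℝ} {c ε : ℝ} (hc : 0 < c) (hε : 0 < ε)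
    (hS : ∀ m : ℕ, 1 ≤ m → c ≤ (m : ℝ) ^ (1 + ε) * ∏ i, nd (m * α i)) {M : ℕ} (δ : Fin d → ℝ)
    (hδ : ∀ i, 0 < δ i) (S : Finset ℕ) (hSM : ∀ m ∈ S, 1 ≤ m ∧ m ≤ M)
    (hSδ : ∀ m ∈ S, ∀ i, nd (m * α i) ≤ δ i) :
    (S.card : ℝ) * c ≤ 5 * 2 ^ d * (M : ℝ) ^ (1 + ε) * ∏ i, δ i := by
  have hP : 0 < ∏ i, δ i := prod_pos fun i _ => hδ i
  rcases S.eq_empty_or_nonempty with rfl | ⟨m0, hm0⟩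
  · simp only [card_empty, Nat.cast_zero, zero_mul]; positivity
  have hpow : ∀ m : ℕ, m ≤ M → (m : ℝ) ^ (1 + ε) ≤ (M : ℝ) ^ (1 + ε) := fun m hm =>
    Real.rpow_le_rpow (Nat.cast_nonneg _) (by exact_mod_cast hm) (by linarith)
  set X : ℝ := (M : ℝ) ^ (1 + ε) with hX
  have hX0 : 0 ≤ X := Real.rpow_nonneg (Nat.cast_nonneg _) _
  have h1 : c ≤ X * ∏ i, δ i := (hS m0 (hSM _ hm0).1).trans
    (mul_le_mul (hpow _ (hSM _ hm0).2) (prod_le_prod (fun i _ => abs_nonneg _) fun i _ => hSδ _ hm0 i)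
      (prod_nonneg fun i _ => abs_nonneg _) hX0)
  set Y : ℝ := 2 ^ d * X * (∏ i, δ i) / c with hY
  have h2d : (1 : ℝ) ≤ 2 ^ d := one_le_pow₀ (by norm_num)
  have hYc : Y * c = 2 ^ d * X * ∏ i, δ i := by rw [hY]; field_simp
  have hY1 : 1 ≤ Y := by
    rw [hY, le_div_iff₀ hc]
    nlinarith
  set L : ℕ := ⌊Y⌋₊ + 1 with hL
  have hYL : Y < L := by rw [hL]; push_cast; exact Nat.lt_floor_add_one Y
  have hLY : (L : ℝ) ≤ Y + 1 := by rw [hL]; push_cast; linarith [Nat.floor_le (by linarith : 0 ≤ Y)]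
  have hL0 : (0 : ℝ) < L := by linarith
  set i0 : Fin d := ⟨0, hd⟩ with hi0
  set R : ℕ → Fin d → ℝ := fun m i => (m : ℝ) * α i - round ((m : ℝ) * α i) with hR
  have hRb : ∀ m ∈ S, ∀ i, |R m i| ≤ δ i := hSδ
  set f : ℕ → ℤ := fun m => ⌊(L : ℝ) * (R m i0 / δ i0)⌋ with hf
  have hkey : ∀ m ∈ S, ∀ m' ∈ S, f m = f m' → m < m' → False := by
    intro m hm m' hm' hff hlt
    obtain ⟨r, hr⟩ : ∃ r, m' = m + r := ⟨m' - m, by omega⟩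
    have hrM : r ≤ M := by have := (hSM m' hm').2; omega
    have h3 : ∀ i, nd (r * α i) ≤ (2 * δ i) * (if i = i0 then (L : ℝ)⁻¹ else 1) := by
      intro i
      refine (nd_sub_le r m m' hr (α i)).trans ?_
      change |R m' i - R m i| ≤ _
      split_ifs with hi
      · subst hi
        have h4 := Int.abs_sub_lt_one_of_floor_eq_floor hff
        rw [← mul_sub, ← sub_div, abs_mul, abs_div, abs_of_pos hL0, abs_of_pos (hδ i0), abs_sub_comm,
          ← mul_div_assoc, div_lt_one (hδ i0)] at h4
        rw [← div_eq_mul_inv, le_div_iff₀ hL0]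
        linarith [hδ i0]
      · rw [mul_one]
        refine (abs_sub _ _).trans ?_
        linarith [hRb m hm i, hRb m' hm' i]
    have h5 : ∏ i, nd (r * α i) ≤ 2 ^ d * (∏ i, δ i) * (L : ℝ)⁻¹ := by
      refine (prod_le_prod (fun i _ => abs_nonneg _) fun i _ => h3 i).trans (le_of_eq ?_)
      rw [prod_mul_distrib, prod_mul_distrib, prod_ite_eq']
      simp
    have h6 := (hS r (by omega)).trans (mul_le_mul (hpow r hrM) h5
      (prod_nonneg fun i _ => abs_nonneg _) hX0)
    have h7 : c * L ≤ Y * c := by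
      rw [hYc]
      calc c * L ≤ X * (2 ^ d * (∏ i, δ i) * (L : ℝ)⁻¹) * L :=
            mul_le_mul_of_nonneg_right h6 hL0.le
        _ = _ := by field_simp
    nlinarith
  have hinj : Set.InjOn f S := by
    intro m hm m' hm' h
    rcases lt_trichotomy m m' with h' | h' | h'
    · exact (hkey m hm m' hm' h h').elim
    · exact h'
    · exact (hkey m' hm' m hm h.symm h').elim
  have hmaps : Set.MapsTo f S (Finset.Icc (-(L : ℤ)) L : Finset ℤ) := by
    intro m hm
    have h8 := abs_le.1 (hRb m hm i0)
    have h9 : |R m i0 / δ i0| ≤ 1 := by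
      rw [abs_div, abs_of_pos (hδ i0), div_le_one (hδ i0)]; exact hRb m hm i0
    rw [abs_le] at h9
    simp only [coe_Icc, Set.mem_Icc, hf]
    constructor
    · rw [Int.le_floor]; push_cast; nlinarith
    · have : (⌊(L : ℝ) * (R m i0 / δ i0)⌋ : ℝ) ≤ L := (Int.floor_le _).trans (by nlinarith)
      exact_mod_cast this
  have hcard := Finset.card_le_card_of_injOn f hmaps hinj
  rw [Int.card_Icc] at hcard
  have hcR : (S.card : ℝ) ≤ 2 * L + 1 := by
    have : S.card ≤ 2 * L + 1 := by omega
    exact_mod_cast this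
  have : (S.card : ℝ) ≤ 5 * Y := by linarith
  calc (S.card : ℝ) * c ≤ 5 * Y * c := mul_le_mul_of_nonneg_right this hc.le
    _ = _ := by rw [mul_assoc, hYc]; ring

theorem main_bd (d : ℕ) (hd : 1 ≤ d) (α : Fin d → ℝ)
    (halg : ∀ i, IsAlgebraic ℚ (α i))
    (hli : LinearIndependent ℚ (Fin.cons 1 α : Fin (d + 1) → ℝ)) :
    ∀ ε > (0 : ℝ), ∃ K : ℝ, ∀ M : ℕ, 1 ≤ M →
      ∑ m ∈ Finset.Icc 1 M, (∏ i, nd ((m : ℝ) * α i))⁻¹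
        ≤ K * (M : ℝ) ^ (2 - 1 / (d : ℝ) + ε) := by
  intro ε hε
  have hd0 : (1 : ℝ) ≤ d := by exact_mod_cast hd
  set e : ℝ := min (ε / 2) 1 with he
  have he0 : 0 < e := lt_min (by linarith) one_pos
  have he1 : e ≤ 1 := min_le_right _ _
  have he2 : e ≤ ε / 2 := min_le_left _ _
  obtain ⟨c, hc, hS⟩ := schmidt hd halg hli he0 he1
  set ρ : ℝ := ε / (4 * d) with hρ
  have hρ0 : 0 < ρ := by positivity
  set C : ℝ := (c⁻¹) ^ ρ / ρ / Real.log 2 with hC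
  have hl2 : 0 < Real.log 2 := Real.log_pos (by norm_num)
  have hC0 : 0 ≤ C := by positivity
  refine ⟨(C + 1) ^ d * (5 * 4 ^ d / c), fun M hM => ?_⟩
  have hMR : (1 : ℝ) ≤ M := by exact_mod_cast hM
  have hM0 : (0 : ℝ) < M := by linarith
  have hq0 : ∀ m ∈ Icc 1 M, ∀ i, 0 < nd ((m : ℝ) * α i) := fun m hm i =>
    nd_pos hli (mem_Icc.1 hm).1 i
  have hq1 : ∀ (m : ℕ) i, nd ((m : ℝ) * α i) ≤ 1 := fun m i =>
    (abs_sub_round _).trans (by norm_num)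
  have hex : ∀ (m : ℕ) i, ∃ k : ℕ, m ∈ Icc 1 M → (2 : ℝ) ^ k ≤ (nd ((m : ℝ) * α i))⁻¹ ∧
      (nd ((m : ℝ) * α i))⁻¹ < 2 ^ (k + 1) := by
    intro m i
    by_cases hm : m ∈ Icc 1 M
    · obtain ⟨k, h1, h2⟩ := exists_nat_pow_near ((one_le_inv₀ (hq0 m hm i)).2 (hq1 m i))
        (one_lt_two : (1 : ℝ) < 2)
      exact ⟨k, fun _ => ⟨h1, h2⟩⟩
    · exact ⟨0, fun h => absurd h hm⟩
  choose k hk using hex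
  have hkb : ∀ m ∈ Icc 1 M, ∀ i, (k m i : ℝ) ≤ C * (M : ℝ) ^ (2 * ρ) := by
    intro m hm i
    have h1 : ∏ j, nd ((m : ℝ) * α j) ≤ nd ((m : ℝ) * α i) := by
      rw [← mul_prod_erase _ _ (mem_univ i)]
      exact mul_le_of_le_one_right (abs_nonneg _) (prod_le_one (fun j _ => abs_nonneg _) fun j _ => hq1 m j)
    have hmM : (m : ℝ) ≤ M := by exact_mod_cast (mem_Icc.1 hm).2
    have h2 : (m : ℝ) ^ (1 + e) ≤ (M : ℝ) ^ (2 : ℝ) :=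
      (Real.rpow_le_rpow (Nat.cast_nonneg _) hmM (by linarith)).trans
        (Real.rpow_le_rpow_of_exponent_le hMR (by linarith))
    have h3 : c ≤ (M : ℝ) ^ (2 : ℝ) * nd ((m : ℝ) * α i) := (hS m (mem_Icc.1 hm).1).trans
      (mul_le_mul h2 h1 (prod_nonneg fun j _ => abs_nonneg _) (by positivity))
    have h4 : (nd ((m : ℝ) * α i))⁻¹ ≤ c⁻¹ * (M : ℝ) ^ (2 : ℝ) := by
      rw [inv_le_iff_one_le_mul₀ (hq0 m hm i), mul_assoc, inv_mul_eq_div, one_le_div hc]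
      exact h3
    have h5 : (2 : ℝ) ^ k m i ≤ c⁻¹ * (M : ℝ) ^ (2 : ℝ) := (hk m i hm).1.trans h4
    have h6 := Real.log_le_log (by positivity) h5
    rw [Real.log_pow] at h6
    have h7 := Real.log_le_rpow_div (x := c⁻¹ * (M : ℝ) ^ (2 : ℝ)) (by positivity) hρ0
    rw [Real.mul_rpow (by positivity) (by positivity), ← Real.rpow_mul hM0.le] at h7
    have h8 := h6.trans h7
    rw [← le_div_iff₀ hl2] at h8
    refine h8.trans (le_of_eq ?_)
    rw [hC]; ring
  set B : ℕ := ⌊C * (M : ℝ) ^ (2 * ρ)⌋₊ + 1 with hB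
  have hMρ : (1 : ℝ) ≤ (M : ℝ) ^ (2 * ρ) := Real.one_le_rpow hMR (by positivity)
  have hBb : (B : ℝ) ≤ (C + 1) * (M : ℝ) ^ (2 * ρ) := by
    rw [hB]; push_cast
    linarith [Nat.floor_le (show 0 ≤ C * (M : ℝ) ^ (2 * ρ) by positivity)]
  have hmem : ∀ m ∈ Icc 1 M, k m ∈ Fintype.piFinset (fun _ : Fin d => range B) := by
    intro m hm
    rw [Fintype.mem_piFinset]
    intro i
    rw [mem_range, hB, Nat.lt_succ_iff]
    exact Nat.le_floor (hkb m hm i)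
  rw [← sum_fiberwise_of_maps_to hmem]
  have hbox : ∀ v ∈ Fintype.piFinset (fun _ : Fin d => range B),
      ∑ m ∈ Icc 1 M with k m = v, (∏ i, nd ((m : ℝ) * α i))⁻¹ ≤ 5 * 4 ^ d / c * (M : ℝ) ^ (1 + e) := by
    intro v _
    set S := {m ∈ Icc 1 M | k m = v} with hSd
    have hSm : ∀ m ∈ S, m ∈ Icc 1 M ∧ k m = v := fun m hm => by simpa [hSd] using hm
    have hb := box_bd hd hc he0 hS (M := M) (fun i => ((2 : ℝ) ^ v i)⁻¹) (fun i => by positivity) S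
      (fun m hm => mem_Icc.1 (hSm m hm).1) (fun m hm i => by
        have h1 := (hk m i (hSm m hm).1).1
        rw [(hSm m hm).2] at h1
        exact le_inv_of_le_inv₀ (by positivity) h1)
    have h2 : ∑ m ∈ S, (∏ i, nd ((m : ℝ) * α i))⁻¹ ≤ S.card • (2 ^ d * ∏ i, (2 : ℝ) ^ v i) := by
      refine sum_le_card_nsmul _ _ _ fun m hm => ?_
      rw [← prod_inv_distrib]
      refine (prod_le_prod (fun i _ => inv_nonneg.2 (abs_nonneg _)) fun i _ =>
        (hk m i (hSm m hm).1).2.le).trans (le_of_eq ?_)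
      rw [(hSm m hm).2]
      simp only [pow_succ]
      rw [prod_mul_distrib]
      simp [mul_comm]
    refine h2.trans ?_
    rw [nsmul_eq_mul]
    set Q := ∏ i, (2 : ℝ) ^ v i with hQ
    have hQ0 : 0 < Q := prod_pos fun i _ => by positivity
    rw [prod_inv_distrib, ← hQ] at hb
    have h3 : (S.card : ℝ) ≤ 5 * 2 ^ d * (M : ℝ) ^ (1 + e) * Q⁻¹ / c := (le_div_iff₀ hc).2 hb
    calc (S.card : ℝ) * (2 ^ d * Q) ≤ 5 * 2 ^ d * (M : ℝ) ^ (1 + e) * Q⁻¹ / c * (2 ^ d * Q) :=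
          mul_le_mul_of_nonneg_right h3 (by positivity)
      _ = 5 * (2 ^ d * 2 ^ d) / c * (M : ℝ) ^ (1 + e) := by field_simp
      _ = _ := by rw [← mul_pow]; norm_num
  refine (sum_le_card_nsmul _ _ _ hbox).trans ?_
  rw [nsmul_eq_mul, Fintype.card_piFinset]
  simp only [card_range, prod_const, card_univ, Fintype.card_fin, Nat.cast_pow]
  have h9 : (B : ℝ) ^ d ≤ (C + 1) ^ d * (M : ℝ) ^ (ε / 2) := by
    refine (pow_le_pow_left₀ (Nat.cast_nonneg _) hBb d).trans (le_of_eq ?_)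
    rw [mul_pow, ← Real.rpow_natCast ((M : ℝ) ^ (2 * ρ)), ← Real.rpow_mul hM0.le]
    congr 2
    rw [hρ]; field_simp; ring
  have h10 : (M : ℝ) ^ (ε / 2) * (M : ℝ) ^ (1 + e) ≤ (M : ℝ) ^ (2 - 1 / (d : ℝ) + ε) := by
    rw [← Real.rpow_add hM0]
    refine Real.rpow_le_rpow_of_exponent_le hMR ?_
    have : 1 / (d : ℝ) ≤ 1 := (div_le_one (by linarith)).2 hd0
    linarith
  calc (B : ℝ) ^ d * (5 * 4 ^ d / c * (M : ℝ) ^ (1 + e))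
      ≤ (C + 1) ^ d * (M : ℝ) ^ (ε / 2) * (5 * 4 ^ d / c * (M : ℝ) ^ (1 + e)) :=
        mul_le_mul_of_nonneg_right h9 (by positivity)
    _ = (C + 1) ^ d * (5 * 4 ^ d / c) * ((M : ℝ) ^ (ε / 2) * (M : ℝ) ^ (1 + e)) := by ring
    _ ≤ _ := mul_le_mul_of_nonneg_left h10 (by positivity)

end
end SchmidtPf


/-- `γ_d ≤ 2 - 1/d`, i.e. the sum of reciprocal products is
`O(M^{2-1/d+ε})` for algebraic numbers. -/
theorem stmt10 (d : ℕ) (hd : 1 ≤ d) (α : Fin d → ℝ)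
    (halg : ∀ i, IsAlgebraic ℚ (α i))
    (hli : LinearIndependent ℚ (Fin.cons 1 α : Fin (d + 1) → ℝ)) :
    ∀ ε > (0 : ℝ), ∃ K : ℝ, ∀ M : ℕ, 1 ≤ M →
      ∑ m ∈ Finset.Icc 1 M, (∏ i, |(m : ℝ) * α i - round ((m : ℝ) * α i)|)⁻¹
        ≤ K * (M : ℝ) ^ (2 - 1 / (d : ℝ) + ε) := by
  exact SchmidtPf.main_bd d hd α halg hli
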